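/- arXiv:1004.3472 — 2 statements merged into one kernel-verified Lean document; each statement's English description precedes it below -/
import Mathlib

section
/- Let Λ be a representation-infinite artin algebra. Then the set T of take-off GR measures for Λ (GR measures I such that only finitely many GR measures J satisfy J ≺ I) is nonempty and closed under direct successors and direct predecessors (so T is a GR segment), T is infinite, and (T, ≺) is order-isomorphic to (ℕ, <). In particular, the GR segment containing a take-off measure is ℕ-indexed. -/
/-- The Gabriel–Roiter total order on sets of natural numbers: `I ≺ J` iff
`I ≠ J` and the least element of the symmetric difference belongs to `J`.
(All sets occurring as Gabriel–Roiter measures consist of positive integers.) -/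
def GRlt (I J : Set ℕ) : Prop :=
  I ≠ J ∧ ∃ m ∈ (I \ J) ∪ (J \ I), (∀ k ∈ (I \ J) ∪ (J \ I), m ≤ k) ∧ m ∈ J

/-- `I ≼ J` iff `I = J` or `I ≺ J`. -/
def GRle (I J : Set ℕ) : Prop := I = J ∨ GRlt I J

/-- A module is indecomposable if it is nonzero and is not the internal direct
sum of two nonzero submodules. -/
def IsIndecomposableModule (Λ : Type*) [Ring Λ] (M : Type*) [AddCommGroup M]
    [Module Λ M] : Prop :=
  (⊤ : Submodule Λ M) ≠ ⊥ ∧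
    ¬ ∃ A B : Submodule Λ M, A ≠ ⊥ ∧ B ≠ ⊥ ∧ IsCompl A B

open Classical in
/-- The (composition series) length `|M|` of a finite length module `M`,
defined via a composition series from `⊥` to `⊤` (any two such have the same
length by the Jordan–Hölder theorem); it is `0` if no such series exists. -/
noncomputable def mlen (Λ : Type*) [Ring Λ] (M : Type*) [AddCommGroup M]
    [Module Λ M] : ℕ :=
  if h : ∃ s : CompositionSeries (Submodule Λ M), s.head = ⊥ ∧ s.last = ⊤ then
    h.choose.length
  else 0

/-- The collection of subsets of `ℕ` of the form `{|M₁|, …, |M_t|}` where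
`M₁ ⊂ M₂ ⊂ ⋯ ⊂ M_t` ranges over (finite, nonempty) chains of indecomposable
submodules of `M`. -/
def grChainSets (Λ : Type*) [Ring Λ] (M : Type*) [AddCommGroup M]
    [Module Λ M] : Set (Set ℕ) :=
  { S | ∃ (t : ℕ) (c : Fin (t + 1) → Submodule Λ M), StrictMono c ∧
      (∀ i, IsIndecomposableModule Λ (c i)) ∧
      S = Set.range fun i => mlen Λ (c i) }

open Classical in
/-- The Gabriel–Roiter measure `μ(M)`: the maximum, with respect to the total
order `≺`, of the sets of lengths of chains of indecomposable submodules of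
`M` (and `∅` if this maximum does not exist, e.g. for `M = 0`). -/
noncomputable def grMeasure (Λ : Type*) [Ring Λ] (M : Type*) [AddCommGroup M]
    [Module Λ M] : Set ℕ :=
  if h : ∃ S, S ∈ grChainSets Λ M ∧ ∀ S' ∈ grChainSets Λ M, GRle S' S then
    h.choose
  else ∅
universe u

/-- A bundled `Λ`-module (in the same universe as `Λ`). -/
structure BundledMod (Λ : Type u) [Ring Λ] : Type (u + 1) where
  carrier : Type u
  [isAddCommGroup : AddCommGroup carrier]
  [isModule : Module Λ carrier]

attribute [instance] BundledMod.isAddCommGroup BundledMod.isModule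

/-- `Λ` has finite representation type: there are only finitely many
isomorphism classes of indecomposable finitely generated `Λ`-modules, i.e.
there is a finite list of modules such that every indecomposable finitely
generated `Λ`-module is isomorphic to one of them. -/
def HasFiniteRepType (Λ : Type u) [Ring Λ] : Prop :=
  ∃ (n : ℕ) (rep : Fin n → BundledMod Λ),
    ∀ (M : Type u) (_ : AddCommGroup M) (_ : Module Λ M),
      Module.Finite Λ M → IsIndecomposableModule Λ M →
        ∃ i, Nonempty (M ≃ₗ[Λ] (rep i).carrier)

/-- `I` is a Gabriel–Roiter measure for `Λ` if `I = μ(M)` for some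
indecomposable finitely generated `Λ`-module `M`. -/
def IsGRMeasureOf (Λ : Type u) [Ring Λ] (I : Set ℕ) : Prop :=
  ∃ (M : Type u) (_ : AddCommGroup M) (_ : Module Λ M),
    Module.Finite Λ M ∧ IsIndecomposableModule Λ M ∧ grMeasure Λ M = I

/-- `J` is a direct successor of `I` (and `I` a direct predecessor of `J`):
both are GR measures for `Λ`, `I ≺ J`, and no GR measure lies strictly
between them. -/
def IsDirectSuccessor (Λ : Type u) [Ring Λ] (I J : Set ℕ) : Prop :=
  IsGRMeasureOf Λ I ∧ IsGRMeasureOf Λ J ∧ GRlt I J ∧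
    ¬ ∃ K, IsGRMeasureOf Λ K ∧ GRlt I K ∧ GRlt K J

/-- A GR segment: a nonempty set of GR measures closed under taking direct
successors and direct predecessors. -/
def IsGRSegment (Λ : Type u) [Ring Λ] (S : Set (Set ℕ)) : Prop :=
  S.Nonempty ∧ (∀ I ∈ S, IsGRMeasureOf Λ I) ∧
    ∀ I ∈ S, ∀ J, (IsDirectSuccessor Λ I J ∨ IsDirectSuccessor Λ J I) → J ∈ S

section MatlisDuality

universe v w

/-- For every maximal ideal `m` of `R`, the elements of `E` killed by `m` form an `R`-module
generated by any of its nonzero elements. -/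
def HasSimpleTorsion (R : Type v) [CommRing R] (E : Type w) [AddCommGroup E] [Module R E] : Prop :=
  ∀ m : Ideal R, m.IsMaximal → ∀ a b : E, (∀ r ∈ m, r • a = 0) → (∀ r ∈ m, r • b = 0) →
    a ≠ 0 → ∃ r : R, b = r • a

lemma hasSimpleTorsion_pi_residueFields (R : Type v) [CommRing R] :
    HasSimpleTorsion R ((m : MaximalSpectrum R) → R ⧸ m.asIdeal) := by
  intro m hm a b ha hb hne
  have key : ∀ c : (m : MaximalSpectrum R) → R ⧸ m.asIdeal, (∀ r ∈ m, r • c = 0) →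
      ∀ m' : MaximalSpectrum R, m' ≠ ⟨m, hm⟩ → c m' = 0 := by
    intro c hc m' hne
    have hnle : ¬ m ≤ m'.asIdeal := by
      intro hle
      exact hne (MaximalSpectrum.ext (hm.eq_of_le m'.isMaximal.ne_top hle).symm)
    obtain ⟨r, hr, hr'⟩ := Set.not_subset.mp hnle
    obtain ⟨s, t, ht, hs⟩ := m'.isMaximal.exists_inv hr'
    obtain ⟨x, hx⟩ := Ideal.Quotient.mk_surjective (c m')
    have h1 : r • c m' = 0 := congrFun (hc r hr) m'
    rw [← hx]
    rw [← hx, ← Ideal.Quotient.mk_eq_mk, ← Submodule.Quotient.mk_smul,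
      Submodule.Quotient.mk_eq_zero] at h1
    rw [Ideal.Quotient.eq_zero_iff_mem]
    have : x = s * (r • x) + t * x := by
      rw [smul_eq_mul, ← mul_assoc, ← add_mul, hs, one_mul]
    rw [this]
    exact add_mem (Ideal.mul_mem_left _ _ h1) (Ideal.mul_mem_right _ _ ht)
  have ham : a ⟨m, hm⟩ ≠ 0 := by
    intro h0
    refine hne (funext fun m' => ?_)
    by_cases h : m' = ⟨m, hm⟩
    · subst h; exact h0
    · exact key a ha m' h
  obtain ⟨x, hx⟩ := Ideal.Quotient.mk_surjective (a ⟨m, hm⟩)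
  obtain ⟨y, hy⟩ := Ideal.Quotient.mk_surjective (b ⟨m, hm⟩)
  have hxm : x ∉ m := by
    intro h
    exact ham (by rw [← hx]; exact Ideal.Quotient.eq_zero_iff_mem.mpr h)
  obtain ⟨s, t, ht, hs⟩ := hm.exists_inv hxm
  refine ⟨y * s, funext fun m' => ?_⟩
  by_cases h : m' = ⟨m, hm⟩
  · subst h
    change _ = (y * s) • a ⟨m, hm⟩
    rw [← hx, ← hy]
    change _ = Ideal.Quotient.mk m ((y * s) * x)
    rw [Ideal.Quotient.eq]
    have : y - y * s * x = y * t := by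
      linear_combination (-y) * hs
    rw [this]
    exact Ideal.mul_mem_left _ _ ht
  · change _ = (y * s) • a m'
    rw [key a ha m' h, key b hb m' h, smul_zero]

lemma length_hom_le_one_of_isSimpleModule {R : Type v} [CommRing R] {E : Type w} [AddCommGroup E]
    [Module R E] (hE : HasSimpleTorsion R E) (N : Type*) [AddCommGroup N] [Module R N]
    [IsSimpleModule R N] : Module.length R (N →ₗ[R] E) ≤ 1 := by
  by_cases hs : Subsingleton (N →ₗ[R] E)
  · simp [Module.length_eq_zero]
  rw [not_subsingleton_iff_nontrivial] at hs
  have : IsSimpleModule R (N →ₗ[R] E) := by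
    have := IsSimpleModule.nontrivial R N
    obtain ⟨n, hn⟩ := exists_ne (0 : N)
    have hgen : ∀ x : N, ∃ r : R, r • n = x := by
      intro x
      have := IsSimpleModule.toSpanSingleton_surjective R hn x
      simpa using this
    let m : Ideal R := LinearMap.ker (LinearMap.toSpanSingleton R N n)
    have hm : m.IsMaximal := IsSimpleModule.ker_toSpanSingleton_isMaximal R hn
    have hm0 : ∀ r ∈ m, r • n = 0 := fun r hr => by simpa [m] using hr
    rw [isSimpleModule_iff_toSpanSingleton_surjective]
    refine ⟨hs, fun f hf g => ?_⟩
    have hfn : f n ≠ 0 := by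
      intro h0
      refine hf (LinearMap.ext fun x => ?_)
      obtain ⟨r, rfl⟩ := hgen x
      simp [h0]
    obtain ⟨r, hr⟩ := hE m hm (f n) (g n) (fun r hr => by rw [← map_smul, hm0 r hr, map_zero])
      (fun r hr => by rw [← map_smul, hm0 r hr, map_zero]) hfn
    refine ⟨r, LinearMap.ext fun x => ?_⟩
    obtain ⟨s, rfl⟩ := hgen x
    simp only [LinearMap.toSpanSingleton_apply, LinearMap.smul_apply, map_smul, hr]
  exact (Module.length_eq_one_iff.mpr this).le

lemma length_hom_le {R : Type v} [CommRing R] {E : Type w} [AddCommGroup E]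
    [Module R E] (hE : HasSimpleTorsion R E) {N : Type*} [AddCommGroup N] [Module R N]
    (hN : IsFiniteLength R N) : Module.length R (N →ₗ[R] E) ≤ Module.length R N := by
  induction hN with
  | @of_subsingleton M _ _ _ =>
    have : Subsingleton (M →ₗ[R] E) := ⟨fun f g => LinearMap.ext fun x => by
      rw [Subsingleton.elim x 0, map_zero, map_zero]⟩
    simp [Module.length_eq_zero]
  | @of_simple_quotient M _ _ N' _ hN' ih =>
    let res : (M →ₗ[R] E) →ₗ[R] (N' →ₗ[R] E) := LinearMap.lcomp R E N'.subtype
    let infl : ((M ⧸ N') →ₗ[R] E) →ₗ[R] (M →ₗ[R] E) := LinearMap.lcomp R E N'.mkQ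
    have h1 := Module.length_eq_add_of_exact (LinearMap.ker res).subtype res.rangeRestrict
      (Submodule.subtype_injective _) (LinearMap.surjective_rangeRestrict _)
      (by rw [LinearMap.exact_iff]; simp)
    have h2 := Module.length_eq_add_of_exact N'.subtype N'.mkQ
      (Submodule.subtype_injective _) (Submodule.mkQ_surjective _)
      (by rw [LinearMap.exact_iff]; simp)
    rw [h1, h2, add_comm]
    refine add_le_add ((Module.length_le_of_injective (LinearMap.range res).subtype
      (Submodule.subtype_injective _)).trans ih) ?_
    rw [(Module.length_eq_one_iff (R := R) (M := M ⧸ N')).mpr inferInstance]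
    refine le_trans (Module.length_le_of_surjective
      (infl.codRestrict (LinearMap.ker res) fun f => ?_) ?_)
      (length_hom_le_one_of_isSimpleModule hE (M ⧸ N'))
    · refine LinearMap.mem_ker.mpr (LinearMap.ext fun x => ?_)
      change f (N'.mkQ x) = 0
      rw [Submodule.mkQ_apply, (Submodule.Quotient.mk_eq_zero N').mpr x.2, map_zero]
    · rintro ⟨f, hf⟩
      refine ⟨N'.liftQ f fun x hx => ?_, ?_⟩
      · exact LinearMap.congr_fun (show res f = 0 from hf) ⟨x, hx⟩
      · ext x
        rfl

/-- An artinian commutative ring has a module of finite length (an injective hull of the sum of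
all simple modules) which is an injective cogenerator and yields a duality. -/
lemma exists_dualizing_module (R : Type v) [CommRing R] [IsArtinianRing R] :
    ∃ (E : Type v) (_ : AddCommGroup E) (_ : Module R E),
      Module.Baer R E ∧ HasSimpleTorsion R E ∧
      ∀ m : Ideal R, m.IsMaximal → ∃ e : E, e ≠ 0 ∧ ∀ r ∈ m, r • e = 0 := by
  let S := (m : MaximalSpectrum R) → R ⧸ m.asIdeal
  have := ModuleCat.enoughInjectives.{v} R
  let I : ModuleCat.{v} R := CategoryTheory.Injective.under (ModuleCat.of R S)
  have hinj : CategoryTheory.Injective (ModuleCat.of R I) :=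
    inferInstanceAs (CategoryTheory.Injective (CategoryTheory.Injective.under (ModuleCat.of R S)))
  let j : S →ₗ[R] I := (CategoryTheory.Injective.ι (ModuleCat.of R S)).hom
  have hj : Function.Injective j :=
    (ModuleCat.mono_iff_injective (CategoryTheory.Injective.ι (ModuleCat.of R S))).mp inferInstance
  have hI : Module.Baer R I :=
    Module.Baer.of_injective (Module.injective_module_of_injective_object R I)
  obtain ⟨B, hB⟩ : ∃ B : Submodule R I, Maximal (fun B => Disjoint (LinearMap.range j) B) B := by
    obtain ⟨B, -, hB⟩ := zorn_le_nonempty₀ {B : Submodule R I | Disjoint (LinearMap.range j) B}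
      (fun c hc hchain y hy => ⟨sSup c, by
        simp only [Set.mem_ofPred_eq]
        rw [hchain.directedOn.disjoint_sSup_right]
        exact fun b hb => hc hb, fun z hz => le_sSup hz⟩) ⊥ disjoint_bot_right
    exact ⟨B, hB⟩
  let p : I →ₗ[R] (I ⧸ B) := B.mkQ
  have hpj : Function.Injective (p ∘ₗ j) := by
    rw [← LinearMap.ker_eq_bot, LinearMap.ker_eq_bot']
    intro s hs
    have : j s ∈ B := by simpa [p] using hs
    have := (Submodule.disjoint_def.mp hB.prop) _ ⟨s, rfl⟩ this
    exact hj (by rw [this, map_zero])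
  have hess : ∀ U : Submodule R (I ⧸ B), U ≠ ⊥ → ∃ s : S, s ≠ 0 ∧ (p ∘ₗ j) s ∈ U := by
    intro U hU
    by_contra! hcon
    have hdis : Disjoint (LinearMap.range j) (U.comap p) := by
      rw [Submodule.disjoint_def]
      rintro _ ⟨s, rfl⟩ hs
      by_cases h : s = 0
      · rw [h, map_zero]
      · exact absurd hs (hcon s h)
    have hle : B ≤ U.comap p := by
      intro b hb
      have : p b = 0 := by simpa [p] using hb
      simp [this]
    have heq := hB.eq_of_le hdis hle
    apply hU
    rw [← Submodule.map_comap_eq_of_surjective (Submodule.mkQ_surjective B) U]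
    change (U.comap p).map p = ⊥
    rw [← heq]
    simp [p]
  have hST := hasSimpleTorsion_pi_residueFields R
  have hE : HasSimpleTorsion R (I ⧸ B) := by
    intro m hm a b ha hb hne
    have key : ∀ c : I ⧸ B, (∀ r ∈ m, r • c = 0) → ∃ s : S, (p ∘ₗ j) s = c := by
      intro c hc
      by_cases h0 : c = 0
      · exact ⟨0, by rw [map_zero, h0]⟩
      obtain ⟨s, hs, hmem⟩ := hess (R ∙ c) (by simpa using h0)
      obtain ⟨r, hr⟩ := Submodule.mem_span_singleton.mp hmem
      have hrm : r ∉ m := by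
        intro h
        rw [hc r h] at hr
        exact hs (hpj (by rw [← hr, map_zero]))
      obtain ⟨t, u, hu, ht⟩ := hm.exists_inv hrm
      refine ⟨t • s, ?_⟩
      rw [map_smul, ← hr, smul_smul]
      calc (t * r) • c = (t * r) • c + u • c := by rw [hc u hu, add_zero]
        _ = c := by rw [← add_smul, ht, one_smul]
    obtain ⟨s, rfl⟩ := key a ha
    obtain ⟨t, rfl⟩ := key b hb
    obtain ⟨r, hr⟩ := hST m hm s t
      (fun r hr => hpj (by rw [map_smul, map_zero]; exact ha r hr))
      (fun r hr => hpj (by rw [map_smul, map_zero]; exact hb r hr))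
      (fun h => hne (by rw [h, map_zero]))
    exact ⟨r, by rw [hr, map_smul]⟩
  refine ⟨I ⧸ B, inferInstance, inferInstance, ?_, hE, ?_⟩
  · obtain ⟨i, hi⟩ := hI.extension_property (p ∘ₗ j) hpj j
    have hinj : Function.Injective (p ∘ₗ i) := by
      rw [← LinearMap.ker_eq_bot]
      by_contra hne
      obtain ⟨s, hs, hs'⟩ := hess _ hne
      apply hs
      apply hpj
      rw [map_zero]
      have h1 : i ((p ∘ₗ j) s) = j s := LinearMap.congr_fun hi s
      have h2 : p (i ((p ∘ₗ j) s)) = 0 := hs'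
      rw [h1] at h2
      exact h2
    have hlen : Module.length R (I ⧸ B) ≠ ⊤ := by
      have h1 := length_hom_le hE (N := R)
        (isFiniteLength_iff_isNoetherian_isArtinian.mpr ⟨inferInstance, inferInstance⟩)
      rw [(LinearMap.ringLmapEquivSelf R R (I ⧸ B)).length_eq] at h1
      exact ne_top_of_le_ne_top Module.length_ne_top h1
    rw [Module.length_ne_top_iff, isFiniteLength_iff_isNoetherian_isArtinian] at hlen
    have := hlen.2
    have hbij := IsArtinian.bijective_of_injective_endomorphism _ hinj
    let e := LinearEquiv.ofBijective _ hbij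
    intro J g
    obtain ⟨g', hg'⟩ := hI J (i ∘ₗ e.symm.toLinearMap ∘ₗ g)
    refine ⟨p ∘ₗ g', fun x hx => ?_⟩
    rw [LinearMap.comp_apply, hg' x hx]
    exact e.apply_symm_apply (g ⟨x, hx⟩)
  · intro m hm
    classical
    let s : S := Pi.single ⟨m, hm⟩ 1
    have hsm : s ⟨m, hm⟩ = 1 := Pi.single_eq_same _ _
    have hs : s ≠ 0 := by
      intro h
      have : Nontrivial (R ⧸ m) := Ideal.Quotient.nontrivial_iff.mpr hm.ne_top
      exact one_ne_zero (hsm.symm.trans (congrFun h ⟨m, hm⟩))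
    refine ⟨(p ∘ₗ j) s, fun h => hs (hpj (by rw [h, map_zero])), fun r hr => ?_⟩
    rw [← map_smul]
    have : r • s = 0 := by
      funext m'
      by_cases h : m' = ⟨m, hm⟩
      · subst h
        change r • s ⟨m, hm⟩ = 0
        rw [hsm, ← map_one (Ideal.Quotient.mk m), ← Ideal.Quotient.mk_eq_mk,
          ← Submodule.Quotient.mk_smul, Submodule.Quotient.mk_eq_zero]
        simpa using hr
      · change r • s m' = 0
        rw [show s m' = 0 from Pi.single_eq_of_ne h _, smul_zero]
    rw [this, map_zero]

/-- Over a ring, a Baer module containing every simple module cogenerates all modules. -/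
lemma exists_functional_ne_zero {R : Type v} [CommRing R] {E : Type w} [AddCommGroup E]
    [Module R E] (hB : Module.Baer R E)
    (hS : ∀ m : Ideal R, m.IsMaximal → ∃ e : E, e ≠ 0 ∧ ∀ r ∈ m, r • e = 0)
    {N : Type*} [AddCommGroup N] [Module R N] {n : N} (hn : n ≠ 0) :
    ∃ θ : N →ₗ[R] E, θ n ≠ 0 := by
  let k : Ideal R := LinearMap.ker (LinearMap.toSpanSingleton R N n)
  have hk : k ≠ ⊤ := by
    intro h
    have : (1 : R) ∈ k := by rw [h]; trivial
    exact hn (by simpa [k] using this)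
  obtain ⟨m, hm, hkm⟩ := Ideal.exists_le_maximal k hk
  obtain ⟨e, he, hme⟩ := hS m hm
  let q : (R ⧸ k) →ₗ[R] N := k.liftQ (LinearMap.toSpanSingleton R N n) le_rfl
  have hq : Function.Injective q := by
    rw [← LinearMap.ker_eq_bot]
    exact Submodule.ker_liftQ_eq_bot _ _ _ le_rfl
  let t : (R ⧸ k) →ₗ[R] E := k.liftQ (LinearMap.toSpanSingleton R E e)
    (fun r hr => by simpa using hme r (hkm hr))
  obtain ⟨θ, hθ⟩ := hB.extension_property q hq t
  refine ⟨θ, ?_⟩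
  have h1 : θ (q (k.mkQ 1)) = t (k.mkQ 1) := LinearMap.congr_fun hθ _
  have h2 : q (k.mkQ 1) = n := by
    rw [← LinearMap.comp_apply, Submodule.liftQ_mkQ, LinearMap.toSpanSingleton_apply, one_smul]
  have h3 : t (k.mkQ 1) = e := by
    rw [← LinearMap.comp_apply, Submodule.liftQ_mkQ, LinearMap.toSpanSingleton_apply, one_smul]
  rwa [← h2, h1, h3]

/-- Every functional on the dual of a module of finite length is an evaluation. -/
lemma exists_eq_eval {R : Type v} [CommRing R] {E : Type w} [AddCommGroup E]
    [Module R E] (hB : Module.Baer R E) (hT : HasSimpleTorsion R E)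
    (hS : ∀ m : Ideal R, m.IsMaximal → ∃ e : E, e ≠ 0 ∧ ∀ r ∈ m, r • e = 0)
    {N : Type*} [AddCommGroup N] [Module R N] (hN : IsFiniteLength R N)
    (η : (N →ₗ[R] E) →ₗ[R] E) : ∃ x : N, ∀ φ : N →ₗ[R] E, η φ = φ x := by
  let ev : N →ₗ[R] ((N →ₗ[R] E) →ₗ[R] E) := LinearMap.id.flip
  have hev : Function.Injective ev := by
    rw [← LinearMap.ker_eq_bot, LinearMap.ker_eq_bot']
    intro n hn
    by_contra h
    obtain ⟨θ, hθ⟩ := exists_functional_ne_zero hB hS h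
    exact hθ (LinearMap.congr_fun hn θ)
  have h1 := length_hom_le hT hN
  have hfin : IsFiniteLength R (N →ₗ[R] E) := by
    rw [← Module.length_ne_top_iff] at hN ⊢
    exact ne_top_of_le_ne_top hN h1
  have h2 := (length_hom_le hT hfin).trans h1
  have hfin2 : IsFiniteLength R ((N →ₗ[R] E) →ₗ[R] E) := by
    rw [← Module.length_ne_top_iff] at hN ⊢
    exact ne_top_of_le_ne_top hN h2
  rw [isFiniteLength_iff_isNoetherian_isArtinian] at hfin2
  have := hfin2.1
  have := hfin2.2
  have htop : LinearMap.range ev = ⊤ := by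
    by_contra hne
    have h3 := Submodule.length_lt hne
    rw [← (LinearEquiv.ofInjective ev hev).length_eq] at h3
    exact absurd h3 (not_lt.mpr h2)
  obtain ⟨x, hx⟩ := LinearMap.range_eq_top.mp htop η
  exact ⟨x, fun φ => by rw [← hx]; rfl⟩

end MatlisDuality

section LeftAlmostSplit

/-- In the endomorphism ring of an indecomposable module of finite length, if a sum is injective
then one of the summands is. -/
lemma injective_or_injective_of_add {Λ : Type*} [Ring Λ] {X : Type*} [AddCommGroup X]
    [Module Λ X] [IsNoetherian Λ X] [IsArtinian Λ X] (hX : IsIndecomposableModule Λ X)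
    {f g : X →ₗ[Λ] X} (hfg : Function.Injective (f + g)) :
    Function.Injective f ∨ Function.Injective g := by
  let e := LinearEquiv.ofBijective _ (IsArtinian.bijective_of_injective_endomorphism _ hfg)
  let f' : Module.End Λ X := e.symm.toLinearMap ∘ₗ f
  have hf' : ∀ x, f' x = x - e.symm (g x) := by
    intro x
    apply e.injective
    simp only [f', LinearMap.comp_apply, LinearEquiv.coe_coe, LinearEquiv.apply_symm_apply, map_sub]
    simp [e]
  obtain ⟨n, hn, hc⟩ := ((Filter.eventually_ge_atTop 1).and
    (LinearMap.eventually_isCompl_ker_pow_range_pow f')).exists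
  by_cases hk : LinearMap.ker (f' ^ n) = ⊥
  · left
    intro x y hxy
    have h1 : f' x = f' y := by simp [f', hxy]
    apply LinearMap.ker_eq_bot.mp hk
    obtain ⟨k, rfl⟩ := Nat.exists_eq_succ_of_ne_zero (Nat.one_le_iff_ne_zero.mp hn)
    rw [pow_succ, Module.End.mul_apply, Module.End.mul_apply, h1]
  · right
    have hr : LinearMap.range (f' ^ n) = ⊥ := by
      by_contra h
      exact hX.2 ⟨_, _, hk, h, hc⟩
    rw [← LinearMap.ker_eq_bot, LinearMap.ker_eq_bot']
    intro x hx
    have h1 : f' x = x := by rw [hf', hx, map_zero, sub_zero]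
    have h2 : ∀ k : ℕ, (f' ^ k) x = x := by
      intro k
      induction k with
      | zero => simp
      | succ k ih => rw [pow_succ, Module.End.mul_apply, h1, ih]
    have h3 := LinearMap.mem_range_self (f' ^ n) x
    rwa [hr, h2, Submodule.mem_bot] at h3

universe v w

/-- The linear system attached to generators of the annihilator of a dual family is solvable along
every map which is not a split monomorphism. -/
lemma exists_solution_of_not_split {R : Type v} [CommRing R] {E : Type w} [AddCommGroup E]
    [Module R E] (hB : Module.Baer R E) (hT : HasSimpleTorsion R E)
    (hS : ∀ m : Ideal R, m.IsMaximal → ∃ e : E, e ≠ 0 ∧ ∀ r ∈ m, r • e = 0)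
    {Λ : Type*} [Ring Λ] [Algebra R Λ] {X : Type*} [AddCommGroup X] [Module R X] [Module Λ X]
    [IsScalarTower R Λ X] [IsArtinian Λ X] (hX : IsFiniteLength R X) {d e : ℕ}
    (φ : Fin d → X →ₗ[R] E) (hφ : ∀ ψ : X →ₗ[R] E, ∃ r : Fin d → R, ∑ l, r l • φ l = ψ)
    (x' : Fin d → X) (a : Fin d → Fin e → Λ)
    (hK : ∀ c : Fin d → Λ, (∀ x, ∑ l, φ l (c l • x) = 0) →
      ∃ s : Fin e → R, ∀ l, c l = ∑ j, s j • a l j)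
    (hΩ : ∀ f : X →ₗ[Λ] X, ¬ Function.Injective f → ∑ l, φ l (f (x' l)) = 0)
    {M : Type*} [AddCommGroup M] [Module R M] [Module Λ M] [IsScalarTower R Λ M]
    (h : X →ₗ[Λ] M) (hh : ¬ ∃ r : M →ₗ[Λ] X, r ∘ₗ h = LinearMap.id) :
    ∃ y : Fin e → M, ∀ l, h (x' l) = ∑ j, a l j • y j := by
  by_contra hno
  let Φ : (Fin e → M) →ₗ[R] (Fin d → M) :=
    LinearMap.pi fun l => ∑ j, (Algebra.lsmul R R M (a l j)) ∘ₗ LinearMap.proj j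
  have hΦ : ∀ y l, Φ y l = ∑ j, a l j • y j := fun y l => by simp [Φ]
  have hn : (LinearMap.range Φ).mkQ (fun l => h (x' l)) ≠ 0 := by
    rw [Submodule.mkQ_apply, Ne, Submodule.Quotient.mk_eq_zero]
    rintro ⟨y, hy⟩
    exact hno ⟨y, fun l => by rw [← hΦ, hy]⟩
  obtain ⟨θ', hθ'⟩ := exists_functional_ne_zero hB hS hn
  let θ : Fin d → M →ₗ[R] E :=
    fun l => θ' ∘ₗ (LinearMap.range Φ).mkQ ∘ₗ LinearMap.single R (fun _ => M) l
  have hθ : ∀ v : Fin d → M, θ' ((LinearMap.range Φ).mkQ v) = ∑ l, θ l (v l) := by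
    intro v
    conv_lhs => rw [← Finset.univ_sum_single v]
    rw [map_sum, map_sum]
    rfl
  have hθK : ∀ c : Fin d → Λ, (∀ x, ∑ l, φ l (c l • x) = 0) → ∀ m, ∑ l, θ l (c l • m) = 0 := by
    intro c hc m
    obtain ⟨s, hs⟩ := hK c hc
    have : (fun l => c l • m) = Φ (fun j => s j • m) := by
      funext l
      rw [hΦ, hs, Finset.sum_smul]
      refine Finset.sum_congr rfl fun j _ => ?_
      rw [smul_assoc, smul_comm]
    rw [← hθ (fun l => c l • m), this, Submodule.mkQ_apply,
      (Submodule.Quotient.mk_eq_zero _).mpr (LinearMap.mem_range_self Φ _), map_zero]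
  have hφext : ∀ x y : X, (∀ l, φ l x = φ l y) → x = y := by
    intro x y hxy
    by_contra hne
    obtain ⟨ψ, hψ⟩ := exists_functional_ne_zero hB hS (sub_ne_zero.mpr hne)
    obtain ⟨r, rfl⟩ := hφ ψ
    exact hψ (by simp [hxy])
  have hF : ∀ m : M, ∃ x : X, ∀ l, φ l x = θ l m := by
    intro m
    let p := Fintype.linearCombination R φ
    have hp : Function.Surjective p := fun ψ => by
      obtain ⟨r, hr⟩ := hφ ψ
      exact ⟨r, by rw [← hr]; rfl⟩
    let q := Fintype.linearCombination R (fun l => θ l m)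
    have hpq : LinearMap.ker p ≤ LinearMap.ker q := by
      intro r hr
      have h1 := hθK (fun l => algebraMap R Λ (r l)) (fun x => by
        have := LinearMap.congr_fun (show p r = 0 from hr) x
        simpa [p, Fintype.linearCombination_apply] using this) m
      simpa [q, Fintype.linearCombination_apply] using h1
    obtain ⟨x, hx⟩ := exists_eq_eval hB hT hS hX
      ((LinearMap.ker p).liftQ q hpq ∘ₗ (LinearMap.quotKerEquivOfSurjective p hp).symm.toLinearMap)
    refine ⟨x, fun l => ?_⟩
    have h1 : p (Pi.single l 1) = φ l := by simp [p]
    have h2 : q (Pi.single l 1) = θ l m := by simp [q]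
    rw [← hx, ← h1, ← h2, LinearMap.comp_apply, LinearEquiv.coe_coe]
    have h3 : (LinearMap.quotKerEquivOfSurjective p hp).symm (p (Pi.single l 1)) =
        (LinearMap.ker p).mkQ (Pi.single l 1) := by
      rw [LinearEquiv.symm_apply_eq]
      rfl
    rw [h3]
    rfl
  choose F hF using hF
  let f : M →ₗ[Λ] X :=
    { toFun := F
      map_add' := fun m m' => hφext _ _ fun l => by simp [hF]
      map_smul' := fun lam m => hφext _ _ fun l => by
        obtain ⟨s, hs⟩ := hφ (φ l ∘ₗ Algebra.lsmul R R X lam)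
        have hs' : ∀ x, φ l (lam • x) = ∑ k, s k • φ k x := fun x => by
          have := LinearMap.congr_fun hs x
          simpa using this.symm
        have h1 := hθK (fun k => Pi.single (M := fun _ => Λ) l lam k - algebraMap R Λ (s k))
          (fun x => by
            simp only [sub_smul, map_sub, Finset.sum_sub_distrib, algebraMap_smul, map_smul]
            rw [← hs' x, Finset.sum_eq_single l]
            · simp
            · intro k _ hk; simp [Pi.single_eq_of_ne hk]
            · simp) m
        simp only [sub_smul, map_sub, Finset.sum_sub_distrib, algebraMap_smul, map_smul] at h1
        rw [Finset.sum_eq_single l (fun k _ hk => by simp [Pi.single_eq_of_ne hk]) (by simp),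
          Pi.single_eq_same] at h1
        rw [RingHom.id_apply, hF, hs', sub_eq_zero.mp h1]
        simp [hF] }
  have hinj : ¬ Function.Injective (f ∘ₗ h) := by
    intro hi
    let u := LinearEquiv.ofBijective _ (IsArtinian.bijective_of_injective_endomorphism _ hi)
    exact hh ⟨u.symm.toLinearMap ∘ₗ f, LinearMap.ext fun x => u.symm_apply_apply x⟩
  have h1 := hΩ _ hinj
  have h2 : ∑ l, φ l ((f ∘ₗ h) (x' l)) = ∑ l, θ l (h (x' l)) :=
    Finset.sum_congr rfl fun l _ => hF _ l
  exact hθ' (by rw [hθ, ← h2, h1])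

/-- A trace-like form on the endomorphism ring of an indecomposable module vanishing on all
non-injective endomorphisms. -/
lemma exists_form_vanishing_on_radical {R : Type v} [CommRing R] {E : Type w} [AddCommGroup E]
    [Module R E] (hB : Module.Baer R E)
    (hS : ∀ m : Ideal R, m.IsMaximal → ∃ e : E, e ≠ 0 ∧ ∀ r ∈ m, r • e = 0)
    {Λ : Type*} [Ring Λ] [Algebra R Λ] {X : Type*} [AddCommGroup X] [Module R X] [Module Λ X]
    [IsScalarTower R Λ X] [IsNoetherian Λ X] [IsArtinian Λ X] (hX : IsIndecomposableModule Λ X)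
    [Module.Finite R X] {d : ℕ}
    (φ : Fin d → X →ₗ[R] E) (hφ : ∀ ψ : X →ₗ[R] E, ∃ r : Fin d → R, ∑ l, r l • φ l = ψ) :
    ∃ x' : Fin d → X, ∑ l, φ l (x' l) ≠ 0 ∧
      ∀ f : X →ₗ[Λ] X, ¬ Function.Injective f → ∑ l, φ l (f (x' l)) = 0 := by
  have hX0 : Nontrivial X := by
    by_contra h
    rw [not_nontrivial_iff_subsingleton] at h
    exact hX.1 (Subsingleton.elim _ _)
  let J : Submodule R (X →ₗ[Λ] X) :=
    { carrier := {f | ¬ Function.Injective f}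
      add_mem' := fun {f g} hf hg hfg => (injective_or_injective_of_add hX hfg).elim hf hg
      zero_mem' := fun h => by
        obtain ⟨x, hx⟩ := exists_ne (0 : X)
        exact hx (h (by simp))
      smul_mem' := fun r f hf h => hf fun x y hxy => h (by simp [hxy]) }
  have h1 : J.mkQ LinearMap.id ≠ 0 := by
    rw [Submodule.mkQ_apply, Ne, Submodule.Quotient.mk_eq_zero]
    exact fun h => h Function.injective_id
  obtain ⟨θ, hθ⟩ := exists_functional_ne_zero hB hS h1
  obtain ⟨c, x, hx⟩ := Module.Finite.exists_fin (R := R) (M := X)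
  let ev : (X →ₗ[Λ] X) →ₗ[R] (Fin c → X) :=
    { toFun := fun f k => f (x k)
      map_add' := fun _ _ => rfl
      map_smul' := fun _ _ => rfl }
  have hev : Function.Injective ev := by
    intro f g hfg
    have : f.restrictScalars R = g.restrictScalars R := by
      refine LinearMap.ext_on hx ?_
      rintro _ ⟨k, rfl⟩
      exact congrFun hfg k
    exact LinearMap.ext fun y => LinearMap.congr_fun this y
  obtain ⟨ω, hω⟩ := hB.extension_property ev hev (θ ∘ₗ J.mkQ)
  choose r hr using fun k => hφ (ω ∘ₗ LinearMap.single R (fun _ => X) k)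
  have key : ∀ f : X →ₗ[Λ] X, ∑ l, φ l (f (∑ k, r k l • x k)) = θ (J.mkQ f) := by
    intro f
    rw [← LinearMap.comp_apply θ, ← hω, LinearMap.comp_apply,
      ← Finset.univ_sum_single (ev f), map_sum]
    simp only [map_sum]
    rw [Finset.sum_comm]
    refine Finset.sum_congr rfl fun k _ => ?_
    have := LinearMap.congr_fun (hr k) (f (x k))
    simp only [LinearMap.sum_apply, LinearMap.smul_apply] at this
    rw [show ω (Pi.single k (ev f k)) = (ω ∘ₗ LinearMap.single R (fun _ => X) k) (f (x k)) from rfl,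
      ← this]
    exact Finset.sum_congr rfl fun l _ => by
      rw [LinearMap.map_smul_of_tower, map_smul]
  refine ⟨fun l => ∑ k, r k l • x k, ?_, fun f hf => ?_⟩
  · have := key LinearMap.id
    simp only [LinearMap.id_apply] at this
    rw [this]
    exact hθ
  · rw [key, Submodule.mkQ_apply, (Submodule.Quotient.mk_eq_zero J).mpr hf, map_zero]

/-- A finite linear system which is unsolvable over an indecomposable module `X` but becomes
solvable along every map out of `X` that is not a split monomorphism. -/
lemma exists_system_solvable_of_not_split (R : Type v) [CommRing R] [IsArtinianRing R]
    (Λ : Type u) [Ring Λ] [Algebra R Λ] [Module.Finite R Λ] (X : Type u) [AddCommGroup X]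
    [Module Λ X] [Module.Finite Λ X] (hX : IsIndecomposableModule Λ X) :
    ∃ (d e : ℕ) (x' : Fin d → X) (a : Fin d → Fin e → Λ),
      (¬ ∃ y : Fin e → X, ∀ l, x' l = ∑ j, a l j • y j) ∧
      ∀ (M : Type u) [AddCommGroup M] [Module Λ M] (h : X →ₗ[Λ] M),
        (¬ ∃ r : M →ₗ[Λ] X, r ∘ₗ h = LinearMap.id) →
        ∃ y : Fin e → M, ∀ l, h (x' l) = ∑ j, a l j • y j := by
  have tower : ∀ (M : Type u) [AddCommGroup M] [Module Λ M],
      let := Module.compHom M (algebraMap R Λ)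
      IsScalarTower R Λ M := by
    intro M _ _
    let := Module.compHom M (algebraMap R Λ)
    refine ⟨fun r l m => ?_⟩
    rw [Algebra.smul_def, mul_smul]
    rfl
  let : Module R X := Module.compHom X (algebraMap R Λ)
  have : IsScalarTower R Λ X := tower X
  have : Module.Finite R X := Module.Finite.trans Λ X
  have : IsNoetherian Λ X := isNoetherian_of_tower R inferInstance
  have : IsArtinian Λ X := isArtinian_of_tower R inferInstance
  have hfl : IsFiniteLength R X :=
    isFiniteLength_iff_isNoetherian_isArtinian.mpr ⟨inferInstance, inferInstance⟩
  obtain ⟨E, _, _, hB, hT, hS⟩ := exists_dualizing_module R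
  have hD : Module.Finite R (X →ₗ[R] E) := by
    have h1 : Module.length R (X →ₗ[R] E) ≠ ⊤ :=
      ne_top_of_le_ne_top (Module.length_ne_top_iff.mpr hfl) (length_hom_le hT hfl)
    have := (isFiniteLength_iff_isNoetherian_isArtinian.mp (Module.length_ne_top_iff.mp h1)).1
    infer_instance
  obtain ⟨d, φ, hφ⟩ := Module.Finite.exists_fin (R := R) (M := X →ₗ[R] E)
  have hφ' : ∀ ψ : X →ₗ[R] E, ∃ r : Fin d → R, ∑ l, r l • φ l = ψ := fun ψ =>
    (Submodule.mem_span_range_iff_exists_fun R).mp (hφ ▸ Submodule.mem_top)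
  obtain ⟨x', hx1, hx2⟩ := exists_form_vanishing_on_radical hB hS hX φ hφ'
  let K : Submodule R (Fin d → Λ) :=
    { carrier := {c | ∀ x, ∑ l, φ l (c l • x) = 0}
      add_mem' := fun {c c'} hc hc' x => by
        simp [add_smul, Finset.sum_add_distrib, hc x, hc' x]
      zero_mem' := fun x => by simp
      smul_mem' := fun r c hc x => by
        simp [smul_assoc, ← Finset.smul_sum, hc x] }
  obtain ⟨e, a, ha⟩ := Submodule.fg_iff_exists_fin_generating_family.mp (IsNoetherian.noetherian K)
  have haK : ∀ j, a j ∈ K := fun j => ha ▸ Submodule.subset_span ⟨j, rfl⟩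
  refine ⟨d, e, x', fun l j => a j l, ?_, fun M _ _ h hh => ?_⟩
  · rintro ⟨y, hy⟩
    apply hx1
    simp only [hy, map_sum]
    rw [Finset.sum_comm]
    exact Finset.sum_eq_zero fun j _ => haK j (y j)
  · let : Module R M := Module.compHom M (algebraMap R Λ)
    have : IsScalarTower R Λ M := tower M
    refine exists_solution_of_not_split hB hT hS hfl φ hφ' x' (fun l j => a j l)
      (fun c hc => ?_) hx2 h hh
    obtain ⟨s, hs⟩ := (Submodule.mem_span_range_iff_exists_fun R).mp
      (ha ▸ (show c ∈ K from hc) : c ∈ Submodule.span R (Set.range a))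
    exact ⟨s, fun l => by simp [← hs]⟩

/-- Every indecomposable finitely generated module over an artin algebra has a left almost split
map. -/
lemma exists_leftAlmostSplit (R : Type v) [CommRing R] [IsArtinianRing R]
    (Λ : Type u) [Ring Λ] [Algebra R Λ] [Module.Finite R Λ] (X : Type u) [AddCommGroup X]
    [Module Λ X] [Module.Finite Λ X] (hX : IsIndecomposableModule Λ X) :
    ∃ (W : Type u) (_ : AddCommGroup W) (_ : Module Λ W) (f : X →ₗ[Λ] W), Module.Finite Λ W ∧
      (¬ ∃ r : W →ₗ[Λ] X, r ∘ₗ f = LinearMap.id) ∧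
      ∀ (M : Type u) [AddCommGroup M] [Module Λ M] (h : X →ₗ[Λ] M),
        (¬ ∃ r : M →ₗ[Λ] X, r ∘ₗ h = LinearMap.id) → ∃ g : W →ₗ[Λ] M, g ∘ₗ f = h := by
  obtain ⟨d, e, x', a, h1, h2⟩ := exists_system_solvable_of_not_split R Λ X hX
  let S : Submodule Λ (X × (Fin e → Λ)) := Submodule.span Λ (Set.range fun l => (x' l, -a l))
  refine ⟨(X × (Fin e → Λ)) ⧸ S, inferInstance, inferInstance,
    S.mkQ ∘ₗ LinearMap.inl Λ X (Fin e → Λ), inferInstance, ?_, fun M _ _ h hh => ?_⟩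
  · rintro ⟨r, hr⟩
    apply h1
    refine ⟨fun j => r (S.mkQ (0, Pi.single j 1)), fun l => ?_⟩
    have h3 : S.mkQ (x' l, -a l) = 0 := by
      rw [Submodule.mkQ_apply, Submodule.Quotient.mk_eq_zero]
      exact Submodule.subset_span ⟨l, rfl⟩
    have h4 : ((x' l, -a l) : X × (Fin e → Λ)) =
        LinearMap.inl Λ X (Fin e → Λ) (x' l) - LinearMap.inr Λ X (Fin e → Λ) (a l) := by
      simp
    have h5 : LinearMap.inr Λ X (Fin e → Λ) (a l) =
        ∑ j, a l j • ((0, Pi.single j 1) : X × (Fin e → Λ)) := by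
      conv_lhs => rw [pi_eq_sum_univ' (a l), map_sum]
      refine Finset.sum_congr rfl fun j _ => ?_
      rw [map_smul]
      congr 2
    have h6 := congrArg r h3
    rw [h4, map_sub, map_sub, map_zero, sub_eq_zero, h5, map_sum, map_sum] at h6
    simp only [map_smul] at h6
    rw [← h6]
    exact (LinearMap.congr_fun hr (x' l)).symm
  · obtain ⟨y, hy⟩ := h2 M h hh
    refine ⟨S.liftQ (h.coprod (Fintype.linearCombination Λ y)) ?_, ?_⟩
    · rw [Submodule.span_le]
      rintro _ ⟨l, rfl⟩
      simp [hy, Fintype.linearCombination_apply]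
    · ext x
      simp

end LeftAlmostSplit

section GabrielRoiterOrder

lemma GRlt_iff {I J : Set ℕ} :
    GRlt I J ↔ ∃ m, m ∈ J ∧ m ∉ I ∧ ∀ k < m, (k ∈ I ↔ k ∈ J) := by
  constructor
  · rintro ⟨-, m, hm, hmin, hmJ⟩
    refine ⟨m, hmJ, fun hmI => ?_, fun k hk => ?_⟩
    · rcases hm with h | h
      · exact h.2 hmJ
      · exact h.2 hmI
    · by_contra h
      refine absurd (hmin k ?_) (not_le.mpr hk)
      simp only [Set.mem_union, Set.mem_sdiff]
      tauto
  · rintro ⟨m, hmJ, hmI, h⟩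
    refine ⟨fun h' => hmI (h' ▸ hmJ), m, Or.inr ⟨hmJ, hmI⟩, fun k hk => ?_, hmJ⟩
    by_contra hlt
    have := h k (not_le.mp hlt)
    simp only [Set.mem_union, Set.mem_sdiff] at hk
    tauto

lemma GRlt_irrefl (I : Set ℕ) : ¬ GRlt I I := fun h => h.1 rfl

lemma GRlt_trans {I J K : Set ℕ} (h₁ : GRlt I J) (h₂ : GRlt J K) : GRlt I K := by
  rw [GRlt_iff] at *
  obtain ⟨m, hmJ, hmI, hm⟩ := h₁
  obtain ⟨n, hnK, hnJ, hn⟩ := h₂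
  rcases lt_trichotomy m n with h | rfl | h
  · exact ⟨m, (hn m h).mp hmJ, hmI, fun k hk => (hm k hk).trans (hn k (hk.trans h))⟩
  · exact absurd hmJ hnJ
  · exact ⟨n, hnK, fun h' => hnJ ((hm n h).mp h'), fun k hk => (hm k (hk.trans h)).trans (hn k hk)⟩

lemma GRlt_trichotomy (I J : Set ℕ) : GRlt I J ∨ I = J ∨ GRlt J I := by
  classical
  by_cases h : ∃ m, ¬ (m ∈ I ↔ m ∈ J)
  · have h1 := Nat.find_spec h
    have h2 : ∀ k < Nat.find h, (k ∈ I ↔ k ∈ J) := fun k hk => not_not.mp (Nat.find_min h hk)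
    by_cases h3 : Nat.find h ∈ I
    · exact Or.inr (Or.inr (GRlt_iff.mpr
        ⟨Nat.find h, h3, fun h4 => h1 ⟨fun _ => h4, fun _ => h3⟩, fun k hk => (h2 k hk).symm⟩))
    · refine Or.inl (GRlt_iff.mpr ⟨Nat.find h, ?_, h3, h2⟩)
      by_contra h4
      exact h1 ⟨fun h5 => absurd h5 h3, fun h5 => absurd h5 h4⟩
  · push Not at h
    exact Or.inr (Or.inl (Set.ext h))

lemma GRlt_asymm {I J : Set ℕ} (h : GRlt I J) : ¬ GRlt J I :=
  fun h' => GRlt_irrefl I (GRlt_trans h h')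

lemma GRlt_of_GRlt_of_GRle {I J K : Set ℕ} (h₁ : GRlt I J) (h₂ : GRle J K) : GRlt I K :=
  h₂.elim (fun h => h ▸ h₁) fun h => GRlt_trans h₁ h

lemma GRle_trans {I J K : Set ℕ} (h₁ : GRle I J) (h₂ : GRle J K) : GRle I K :=
  h₁.elim (fun h => h ▸ h₂) fun h => Or.inr (GRlt_of_GRlt_of_GRle h h₂)

lemma not_GRlt {I J : Set ℕ} : ¬ GRlt I J ↔ GRle J I := by
  constructor
  · intro h
    rcases GRlt_trichotomy I J with h' | rfl | h'
    · exact absurd h' h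
    · exact Or.inl rfl
    · exact Or.inr h'
  · intro h h'
    exact GRlt_irrefl _ (GRlt_of_GRlt_of_GRle h' h)

lemma GRle_total (I J : Set ℕ) : GRle I J ∨ GRle J I := by
  rcases GRlt_trichotomy I J with h | h | h
  · exact Or.inl (Or.inr h)
  · exact Or.inl (Or.inl h)
  · exact Or.inr (Or.inr h)

lemma empty_GRlt {I : Set ℕ} (h : I.Nonempty) : GRlt ∅ I := by
  classical
  refine GRlt_iff.mpr ⟨Nat.find h, Nat.find_spec h, by simp, fun k hk => ?_⟩
  simpa using Nat.find_min h hk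

lemma GRlt_insert {I : Set ℕ} {x : ℕ} (hx : x ∉ I) : GRlt I (insert x I) :=
  GRlt_iff.mpr ⟨x, by simp, hx, fun k hk => by simp [hk.ne]⟩

lemma insert_GRlt {I J : Set ℕ} {x : ℕ} (h : GRlt I J) (hJ : ∀ k ∈ J, k < x) :
    GRlt (insert x I) J := by
  obtain ⟨m, hmJ, hmI, hm⟩ := GRlt_iff.mp h
  have hmx := hJ m hmJ
  refine GRlt_iff.mpr ⟨m, hmJ, by simp [hmI, hmx.ne], fun k hk => ?_⟩
  rw [← hm k hk]
  simp [(hk.trans hmx).ne]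

lemma exists_relation_max {α : Type*} (r : α → α → Prop) (htot : ∀ a b, r a b ∨ r b a)
    (htrans : ∀ a b c, r a b → r b c → r a c) {s : Set α} (hs : s.Finite) (hne : s.Nonempty) :
    ∃ m ∈ s, ∀ x ∈ s, r x m := by
  induction s, hs using Set.Finite.induction_on with
  | empty => exact absurd hne Set.not_nonempty_empty
  | @insert a s _ _ ih =>
    have hrefl : ∀ a, r a a := fun a => (htot a a).elim id id
    rcases s.eq_empty_or_nonempty with rfl | h
    · exact ⟨a, by simp, by simpa using hrefl a⟩
    obtain ⟨m, hm, hmax⟩ := ih h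
    rcases htot a m with h1 | h1
    · refine ⟨m, Or.inr hm, ?_⟩
      rintro x (rfl | hx)
      exacts [h1, hmax x hx]
    · refine ⟨a, Or.inl rfl, ?_⟩
      rintro x (rfl | hx)
      exacts [hrefl x, htrans _ _ _ (hmax x hx) h1]

lemma exists_GR_max {s : Set (Set ℕ)} (hs : s.Finite) (hne : s.Nonempty) :
    ∃ m ∈ s, ∀ x ∈ s, GRle x m :=
  exists_relation_max GRle GRle_total (fun _ _ _ => GRle_trans) hs hne

lemma exists_GR_min {s : Set (Set ℕ)} (hs : s.Finite) (hne : s.Nonempty) :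
    ∃ m ∈ s, ∀ x ∈ s, GRle m x :=
  exists_relation_max (fun a b => GRle b a) (fun a b => GRle_total b a)
    (fun _ _ _ h₁ h₂ => GRle_trans h₂ h₁) hs hne

end GabrielRoiterOrder

section Length

variable {Λ : Type*} [Ring Λ] {M N : Type*} [AddCommGroup M] [Module Λ M] [AddCommGroup N]
  [Module Λ N]

lemma natCast_mlen [IsNoetherian Λ M] [IsArtinian Λ M] : (mlen Λ M : ℕ∞) = Module.length Λ M := by
  have h : ∃ s : CompositionSeries (Submodule Λ M), s.head = ⊥ ∧ s.last = ⊤ :=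
    exists_compositionSeries_of_isNoetherian_isArtinian Λ M
  rw [mlen, dif_pos h]
  exact Module.length_compositionSeries _ h.choose_spec.1 h.choose_spec.2

lemma mlen_le_of_injective [IsNoetherian Λ M] [IsArtinian Λ M] [IsNoetherian Λ N] [IsArtinian Λ N]
    (f : M →ₗ[Λ] N) (hf : Function.Injective f) : mlen Λ M ≤ mlen Λ N := by
  have := Module.length_le_of_injective f hf
  rw [← natCast_mlen, ← natCast_mlen] at this
  exact_mod_cast this

lemma mlen_le_of_surjective [IsNoetherian Λ M] [IsArtinian Λ M] [IsNoetherian Λ N] [IsArtinian Λ N]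
    (f : M →ₗ[Λ] N) (hf : Function.Surjective f) : mlen Λ N ≤ mlen Λ M := by
  have := Module.length_le_of_surjective f hf
  rw [← natCast_mlen, ← natCast_mlen] at this
  exact_mod_cast this

lemma mlen_congr [IsNoetherian Λ M] [IsArtinian Λ M] [IsNoetherian Λ N] [IsArtinian Λ N]
    (e : M ≃ₗ[Λ] N) : mlen Λ M = mlen Λ N :=
  (mlen_le_of_injective e.toLinearMap e.injective).antisymm
    (mlen_le_of_injective e.symm.toLinearMap e.symm.injective)

lemma mlen_ker_add_mlen_range [IsNoetherian Λ M] [IsArtinian Λ M] (f : M →ₗ[Λ] N) :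
    mlen Λ M = mlen Λ (LinearMap.ker f) + mlen Λ (LinearMap.range f) := by
  have : IsNoetherian Λ (LinearMap.range f) := isNoetherian_of_surjective f.rangeRestrict
    (LinearMap.range_rangeRestrict f)
  have : IsArtinian Λ (LinearMap.range f) := isArtinian_of_surjective M f.rangeRestrict
    (LinearMap.surjective_rangeRestrict f)
  have h1 := Module.length_eq_add_of_exact (LinearMap.ker f).subtype f.rangeRestrict
    (Submodule.subtype_injective _) (LinearMap.surjective_rangeRestrict _)
    (by rw [LinearMap.exact_iff]; simp)
  rw [← natCast_mlen, ← natCast_mlen, ← natCast_mlen] at h1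
  exact_mod_cast h1

lemma mlen_eq_zero_iff [IsNoetherian Λ M] [IsArtinian Λ M] : mlen Λ M = 0 ↔ Subsingleton M := by
  rw [← Module.length_eq_zero_iff (R := Λ), ← natCast_mlen]
  simp

lemma mlen_lt_of_lt [IsNoetherian Λ M] [IsArtinian Λ M] {U V : Submodule Λ M} (h : U < V) :
    mlen Λ U < mlen Λ V := by
  have h1 := mlen_ker_add_mlen_range ((U.comap V.subtype).mkQ)
  rw [Submodule.ker_mkQ, mlen_congr (Submodule.comapSubtypeEquivOfLe h.le)] at h1
  have h2 : mlen Λ (LinearMap.range (U.comap V.subtype).mkQ) ≠ 0 := by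
    rw [Ne, mlen_eq_zero_iff, Submodule.subsingleton_iff_eq_bot, LinearMap.range_eq_bot]
    intro h3
    have h4 := congrArg LinearMap.ker h3
    rw [Submodule.ker_mkQ, LinearMap.ker_zero, Submodule.comap_subtype_eq_top] at h4
    exact absurd h4 (not_le_of_gt h)
  omega

lemma mlen_top [IsNoetherian Λ M] [IsArtinian Λ M] : mlen Λ (⊤ : Submodule Λ M) = mlen Λ M :=
  mlen_congr Submodule.topEquiv

lemma mlen_submodule_lt [IsNoetherian Λ M] [IsArtinian Λ M] {U : Submodule Λ M} (h : U ≠ ⊤) :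
    mlen Λ U < mlen Λ M :=
  (mlen_lt_of_lt (lt_top_iff_ne_top.mpr h)).trans_eq mlen_top

lemma mlen_submodule_le [IsNoetherian Λ M] [IsArtinian Λ M] (U : Submodule Λ M) :
    mlen Λ U ≤ mlen Λ M :=
  mlen_le_of_injective U.subtype U.subtype_injective

lemma mlen_range_lt [IsNoetherian Λ M] [IsArtinian Λ M] {f : M →ₗ[Λ] N}
    (hf : ¬ Function.Injective f) : mlen Λ (LinearMap.range f) < mlen Λ M := by
  have h1 := mlen_ker_add_mlen_range f
  have h2 : mlen Λ (LinearMap.ker f) ≠ 0 := by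
    rw [Ne, mlen_eq_zero_iff, Submodule.subsingleton_iff_eq_bot, LinearMap.ker_eq_bot]
    exact hf
  omega

end Length

section Indecomposable

variable {Λ : Type*} [Ring Λ] {M N : Type*} [AddCommGroup M] [Module Λ M] [AddCommGroup N]
  [Module Λ N]

lemma IsIndecomposableModule.nontrivial (h : IsIndecomposableModule Λ M) : Nontrivial M := by
  by_contra h'
  rw [not_nontrivial_iff_subsingleton] at h'
  exact h.1 (Subsingleton.elim _ _)

lemma IsIndecomposableModule.of_equiv (e : M ≃ₗ[Λ] N) (h : IsIndecomposableModule Λ M) :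
    IsIndecomposableModule Λ N := by
  have := h.nontrivial
  have : Nontrivial N := e.symm.toEquiv.nontrivial
  refine ⟨top_ne_bot, ?_⟩
  rintro ⟨A, B, hA, hB, hAB⟩
  let o := Submodule.orderIsoMapComap e.symm
  exact h.2 ⟨o A, o B, by rwa [Ne, map_eq_bot_iff],
    by rwa [Ne, map_eq_bot_iff], (o.isCompl_iff).mp hAB⟩

/-- A nonzero retract of an indecomposable module is the whole module. -/
lemma IsIndecomposableModule.bijective_of_retraction [Nontrivial M]
    (h : IsIndecomposableModule Λ N) {f : M →ₗ[Λ] N} {r : N →ₗ[Λ] M}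
    (hr : r ∘ₗ f = LinearMap.id) : Function.Bijective f := by
  have hr' : ∀ x, r (f x) = x := fun x => LinearMap.congr_fun hr x
  have hinj : Function.Injective f := Function.LeftInverse.injective hr'
  refine ⟨hinj, ?_⟩
  have hc : IsCompl (LinearMap.range f) (LinearMap.ker r) := by
    refine IsCompl.of_le ?_ ?_
    · rintro _ ⟨⟨x, rfl⟩, hx⟩
      have : x = 0 := by rw [← hr' x]; exact hx
      simp [this]
    · intro y _
      rw [Submodule.mem_sup]
      exact ⟨f (r y), LinearMap.mem_range_self f _, y - f (r y), by simp [hr'], by simp⟩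
  have hk : LinearMap.ker r = ⊥ := by
    by_contra hk
    refine h.2 ⟨_, _, ?_, hk, hc⟩
    rw [Ne, LinearMap.range_eq_bot]
    rintro rfl
    obtain ⟨x, hx⟩ := exists_ne (0 : M)
    exact hx (hinj (by simp))
  rw [← LinearMap.range_eq_top]
  simpa [hk] using hc.sup_eq_top

/-- Every module of finite length is a finite direct sum of indecomposable submodules. -/
lemma exists_indecomposable_decomposition (Λ : Type*) [Ring Λ] (M : Type*) [AddCommGroup M]
    [Module Λ M] [IsNoetherian Λ M] [IsArtinian Λ M] :
    ∃ (ι : Type) (_ : Fintype ι) (Z : ι → Submodule Λ M) (p : ∀ i, M →ₗ[Λ] Z i),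
      (∀ i, IsIndecomposableModule Λ (Z i)) ∧ ∀ x, ∑ i, (p i x : M) = x := by
  suffices H : ∀ U : Submodule Λ M, ∃ (ι : Type) (_ : Fintype ι) (Z : ι → Submodule Λ M)
      (p : ∀ i, U →ₗ[Λ] Z i), (∀ i, IsIndecomposableModule Λ (Z i)) ∧
        ∀ x, ∑ i, (p i x : M) = x by
    obtain ⟨ι, hι, Z, p, hZ, hp⟩ := H ⊤
    exact ⟨ι, hι, Z, fun i => p i ∘ₗ Submodule.topEquiv.symm.toLinearMap, hZ,
      fun x => hp ⟨x, trivial⟩⟩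
  intro U
  induction U using WellFoundedLT.induction with
  | ind U ih =>
  by_cases h0 : U = ⊥
  · subst h0
    exact ⟨Empty, inferInstance, fun e => e.elim, fun e => e.elim, fun e => e.elim, fun x => by
      simp [((Submodule.mem_bot Λ).mp x.2)]⟩
  by_cases hU : IsIndecomposableModule Λ U
  · exact ⟨Unit, inferInstance, fun _ => U, fun _ => LinearMap.id, fun _ => hU, fun x => by simp⟩
  have hU' : ∃ A B : Submodule Λ U, A ≠ ⊥ ∧ B ≠ ⊥ ∧ IsCompl A B := by
    by_contra h
    refine hU ⟨fun h' => h0 ?_, h⟩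
    exact Submodule.subsingleton_iff_eq_bot.mp
      ((Submodule.subsingleton_iff Λ).mp (subsingleton_of_bot_eq_top h'.symm))
  obtain ⟨A, B, hA, hB, hAB⟩ := hU'
  have hlt : ∀ A B : Submodule Λ U, B ≠ ⊥ → IsCompl A B → A.map U.subtype < U := by
    intro A B hB hAB
    refine lt_of_le_of_ne (Submodule.map_subtype_le U A) fun h => hB ?_
    have : A = ⊤ := by
      apply Submodule.map_injective_of_injective U.subtype_injective
      rw [h, Submodule.map_subtype_top]
    rw [this] at hAB
    exact hAB.disjoint.eq_bot_of_ge le_top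
  obtain ⟨ι, _, Z, p, hZ, hp⟩ := ih _ (hlt A B hB hAB)
  obtain ⟨κ, _, Y, q, hY, hq⟩ := ih _ (hlt B A hA hAB.symm)
  let π (A B : Submodule Λ U) (h : IsCompl A B) : U →ₗ[Λ] A.map U.subtype :=
    (Submodule.equivMapOfInjective U.subtype U.subtype_injective A).toLinearMap ∘ₗ
      A.projectionOnto B h
  refine ⟨ι ⊕ κ, inferInstance, Sum.elim Z Y,
    fun i => match i with
      | Sum.inl i => p i ∘ₗ π A B hAB
      | Sum.inr i => q i ∘ₗ π B A hAB.symm, ?_, fun x => ?_⟩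
  · rintro (i | i)
    exacts [hZ i, hY i]
  · rw [Fintype.sum_sum_type]
    refine (congrArg₂ (· + ·) (hp (π A B hAB x)) (hq (π B A hAB.symm x))).trans ?_
    exact congrArg Subtype.val (Submodule.projection_add_projection_eq_self hAB x)

end Indecomposable

section GabrielRoiterMeasure

variable {Λ : Type*} [Ring Λ] {M N : Type*} [AddCommGroup M] [Module Λ M] [AddCommGroup N]
  [Module Λ N]

lemma nonempty_of_mem_grChainSets {S : Set ℕ} (hS : S ∈ grChainSets Λ M) : S.Nonempty := by
  obtain ⟨t, c, -, -, rfl⟩ := hS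
  exact Set.range_nonempty _

variable [IsNoetherian Λ M] [IsArtinian Λ M] [IsArtinian Λ N]

lemma mlen_of_eq_top {U : Submodule Λ M} (h : U = ⊤) : mlen Λ U = mlen Λ M := by
  rw [h, mlen_top]

lemma mlen_of_eq_map {U : Submodule Λ M} {V : Submodule Λ U} {W : Submodule Λ M}
    (h : W = V.map U.subtype) : mlen Λ W = mlen Λ V := by
  rw [h]
  exact (mlen_congr (Submodule.equivMapOfInjective _ U.subtype_injective V)).symm

lemma grChainSets_subset_of_injective (f : M →ₗ[Λ] N) (hf : Function.Injective f) :
    grChainSets Λ M ⊆ grChainSets Λ N := by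
  rintro S ⟨t, c, hc, hi, rfl⟩
  refine ⟨t, fun i => (c i).map f,
    (Submodule.map_strictMono_of_injective hf).comp hc, fun i => ?_, ?_⟩
  · exact (hi i).of_equiv (Submodule.equivMapOfInjective f hf (c i))
  · congr 1
    funext i
    exact mlen_congr (Submodule.equivMapOfInjective f hf (c i))

variable [IsNoetherian Λ N]

/-- A chain of indecomposable submodules below `U` is a chain of submodules of `U`. -/
lemma mem_grChainSets_of_le {U : Submodule Λ M} {t : ℕ} {c : Fin (t + 1) → Submodule Λ M}
    (hc : StrictMono c) (hi : ∀ i, IsIndecomposableModule Λ (c i)) (hU : ∀ i, c i ≤ U) :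
    (Set.range fun i => mlen Λ (c i)) ∈ grChainSets Λ U := by
  refine ⟨t, fun i => (c i).comap U.subtype, fun i j hij => ?_, fun i => ?_, ?_⟩
  · refine lt_of_le_of_ne (Submodule.comap_mono (hc hij).le) fun h => (hc hij).ne ?_
    have := congrArg (Submodule.map U.subtype) h
    rwa [Submodule.map_comap_eq_of_le, Submodule.map_comap_eq_of_le] at this
    · rw [Submodule.range_subtype]; exact hU j
    · rw [Submodule.range_subtype]; exact hU i
  · exact (hi i).of_equiv (Submodule.comapSubtypeEquivOfLe (hU i)).symm
  · congr 1
    funext i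
    exact (mlen_congr (Submodule.comapSubtypeEquivOfLe (hU i))).symm

lemma insert_mem_grChainSets (hM : IsIndecomposableModule Λ M) {U : Submodule Λ M} (hU : U ≠ ⊤)
    {S : Set ℕ} (hS : S ∈ grChainSets Λ U) : insert (mlen Λ M) S ∈ grChainSets Λ M := by
  obtain ⟨t, c, hc, hi, rfl⟩ := hS
  have hlt : ∀ i, (c i).map U.subtype < ⊤ := fun i =>
    (Submodule.map_subtype_le U (c i)).trans_lt (lt_top_iff_ne_top.mpr hU)
  have hsm := (Submodule.map_strictMono_of_injective U.subtype_injective).comp hc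
  let c' : Fin (t + 1 + 1) → Submodule Λ M :=
    Fin.snoc (α := fun _ => Submodule Λ M) (fun i => (c i).map U.subtype) ⊤
  have hl : c' (Fin.last _) = ⊤ := Fin.snoc_last (α := fun _ => Submodule Λ M) _ _
  have hs : ∀ i : Fin (t + 1), c' i.castSucc = (c i).map U.subtype := fun i =>
    Fin.snoc_castSucc (α := fun _ => Submodule Λ M) _ _ i
  refine ⟨t + 1, c', fun i j hij => ?_, fun i => ?_, ?_⟩
  · induction i using Fin.lastCases with
    | last => exact absurd hij (not_lt_of_ge (Fin.le_last j))
    | cast i =>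
      rw [hs]
      induction j using Fin.lastCases with
      | last => rw [hl]; exact hlt i
      | cast j => rw [hs]; exact hsm (Fin.castSucc_lt_castSucc_iff.mp hij)
  · induction i using Fin.lastCases with
    | last => rw [hl]; exact hM.of_equiv Submodule.topEquiv.symm
    | cast i =>
      rw [hs]
      exact (hi i).of_equiv (Submodule.equivMapOfInjective _ U.subtype_injective (c i))
  · ext n
    constructor
    · rintro (rfl | ⟨i, rfl⟩)
      · exact ⟨Fin.last _, mlen_of_eq_top hl⟩
      · exact ⟨i.castSucc, mlen_of_eq_map (hs i)⟩
    · rintro ⟨i, rfl⟩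
      induction i using Fin.lastCases with
      | last => exact Or.inl (mlen_of_eq_top hl)
      | cast i => exact Or.inr ⟨i, (mlen_of_eq_map (hs i)).symm⟩

lemma singleton_mem_grChainSets (hM : IsIndecomposableModule Λ M) :
    {mlen Λ M} ∈ grChainSets Λ M := by
  refine ⟨0, fun _ => ⊤, Subsingleton.strictMono (α := Fin 1) _,
    fun _ => hM.of_equiv Submodule.topEquiv.symm, ?_⟩
  simp [mlen_top]

lemma exists_indecomposable_submodule [Nontrivial M] :
    ∃ U : Submodule Λ M, IsIndecomposableModule Λ U := by
  obtain ⟨ι, _, Z, p, hZ, hp⟩ := exists_indecomposable_decomposition Λ M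
  by_contra h
  push Not at h
  have : IsEmpty ι := ⟨fun i => h _ (hZ i)⟩
  obtain ⟨x, hx⟩ := exists_ne (0 : M)
  exact hx (by rw [← hp x]; simp)

lemma le_mlen_of_mem_grChainSets {S : Set ℕ} (hS : S ∈ grChainSets Λ M) {n : ℕ} (hn : n ∈ S) :
    n ≤ mlen Λ M := by
  obtain ⟨t, c, -, -, rfl⟩ := hS
  obtain ⟨i, rfl⟩ := hn
  exact mlen_submodule_le _

lemma grMeasure_spec (Λ : Type*) [Ring Λ] (M : Type*) [AddCommGroup M] [Module Λ M]
    [IsNoetherian Λ M] [IsArtinian Λ M] [Nontrivial M] :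
    grMeasure Λ M ∈ grChainSets Λ M ∧ ∀ S ∈ grChainSets Λ M, GRle S (grMeasure Λ M) := by
  have hfin : (grChainSets Λ M).Finite :=
    ((Set.finite_Iic (mlen Λ M)).finite_subsets).subset
      fun S hS n hn => le_mlen_of_mem_grChainSets hS hn
  have hne : (grChainSets Λ M).Nonempty := by
    obtain ⟨U, hU⟩ := exists_indecomposable_submodule (Λ := Λ) (M := M)
    exact ⟨_, grChainSets_subset_of_injective U.subtype U.subtype_injective
      (singleton_mem_grChainSets hU)⟩
  have h := exists_GR_max hfin hne
  rw [grMeasure, dif_pos h]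
  exact h.choose_spec

lemma grMeasure_mono [Nontrivial M] {f : M →ₗ[Λ] N} (hf : Function.Injective f) :
    GRle (grMeasure Λ M) (grMeasure Λ N) := by
  have : Nontrivial N := hf.nontrivial
  exact (grMeasure_spec Λ N).2 _ (grChainSets_subset_of_injective f hf (grMeasure_spec Λ M).1)

lemma grMeasure_congr [Nontrivial M] (e : M ≃ₗ[Λ] N) : grMeasure Λ M = grMeasure Λ N := by
  have : Nontrivial N := e.symm.toEquiv.nontrivial
  rcases grMeasure_mono (f := e.toLinearMap) e.injective with h | h
  · exact h
  · exact absurd h (not_GRlt.mpr (grMeasure_mono (f := e.symm.toLinearMap) e.symm.injective))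

lemma le_mlen_of_mem_grMeasure [Nontrivial M] {n : ℕ} (hn : n ∈ grMeasure Λ M) : n ≤ mlen Λ M :=
  le_mlen_of_mem_grChainSets (grMeasure_spec Λ M).1 hn

lemma grMeasure_nonempty [Nontrivial M] : (grMeasure Λ M).Nonempty :=
  nonempty_of_mem_grChainSets (grMeasure_spec Λ M).1

lemma insert_grMeasure_GRle (hM : IsIndecomposableModule Λ M) {U : Submodule Λ M} (hU : U ≠ ⊤)
    [Nontrivial U] : GRle (insert (mlen Λ M) (grMeasure Λ U)) (grMeasure Λ M) := by
  have := hM.nontrivial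
  exact (grMeasure_spec Λ M).2 _ (insert_mem_grChainSets hM hU (grMeasure_spec Λ U).1)

lemma grMeasure_lt_of_ne_top (hM : IsIndecomposableModule Λ M) {U : Submodule Λ M} (hU : U ≠ ⊤)
    [Nontrivial U] : GRlt (grMeasure Λ U) (grMeasure Λ M) :=
  GRlt_of_GRlt_of_GRle (GRlt_insert fun h =>
    absurd (le_mlen_of_mem_grMeasure h) (not_le_of_gt (mlen_submodule_lt hU)))
    (insert_grMeasure_GRle hM hU)

lemma grMeasure_lt_of_injective [Nontrivial M] (hN : IsIndecomposableModule Λ N) {f : M →ₗ[Λ] N}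
    (hf : Function.Injective f) (hs : ¬ Function.Surjective f) :
    GRlt (grMeasure Λ M) (grMeasure Λ N) := by
  let e := LinearEquiv.ofInjective f hf
  have : Nontrivial (LinearMap.range f) := e.symm.toEquiv.nontrivial
  rw [grMeasure_congr e]
  exact grMeasure_lt_of_ne_top hN (by rwa [Ne, LinearMap.range_eq_top])

/-- The Gabriel–Roiter measure of an indecomposable module ends in its length, and removing it
gives the measure of a proper indecomposable submodule, if nonempty. -/
lemma grMeasure_eq_singleton_or_insert (hM : IsIndecomposableModule Λ M) :
    grMeasure Λ M = {mlen Λ M} ∨ ∃ U : Submodule Λ M, U ≠ ⊤ ∧ IsIndecomposableModule Λ U ∧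
      grMeasure Λ M = insert (mlen Λ M) (grMeasure Λ U) := by
  have := hM.nontrivial
  obtain ⟨t, c, hc, hi, hS⟩ := (grMeasure_spec Λ M).1
  by_cases htop : c (Fin.last t) = ⊤
  · cases t with
    | zero =>
      left
      rw [hS, ← mlen_of_eq_top htop]
      exact Set.range_unique (ι := Fin 1)
    | succ t =>
      right
      have hlt : c (Fin.last t).castSucc < ⊤ := htop ▸ hc (Fin.castSucc_lt_last _)
      refine ⟨c (Fin.last t).castSucc, hlt.ne, hi _, ?_⟩
      have := (hi (Fin.last t).castSucc).nontrivial
      have hS' : grMeasure Λ M =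
          insert (mlen Λ M) (Set.range fun i : Fin (t + 1) => mlen Λ (c i.castSucc)) := by
        rw [hS]
        ext n
        constructor
        · rintro ⟨i, rfl⟩
          induction i using Fin.lastCases with
          | last => exact Or.inl (mlen_of_eq_top htop)
          | cast i => exact Or.inr ⟨i, rfl⟩
        · rintro (rfl | ⟨i, rfl⟩)
          · exact ⟨Fin.last _, mlen_of_eq_top htop⟩
          · exact ⟨i.castSucc, rfl⟩
      have hmem' : (Set.range fun i : Fin (t + 1) => mlen Λ (c i.castSucc)) ∈
          grChainSets Λ (c (Fin.last t).castSucc) :=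
        mem_grChainSets_of_le (hc.comp Fin.strictMono_castSucc) (fun i => hi _)
          fun i => hc.monotone (Fin.castSucc_le_castSucc_iff.mpr (Fin.le_last i))
      rcases (grMeasure_spec Λ _).2 _ hmem' with h | h
      · rw [hS', h]
      · exfalso
        have h1 : GRlt (grMeasure Λ M) (grMeasure Λ (c (Fin.last t).castSucc)) := by
          rw [hS']
          exact insert_GRlt h fun k hk =>
            (le_mlen_of_mem_grMeasure hk).trans_lt (mlen_submodule_lt hlt.ne)
        exact GRlt_asymm h1 (grMeasure_lt_of_ne_top hM hlt.ne)
  · exfalso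
    have h1 : grMeasure Λ M ∈ grChainSets Λ (c (Fin.last t)) := by
      rw [hS]
      exact mem_grChainSets_of_le hc hi fun i => hc.monotone (Fin.le_last i)
    refine not_GRlt.mpr ((grMeasure_spec Λ M).2 _ (insert_mem_grChainSets hM htop h1))
      (GRlt_insert fun h => ?_)
    exact absurd (le_mlen_of_mem_grChainSets h1 h) (not_le_of_gt (mlen_submodule_lt htop))

lemma mlen_mem_grMeasure (hM : IsIndecomposableModule Λ M) : mlen Λ M ∈ grMeasure Λ M := by
  rcases grMeasure_eq_singleton_or_insert hM with h | ⟨U, -, -, h⟩ <;> rw [h]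
  exacts [rfl, Set.mem_insert _ _]

end GabrielRoiterMeasure

section MainProperty

universe v

/-- Gabriel's main property: an indecomposable module of finite length which embeds into a product
of indecomposable modules of no larger Gabriel–Roiter measure is isomorphic to a factor. -/
theorem exists_grMeasure_lt_or_bijective {Λ : Type*} [Ring Λ] (X : Type u) [AddCommGroup X]
    [Module Λ X] [IsNoetherian Λ X] [IsArtinian Λ X] (hX : IsIndecomposableModule Λ X)
    (ι : Type v) (Y : ι → Type u) [∀ i, AddCommGroup (Y i)] [∀ i, Module Λ (Y i)]
    [∀ i, IsNoetherian Λ (Y i)] [∀ i, IsArtinian Λ (Y i)]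
    (hY : ∀ i, IsIndecomposableModule Λ (Y i)) (f : ∀ i, X →ₗ[Λ] Y i)
    (hf : ∀ x, (∀ i, f i x = 0) → x = 0) :
    ∃ i, GRlt (grMeasure Λ X) (grMeasure Λ (Y i)) ∨ Function.Bijective (f i) := by
  induction hn : mlen Λ X using Nat.strong_induction_on generalizing X ι with
  | _ n ih =>
  by_contra hno
  push Not at hno
  have := hX.nontrivial
  have hninj : ∀ i, ¬ Function.Injective (f i) := fun i hinj =>
    (hno i).1 (grMeasure_lt_of_injective (hY i) hinj fun hs => (hno i).2 ⟨hinj, hs⟩)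
  choose κ hκ Z p hZ hp using fun i =>
    exists_indecomposable_decomposition Λ (LinearMap.range (f i))
  have hZlen : ∀ i k, mlen Λ (Z i k) < mlen Λ X := fun i k =>
    (mlen_submodule_le _).trans_lt (mlen_range_lt (hninj i))
  have hZle : ∀ i k, GRle (grMeasure Λ (Z i k)) (grMeasure Λ X) := fun i k => by
    have := (hZ i k).nontrivial
    exact GRle_trans (grMeasure_mono (f := (LinearMap.range (f i)).subtype ∘ₗ (Z i k).subtype)
      ((Submodule.subtype_injective _).comp (Submodule.subtype_injective _)))
      (not_GRlt.mp (hno i).1)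
  have hjoint : ∀ x, (∀ i k, p i k ((f i).rangeRestrict x) = 0) → x = 0 := by
    intro x hx
    refine hf x fun i => ?_
    have h1 := hp i ((f i).rangeRestrict x)
    rw [Finset.sum_eq_zero fun k _ => by rw [hx i k]; rfl] at h1
    exact (congrArg Subtype.val h1).symm
  rcases grMeasure_eq_singleton_or_insert hX with hμ | ⟨U, hU, hUi, hμ⟩
  · have : ∃ i, Nonempty (κ i) := by
      by_contra h
      push Not at h
      obtain ⟨x, hx⟩ := exists_ne (0 : X)
      exact hx (hjoint x fun i k => (h i).elim k)
    obtain ⟨i, ⟨k⟩⟩ := this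
    have := (hZ i k).nontrivial
    refine not_GRlt.mpr (hZle i k) ?_
    rw [hμ, ← insert_empty_eq]
    exact insert_GRlt (empty_GRlt grMeasure_nonempty)
      fun m hm => (le_mlen_of_mem_grMeasure hm).trans_lt (hZlen i k)
  · have := hUi.nontrivial
    obtain ⟨⟨i, k⟩, h⟩ := ih (mlen Λ U) (hn ▸ mlen_submodule_lt hU) U hUi (Σ i, κ i)
      (fun ik => Z ik.1 ik.2) (fun ik => hZ _ _)
      (fun ik => p ik.1 ik.2 ∘ₗ (f ik.1).rangeRestrict ∘ₗ U.subtype)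
      (fun x hx => Subtype.ext (hjoint x fun i k => hx ⟨i, k⟩)) rfl
    rcases h with h | h
    · have := (hZ i k).nontrivial
      refine not_GRlt.mpr (hZle i k) ?_
      rw [hμ]
      exact insert_GRlt h fun m hm => (le_mlen_of_mem_grMeasure hm).trans_lt (hZlen i k)
    · let e := LinearEquiv.ofBijective _ h
      have hb := hX.bijective_of_retraction (f := U.subtype)
        (r := e.symm.toLinearMap ∘ₗ p i k ∘ₗ (f i).rangeRestrict)
        (LinearMap.ext fun x => e.symm_apply_apply x)
      exact hU (by rw [← Submodule.range_subtype U, LinearMap.range_eq_top]; exact hb.2)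

end MainProperty

section BoundedLengths

/-- Existence of left almost split maps starting in indecomposable finitely generated modules. -/
def HasLeftAlmostSplitMaps (Λ : Type u) [Ring Λ] : Prop :=
  ∀ (X : Type u) [AddCommGroup X] [Module Λ X] [Module.Finite Λ X], IsIndecomposableModule Λ X →
    ∃ (W : Type u) (_ : AddCommGroup W) (_ : Module Λ W) (f : X →ₗ[Λ] W), Module.Finite Λ W ∧
      (¬ ∃ r : W →ₗ[Λ] X, r ∘ₗ f = LinearMap.id) ∧
      ∀ (M : Type u) [AddCommGroup M] [Module Λ M] (h : X →ₗ[Λ] M),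
        (¬ ∃ r : M →ₗ[Λ] X, r ∘ₗ h = LinearMap.id) → ∃ g : W →ₗ[Λ] M, g ∘ₗ f = h

/-- If composing with `u` on one side and with `f` on the other loses no length of the image, and
the middle module is indecomposable, then `f` is surjective and `u` is injective. -/
lemma injective_and_surjective_of_mlen_range_le {Λ : Type*} [Ring Λ] {X Y Z : Type*}
    [AddCommGroup X] [Module Λ X] [AddCommGroup Y] [Module Λ Y] [AddCommGroup Z] [Module Λ Z]
    [IsNoetherian Λ Y] [IsArtinian Λ Y] [IsNoetherian Λ Z] [IsArtinian Λ Z]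
    (hY : IsIndecomposableModule Λ Y) {f : X →ₗ[Λ] Y} {u : Y →ₗ[Λ] Z} (hne : u ∘ₗ f ≠ 0)
    (hf : mlen Λ (LinearMap.range f) ≤ mlen Λ (LinearMap.range (u ∘ₗ f)))
    (hu : mlen Λ (LinearMap.range u) ≤ mlen Λ (LinearMap.range (u ∘ₗ f))) :
    Function.Injective u ∧ Function.Surjective f := by
  have h1 := mlen_ker_add_mlen_range (u ∘ₗ (LinearMap.range f).subtype)
  have h2 : LinearMap.range (u ∘ₗ (LinearMap.range f).subtype) = LinearMap.range (u ∘ₗ f) := by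
    rw [LinearMap.range_comp, LinearMap.range_comp, Submodule.range_subtype]
  rw [h2] at h1
  have h3 : mlen Λ (LinearMap.ker (u ∘ₗ (LinearMap.range f).subtype)) = 0 := by omega
  rw [mlen_eq_zero_iff, Submodule.subsingleton_iff_eq_bot, LinearMap.ker_eq_bot'] at h3
  have h4 : LinearMap.range (u ∘ₗ f) = LinearMap.range u := by
    refine (LinearMap.range_comp_le_range f u).eq_or_lt.resolve_right fun h => ?_
    exact absurd (mlen_lt_of_lt h) (not_lt_of_ge hu)
  have hc : IsCompl (LinearMap.range f) (LinearMap.ker u) := by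
    refine IsCompl.of_le ?_ ?_
    · rintro y ⟨hy, hyu⟩
      exact congrArg Subtype.val (h3 ⟨y, hy⟩ hyu)
    · intro y _
      obtain ⟨x, hx⟩ := (h4 ▸ LinearMap.mem_range_self u y : u y ∈ LinearMap.range (u ∘ₗ f))
      rw [Submodule.mem_sup]
      refine ⟨f x, LinearMap.mem_range_self f x, y - f x, ?_, by simp⟩
      rw [LinearMap.mem_ker, map_sub, sub_eq_zero]
      exact hx.symm
  have hk : LinearMap.ker u = ⊥ := by
    by_contra hk
    refine hY.2 ⟨_, _, fun h => hne ?_, hk, hc⟩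
    rw [LinearMap.range_eq_bot] at h
    rw [h, LinearMap.comp_zero]
  refine ⟨LinearMap.ker_eq_bot.mp hk, LinearMap.range_eq_top.mp ?_⟩
  simpa [hk] using hc.sup_eq_top

variable {Λ : Type u} [Ring Λ] [IsArtinianRing Λ]

/-- An element of a finitely generated module which is detected by maps to infinitely many members
of a family of pairwise non-isomorphic indecomposable modules of measure `I` is so detected via an
indecomposable module of smaller measure. -/
lemma exists_indecomposable_infinite_detection {I : Set ℕ} {M : ℕ → Type u}
    [∀ j, AddCommGroup (M j)] [∀ j, Module Λ (M j)] [∀ j, Module.Finite Λ (M j)]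
    (hM : ∀ j, IsIndecomposableModule Λ (M j)) (hI : ∀ j, grMeasure Λ (M j) = I)
    (hne : ∀ i j, i ≠ j → IsEmpty (M i ≃ₗ[Λ] M j))
    {Q : Type u} [AddCommGroup Q] [Module Λ Q] [Module.Finite Λ Q] {z : Q}
    (hz : {j | ∃ q : Q →ₗ[Λ] M j, q z ≠ 0}.Infinite) :
    ∃ (Z : Type u) (_ : AddCommGroup Z) (_ : Module Λ Z) (_ : Module.Finite Λ Z) (π : Q →ₗ[Λ] Z),
      IsIndecomposableModule Λ Z ∧ GRlt (grMeasure Λ Z) I ∧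
        {j | ∃ q : Z →ₗ[Λ] M j, q (π z) ≠ 0}.Infinite := by
  classical
  have hq : ∀ j, ∃ q : Q →ₗ[Λ] M j, (∃ q : Q →ₗ[Λ] M j, q z ≠ 0) → q z ≠ 0 := fun j => by
    by_cases h : ∃ q : Q →ₗ[Λ] M j, q z ≠ 0
    · exact ⟨h.choose, fun _ => h.choose_spec⟩
    · exact ⟨0, fun h' => absurd h' h⟩
  choose q hq using hq
  let A := {j | ∃ q : Q →ₗ[Λ] M j, q z ≠ 0}
  let L : Set ℕ → Submodule Λ Q := fun B => ⨅ j ∈ B, LinearMap.ker (q j)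
  have hL : ∀ B x, x ∈ L B ↔ ∀ j ∈ B, q j x = 0 := fun B x => by simp [L, Submodule.mem_iInf]
  obtain ⟨_, ⟨B, hBA, hB, rfl⟩, hmax⟩ := set_has_maximal_iff_noetherian.mpr
    (inferInstance : IsNoetherian Λ Q) {N | ∃ B ⊆ A, B.Infinite ∧ L B = N}
    ⟨L A, A, subset_rfl, hz, rfl⟩
  have hLB : ∀ C ⊆ B, C.Infinite → L C = L B := by
    intro C hCB hC
    refine (eq_of_le_of_not_lt ?_ (hmax _ ⟨C, hCB.trans hBA, hC, rfl⟩)).symm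
    exact fun x hx => (hL C x).mpr fun j hj => (hL B x).mp hx j (hCB hj)
  have hker : ∀ j ∈ B, L B ≤ LinearMap.ker (q j) := fun j hj x hx => (hL B x).mp hx j hj
  obtain ⟨ι, _, Z, p, hZ, hp⟩ := exists_indecomposable_decomposition Λ (Q ⧸ L B)
  have hiso : ∀ i, ¬ GRlt (grMeasure Λ (Z i)) I → ∀ C ⊆ B, C.Infinite →
      ∃ j ∈ C, Nonempty (Z i ≃ₗ[Λ] M j) := by
    intro i hi C hCB hC
    obtain ⟨j, h⟩ := exists_grMeasure_lt_or_bijective (Z i) (hZ i) C (fun j => M j)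
      (fun j => hM j) (fun j => (L B).liftQ (q j) (hker j (hCB j.2)) ∘ₗ (Z i).subtype) (by
        rintro ⟨x, hx⟩ h
        obtain ⟨y, rfl⟩ := (L B).mkQ_surjective x
        have : y ∈ L B := by
          rw [← hLB C hCB hC, hL]
          exact fun j hj => h ⟨j, hj⟩
        exact Subtype.ext ((Submodule.Quotient.mk_eq_zero _).mpr this))
    rcases h with h | h
    · exact absurd (hI j ▸ h) hi
    · exact ⟨j, j.2, ⟨LinearEquiv.ofBijective _ h⟩⟩
  have hlt : ∀ i, GRlt (grMeasure Λ (Z i)) I := by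
    intro i
    by_contra hi
    obtain ⟨j, -, ⟨e⟩⟩ := hiso i hi B subset_rfl hB
    obtain ⟨k, hk, ⟨e'⟩⟩ := hiso i hi (B \ {j}) Set.sdiff_subset (hB.sdiff (Set.finite_singleton j))
    exact (hne j k fun h => hk.2 h.symm).elim (e.symm.trans e')
  have hdet : ∀ j ∈ B, ∃ i, ∃ h : Z i →ₗ[Λ] M j, h (p i ((L B).mkQ z)) ≠ 0 := by
    intro j hj
    by_contra hno
    push Not at hno
    refine hq j (hBA hj) ?_
    have h1 : q j z = (L B).liftQ (q j) (hker j hj) ((L B).mkQ z) := rfl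
    rw [h1, ← hp ((L B).mkQ z), map_sum]
    exact Finset.sum_eq_zero fun i _ =>
      hno i ((L B).liftQ (q j) (hker j hj) ∘ₗ (Z i).subtype)
  have : ∃ i, {j | ∃ h : Z i →ₗ[Λ] M j, h (p i ((L B).mkQ z)) ≠ 0}.Infinite := by
    by_contra hno
    push Not at hno
    refine hB ((Set.finite_iUnion hno).subset fun j hj => ?_)
    simpa using hdet j hj
  obtain ⟨i, hi⟩ := this
  exact ⟨Z i, inferInstance, inferInstance, inferInstance, p i ∘ₗ (L B).mkQ, hZ i, hlt i, hi⟩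

lemma exists_not_bijective_infinite_detection (hΛ : HasLeftAlmostSplitMaps Λ) {I : Set ℕ}
    {M : ℕ → Type u}
    [∀ j, AddCommGroup (M j)] [∀ j, Module Λ (M j)] [∀ j, Module.Finite Λ (M j)]
    (hM : ∀ j, IsIndecomposableModule Λ (M j)) (hI : ∀ j, grMeasure Λ (M j) = I)
    (hne : ∀ i j, i ≠ j → IsEmpty (M i ≃ₗ[Λ] M j))
    {X : Type u} [AddCommGroup X] [Module Λ X] [Module.Finite Λ X]
    (hX : IsIndecomposableModule Λ X) (hXI : GRlt (grMeasure Λ X) I) {x : X}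
    (hx : {j | ∃ q : X →ₗ[Λ] M j, q x ≠ 0}.Infinite) :
    ∃ (Z : Type u) (_ : AddCommGroup Z) (_ : Module Λ Z) (_ : Module.Finite Λ Z) (k : X →ₗ[Λ] Z),
      IsIndecomposableModule Λ Z ∧ GRlt (grMeasure Λ Z) I ∧ ¬ Function.Bijective k ∧
        {j | ∃ q : Z →ₗ[Λ] M j, q (k x) ≠ 0}.Infinite := by
  obtain ⟨W, _, _, f, _, hf, hfac⟩ := hΛ X hX
  have := hX.nontrivial
  have hW : {j | ∃ q : W →ₗ[Λ] M j, q (f x) ≠ 0}.Infinite := by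
    refine hx.mono ?_
    rintro j ⟨q, hq⟩
    obtain ⟨g, hg⟩ := hfac (M j) q (by
      rintro ⟨r, hr⟩
      refine GRlt_irrefl I ?_
      have hb := (hM j).bijective_of_retraction hr
      rwa [grMeasure_congr (LinearEquiv.ofBijective q hb), hI] at hXI)
    exact ⟨g, by rwa [← LinearMap.comp_apply, hg]⟩
  obtain ⟨Z, _, _, _, π, hZ, hZI, hd⟩ := exists_indecomposable_infinite_detection hM hI hne hW
  refine ⟨Z, inferInstance, inferInstance, inferInstance, π ∘ₗ f, hZ, hZI, fun hb => ?_, hd⟩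
  let e := LinearEquiv.ofBijective _ hb
  exact hf ⟨e.symm.toLinearMap ∘ₗ π, LinearMap.ext fun x => e.symm_apply_apply x⟩

/-- If the lengths of the indecomposable modules of measure smaller than `I` are bounded, then
there is no infinite family of pairwise non-isomorphic indecomposable modules of measure `I`. -/
theorem false_of_infinite_family (hΛ : HasLeftAlmostSplitMaps Λ) {I : Set ℕ} {b : ℕ}
    (hb : ∀ (X : Type u) [AddCommGroup X] [Module Λ X] [Module.Finite Λ X],
      IsIndecomposableModule Λ X → GRlt (grMeasure Λ X) I → mlen Λ X ≤ b)
    {M : ℕ → Type u}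
    [∀ j, AddCommGroup (M j)] [∀ j, Module Λ (M j)] [∀ j, Module.Finite Λ (M j)]
    (hM : ∀ j, IsIndecomposableModule Λ (M j)) (hI : ∀ j, grMeasure Λ (M j) = I)
    (hne : ∀ i j, i ≠ j → IsEmpty (M i ≃ₗ[Λ] M j)) : False := by
  have key : ∀ (m : ℕ) (X : Type u) [AddCommGroup X] [Module Λ X] [Module.Finite Λ X],
      IsIndecomposableModule Λ X → GRlt (grMeasure Λ X) I → ∀ x : X,
      {j | ∃ q : X →ₗ[Λ] M j, q x ≠ 0}.Infinite →
      ∃ (Z : Type u) (_ : AddCommGroup Z) (_ : Module Λ Z) (_ : Module.Finite Λ Z)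
        (k : X →ₗ[Λ] Z), IsIndecomposableModule Λ Z ∧ GRlt (grMeasure Λ Z) I ∧
        {j | ∃ q : Z →ₗ[Λ] M j, q (k x) ≠ 0}.Infinite ∧ mlen Λ (LinearMap.range k) + m ≤ b := by
    intro m
    induction m with
    | zero =>
      intro X _ _ _ hX hXI x hx
      exact ⟨X, inferInstance, inferInstance, inferInstance, LinearMap.id, hX, hXI, hx,
        (mlen_submodule_le _).trans (hb X hX hXI)⟩
    | succ m ih =>
      intro X _ _ _ hX hXI x hx
      obtain ⟨Y, _, _, _, f, hY, hYI, hfx, hf⟩ := ih X hX hXI x hx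
      obtain ⟨Y', _, _, _, g, hY', hYI', hg, hgx⟩ :=
        exists_not_bijective_infinite_detection hΛ hM hI hne hY hYI hfx
      obtain ⟨Z, _, _, _, h, hZ, hZI, hhx, hh⟩ := ih Y' hY' hYI' _ hgx
      refine ⟨Z, inferInstance, inferInstance, inferInstance, h ∘ₗ g ∘ₗ f, hZ, hZI, hhx, ?_⟩
      by_contra hlt
      have hne0 : h ∘ₗ g ∘ₗ f ≠ 0 := by
        intro h0
        obtain ⟨j, q, hq⟩ := hhx.nonempty
        have : h (g (f x)) = 0 := LinearMap.congr_fun h0 x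
        exact hq (by rw [this, map_zero])
      have h1 : mlen Λ (LinearMap.range (h ∘ₗ g)) ≤ mlen Λ (LinearMap.range h) :=
        mlen_le_of_injective (Submodule.inclusion (LinearMap.range_comp_le_range g h))
          (Submodule.inclusion_injective _)
      have h2 : mlen Λ (LinearMap.range (g ∘ₗ f)) ≤ mlen Λ (LinearMap.range f) := by
        have h3 := mlen_ker_add_mlen_range (g ∘ₗ (LinearMap.range f).subtype)
        rw [LinearMap.range_comp, Submodule.range_subtype, ← LinearMap.range_comp] at h3
        omega
      have h3 := injective_and_surjective_of_mlen_range_le hY (f := f) (u := h ∘ₗ g)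
        hne0 (by rw [LinearMap.comp_assoc]; omega) (by rw [LinearMap.comp_assoc]; omega)
      have h4 := injective_and_surjective_of_mlen_range_le hY' (f := g ∘ₗ f) (u := h)
        hne0 (by omega) (by omega)
      exact hg ⟨Function.Injective.of_comp (f := h) h3.1, Function.Surjective.of_comp (g := f) h4.2⟩
  have hstart : {j | ∃ q : Λ →ₗ[Λ] M j, q 1 ≠ 0}.Infinite := by
    refine Set.infinite_univ.mono fun j _ => ?_
    have := (hM j).nontrivial
    obtain ⟨m, hm⟩ := exists_ne (0 : M j)
    exact ⟨LinearMap.toSpanSingleton Λ (M j) m, by simpa using hm⟩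
  obtain ⟨X, _, _, _, π, hX, hXI, hx⟩ := exists_indecomposable_infinite_detection hM hI hne hstart
  obtain ⟨Z, _, _, _, k, hZ, hZI, hkx, hk⟩ := key b X hX hXI _ hx
  have h0 : mlen Λ (LinearMap.range k) = 0 := by omega
  rw [mlen_eq_zero_iff, Submodule.subsingleton_iff_eq_bot, LinearMap.range_eq_bot] at h0
  obtain ⟨j, q, hq⟩ := hkx.nonempty
  exact hq (by rw [h0, LinearMap.zero_apply, map_zero])

end BoundedLengths

section TakeOff

variable {Λ : Type u} [Ring Λ] [IsArtinianRing Λ]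

lemma mlen_eq_sSup_grMeasure {X : Type u} [AddCommGroup X] [Module Λ X] [Module.Finite Λ X]
    (hX : IsIndecomposableModule Λ X) : mlen Λ X = sSup (grMeasure Λ X) := by
  have := hX.nontrivial
  have h : IsGreatest (grMeasure Λ X) (mlen Λ X) :=
    ⟨mlen_mem_grMeasure hX, fun _ hn => le_mlen_of_mem_grMeasure hn⟩
  exact h.csSup_eq.symm

/-- A set of finitely generated indecomposable modules representing all indecomposable modules of
measure `I`, which is finite if only finitely many measures are smaller than `I`. -/
theorem exists_finite_representatives (hΛ : HasLeftAlmostSplitMaps Λ) {I : Set ℕ}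
    (hI : {J | IsGRMeasureOf Λ J ∧ GRlt J I}.Finite) :
    ∃ s : Set (BundledMod Λ), s.Finite ∧
      (∀ Y ∈ s, Module.Finite Λ Y.carrier ∧ IsIndecomposableModule Λ Y.carrier) ∧
      ∀ (X : Type u) [AddCommGroup X] [Module Λ X] [Module.Finite Λ X],
        IsIndecomposableModule Λ X → grMeasure Λ X = I →
        ∃ Y ∈ s, Nonempty (X ≃ₗ[Λ] Y.carrier) := by
  obtain ⟨b, hb⟩ := (hI.image sSup).bddAbove
  have hb' : ∀ (X : Type u) [AddCommGroup X] [Module Λ X] [Module.Finite Λ X],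
      IsIndecomposableModule Λ X → GRlt (grMeasure Λ X) I → mlen Λ X ≤ b := by
    intro X _ _ _ hX hXI
    rw [mlen_eq_sSup_grMeasure hX]
    exact hb ⟨_, ⟨⟨X, _, _, inferInstance, hX, rfl⟩, hXI⟩, rfl⟩
  let P := {Y : BundledMod Λ // Module.Finite Λ Y.carrier ∧ IsIndecomposableModule Λ Y.carrier ∧
    grMeasure Λ Y.carrier = I}
  let st : Setoid P :=
    { r := fun Y Y' => Nonempty (Y.1.carrier ≃ₗ[Λ] Y'.1.carrier)
      iseqv :=
        { refl := fun _ => ⟨LinearEquiv.refl Λ _⟩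
          symm := fun ⟨e⟩ => ⟨e.symm⟩
          trans := fun ⟨e⟩ ⟨e'⟩ => ⟨e.trans e'⟩ } }
  rcases finite_or_infinite (Quotient st) with hfin | hinf
  · refine ⟨Set.range fun c : Quotient st => c.out.1, Set.finite_range _, ?_, ?_⟩
    · rintro _ ⟨c, rfl⟩
      exact ⟨c.out.2.1, c.out.2.2.1⟩
    · intro X _ _ _ hX hXI
      let Y : P := ⟨⟨X⟩, inferInstance, hX, hXI⟩
      obtain ⟨e⟩ : Nonempty ((Quotient.mk st Y).out.1.carrier ≃ₗ[Λ] X) := Quotient.mk_out Y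
      exact ⟨_, ⟨Quotient.mk st Y, rfl⟩, ⟨e.symm⟩⟩
  · exfalso
    let a := Infinite.natEmbedding (Quotient st)
    have hf : ∀ j, Module.Finite Λ (a j).out.1.carrier := fun j => (a j).out.2.1
    refine false_of_infinite_family hΛ hb' (M := fun j => (a j).out.1.carrier)
      (fun j => (a j).out.2.2.1) (fun j => (a j).out.2.2.2) fun i j hij => ⟨fun e => hij ?_⟩
    exact a.injective (Quotient.out_equiv_out.mp ⟨e⟩)

/-- An artin algebra with only finitely many Gabriel–Roiter measures is representation-finite. -/
theorem hasFiniteRepType_of_finite (hΛ : HasLeftAlmostSplitMaps Λ)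
    (hfin : {I | IsGRMeasureOf Λ I}.Finite) : HasFiniteRepType Λ := by
  choose s hs _ hs' using fun I : Set ℕ => exists_finite_representatives hΛ (I := I)
    (hfin.subset fun J hJ => hJ.1)
  have hS : (⋃ I ∈ {I | IsGRMeasureOf Λ I}, s I).Finite := hfin.biUnion fun I _ => hs I
  have := hS.to_subtype
  obtain ⟨n, ⟨e⟩⟩ := Finite.exists_equiv_fin (⋃ I ∈ {I | IsGRMeasureOf Λ I}, s I)
  refine ⟨n, fun i => (e.symm i).1, fun M _ _ hM hMi => ?_⟩
  obtain ⟨Y, hY, h⟩ := hs' _ M hMi rfl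
  have hmem : Y ∈ ⋃ I ∈ {I | IsGRMeasureOf Λ I}, s I :=
    Set.mem_biUnion (show IsGRMeasureOf Λ (grMeasure Λ M) from ⟨M, _, _, hM, hMi, rfl⟩) hY
  refine ⟨e ⟨Y, hmem⟩, ?_⟩
  change Nonempty (M ≃ₗ[Λ] (e.symm (e ⟨Y, hmem⟩)).1.carrier)
  rw [e.symm_apply_apply]
  exact h

/-- If there are only finitely many measures below each element of the finite set `D` of measures,
all modules with measure in `D` have left almost split maps into modules of bounded length. -/
lemma exists_leftAlmostSplit_mlen_le (hΛ : HasLeftAlmostSplitMaps Λ) {D : Set (Set ℕ)}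
    (hD : D.Finite) (hD' : ∀ I ∈ D, {J | IsGRMeasureOf Λ J ∧ GRlt J I}.Finite) :
    ∃ b : ℕ, ∀ (X : Type u) [AddCommGroup X] [Module Λ X] [Module.Finite Λ X],
      IsIndecomposableModule Λ X → grMeasure Λ X ∈ D →
      ∃ (W : Type u) (_ : AddCommGroup W) (_ : Module Λ W) (_ : Module.Finite Λ W)
        (f : X →ₗ[Λ] W), mlen Λ W ≤ b ∧ (¬ ∃ r : W →ₗ[Λ] X, r ∘ₗ f = LinearMap.id) ∧
        ∀ (M : Type u) [AddCommGroup M] [Module Λ M] (h : X →ₗ[Λ] M),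
          (¬ ∃ r : M →ₗ[Λ] X, r ∘ₗ h = LinearMap.id) → ∃ g : W →ₗ[Λ] M, g ∘ₗ f = h := by
  have hs : ∀ I : Set ℕ, ∃ s : Set (BundledMod Λ), s.Finite ∧
      (∀ Y ∈ s, Module.Finite Λ Y.carrier ∧ IsIndecomposableModule Λ Y.carrier) ∧
      (I ∈ D → ∀ (X : Type u) [AddCommGroup X] [Module Λ X] [Module.Finite Λ X],
        IsIndecomposableModule Λ X → grMeasure Λ X = I →
        ∃ Y ∈ s, Nonempty (X ≃ₗ[Λ] Y.carrier)) := by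
    intro I
    by_cases hI : I ∈ D
    · obtain ⟨s, h1, h2, h3⟩ := exists_finite_representatives hΛ (hD' I hI)
      exact ⟨s, h1, h2, fun _ => h3⟩
    · exact ⟨∅, Set.finite_empty, by simp, fun h => absurd h hI⟩
  choose s hsfin hsi hs using hs
  have hS : (⋃ I ∈ D, s I).Finite := hD.biUnion fun I _ => hsfin I
  have hW : ∀ Y : BundledMod Λ, ∃ (W : Type u) (_ : AddCommGroup W) (_ : Module Λ W)
      (f : Y.carrier →ₗ[Λ] W), Module.Finite Λ Y.carrier → IsIndecomposableModule Λ Y.carrier →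
      Module.Finite Λ W ∧ (¬ ∃ r : W →ₗ[Λ] Y.carrier, r ∘ₗ f = LinearMap.id) ∧
      ∀ (M : Type u) [AddCommGroup M] [Module Λ M] (h : Y.carrier →ₗ[Λ] M),
        (¬ ∃ r : M →ₗ[Λ] Y.carrier, r ∘ₗ h = LinearMap.id) → ∃ g : W →ₗ[Λ] M, g ∘ₗ f = h := by
    intro Y
    by_cases hY : Module.Finite Λ Y.carrier ∧ IsIndecomposableModule Λ Y.carrier
    · have := hY.1
      obtain ⟨W, i₁, i₂, f, h⟩ := hΛ Y.carrier hY.2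
      exact ⟨W, i₁, i₂, f, fun _ _ => h⟩
    · exact ⟨Y.carrier, inferInstance, inferInstance, 0, fun h1 h2 => absurd ⟨h1, h2⟩ hY⟩
  choose W i₁ i₂ f hW using hW
  obtain ⟨b, hb⟩ := (hS.image fun Y => mlen Λ (W Y)).bddAbove
  refine ⟨b, fun X _ _ _ hX hXD => ?_⟩
  obtain ⟨Y, hY, ⟨e⟩⟩ := hs _ hXD X hX rfl
  obtain ⟨hYf, hYi⟩ := hsi _ Y hY
  obtain ⟨hWf, hsplit, hfac⟩ := hW Y hYf hYi
  refine ⟨W Y, i₁ Y, i₂ Y, hWf, f Y ∘ₗ e.toLinearMap,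
    hb ⟨Y, Set.mem_biUnion hXD hY, rfl⟩, ?_, fun M _ _ h hh => ?_⟩
  · rintro ⟨r, hr⟩
    refine hsplit ⟨e.toLinearMap ∘ₗ r, LinearMap.ext fun y => ?_⟩
    have := LinearMap.congr_fun hr (e.symm y)
    simp only [LinearMap.comp_apply, LinearEquiv.coe_coe, LinearEquiv.apply_symm_apply,
      LinearMap.id_apply] at this ⊢
    rw [this, LinearEquiv.apply_symm_apply]
  · obtain ⟨g, hg⟩ := hfac M (h ∘ₗ e.symm.toLinearMap) (by
      rintro ⟨r, hr⟩
      refine hh ⟨e.symm.toLinearMap ∘ₗ r, LinearMap.ext fun x => ?_⟩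
      have := LinearMap.congr_fun hr (e x)
      simp only [LinearMap.comp_apply, LinearEquiv.coe_coe, LinearEquiv.symm_apply_apply,
        LinearMap.id_apply] at this ⊢
      rw [this, LinearEquiv.symm_apply_apply])
    refine ⟨g, ?_⟩
    rw [← LinearMap.comp_assoc, hg]
    ext x
    simp

lemma mlen_le_one_of_forall_eq_top {M : Type u} [AddCommGroup M] [Module Λ M] [Module.Finite Λ M]
    [Nontrivial M] (h : ∀ U : Submodule Λ M, IsIndecomposableModule Λ U → U = ⊤) :
    mlen Λ M ≤ 1 := by
  have : IsSimpleModule Λ M := by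
    rw [isSimpleModule_iff]
    refine { eq_bot_or_eq_top := fun V => or_iff_not_imp_left.mpr fun hV => ?_ }
    have : Nontrivial V := Submodule.nontrivial_iff_ne_bot.mpr hV
    obtain ⟨U, hU⟩ := exists_indecomposable_submodule (Λ := Λ) (M := V)
    have := h _ (hU.of_equiv (Submodule.equivMapOfInjective V.subtype V.subtype_injective U))
    exact top_le_iff.mp (this ▸ Submodule.map_subtype_le V U)
  have h1 := Module.length_eq_one_iff (R := Λ) (M := M) |>.mpr this
  rw [← natCast_mlen] at h1
  exact (by exact_mod_cast h1 : mlen Λ M = 1).le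

/-- The complement of a finite down-closed set of Gabriel–Roiter measures has a least element. -/
theorem exists_least_not_mem (hΛ : HasLeftAlmostSplitMaps Λ) {D : Set (Set ℕ)} (hD : D.Finite)
    (hdown : ∀ I ∈ D, ∀ J, IsGRMeasureOf Λ J → GRlt J I → J ∈ D)
    (hne : ∃ I, IsGRMeasureOf Λ I ∧ I ∉ D) :
    ∃ I, IsGRMeasureOf Λ I ∧ I ∉ D ∧ ∀ J, IsGRMeasureOf Λ J → J ∉ D → GRle I J := by
  obtain ⟨b, hb⟩ := exists_leftAlmostSplit_mlen_le hΛ hD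
    fun I hI => hD.subset fun J hJ => hdown I hI J hJ.1 hJ.2
  let C : Set (Set ℕ) := {I | ∃ (M : Type u) (_ : AddCommGroup M) (_ : Module Λ M),
    Module.Finite Λ M ∧ IsIndecomposableModule Λ M ∧ grMeasure Λ M = I ∧ I ∉ D ∧
      ∀ U : Submodule Λ M, U ≠ ⊤ → IsIndecomposableModule Λ U → grMeasure Λ U ∈ D}
  have hlen : ∀ (M : Type u) [AddCommGroup M] [Module Λ M] [Module.Finite Λ M],
      IsIndecomposableModule Λ M →
      (∀ U : Submodule Λ M, U ≠ ⊤ → IsIndecomposableModule Λ U → grMeasure Λ U ∈ D) →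
      mlen Λ M ≤ max b 1 := by
    intro M _ _ _ hM hU
    have := hM.nontrivial
    by_cases hex : ∃ U : Submodule Λ M, U ≠ ⊤ ∧ IsIndecomposableModule Λ U
    · refine le_max_of_le_left ?_
      have hfin : {I | ∃ U : Submodule Λ M, U ≠ ⊤ ∧ IsIndecomposableModule Λ U ∧
          grMeasure Λ U = I}.Finite := hD.subset (by
        rintro _ ⟨U, h1, h2, rfl⟩
        exact hU U h1 h2)
      obtain ⟨U, h1, h2⟩ := hex
      obtain ⟨_, ⟨X, hXt, hX, rfl⟩, hmax⟩ := exists_GR_max hfin ⟨_, U, h1, h2, rfl⟩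
      have := hX.nontrivial
      obtain ⟨W, _, _, _, f, hWb, hsplit, hfac⟩ := hb X hX (hU X hXt hX)
      obtain ⟨g, hg⟩ := hfac M X.subtype (by
        rintro ⟨r, hr⟩
        have := (hM.bijective_of_retraction hr).2
        rw [← LinearMap.range_eq_top, Submodule.range_subtype] at this
        exact hXt this)
      refine le_trans (mlen_le_of_surjective g ?_) hWb
      by_contra hgs
      rw [← LinearMap.range_eq_top] at hgs
      obtain ⟨ι, _, Z, p, hZ, hp⟩ := exists_indecomposable_decomposition Λ (LinearMap.range g)
      obtain ⟨i, h | h⟩ := exists_grMeasure_lt_or_bijective X hX ι (fun i => Z i) hZ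
        (fun i => p i ∘ₗ g.rangeRestrict ∘ₗ f) (by
          intro x hx
          have h1 := hp (g.rangeRestrict (f x))
          rw [Finset.sum_eq_zero fun i _ => by
            rw [show p i (g.rangeRestrict (f x)) = 0 from hx i]; rfl] at h1
          have h2 : g (f x) = 0 := (congrArg Subtype.val h1).symm
          rw [← LinearMap.comp_apply, hg] at h2
          exact Subtype.ext h2)
      · have := (hZ i).nontrivial
        let e := Submodule.equivMapOfInjective (LinearMap.range g).subtype
          (Submodule.subtype_injective _) (Z i)
        refine not_GRlt.mpr (hmax _ ⟨(Z i).map (LinearMap.range g).subtype, fun htop => hgs ?_,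
          (hZ i).of_equiv e, (grMeasure_congr e).symm⟩) h
        exact top_le_iff.mp (htop ▸ Submodule.map_subtype_le _ _)
      · let e := LinearEquiv.ofBijective _ h
        exact hsplit ⟨e.symm.toLinearMap ∘ₗ p i ∘ₗ g.rangeRestrict,
          LinearMap.ext fun x => e.symm_apply_apply x⟩
    · push Not at hex
      refine le_max_of_le_right (mlen_le_one_of_forall_eq_top fun U hUi => ?_)
      by_contra h
      exact hex U h hUi
  have hCfin : C.Finite := by
    refine ((Set.finite_Iic (max b 1)).finite_subsets).subset ?_
    rintro _ ⟨M, _, _, _, hM, rfl, -, hU⟩ n hn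
    have := hM.nontrivial
    exact (le_mlen_of_mem_grMeasure hn).trans (hlen M hM hU)
  have hCle : ∀ J, IsGRMeasureOf Λ J → J ∉ D → ∃ I ∈ C, GRle I J := by
    rintro _ ⟨M, _, _, _, hM, rfl⟩ hJ
    have := hM.nontrivial
    have htop : IsIndecomposableModule Λ (⊤ : Submodule Λ M) :=
      hM.of_equiv Submodule.topEquiv.symm
    obtain ⟨U, ⟨hU, hUD⟩, hmin⟩ := IsArtinian.set_has_minimal
      {U : Submodule Λ M | IsIndecomposableModule Λ U ∧ grMeasure Λ U ∉ D}
      ⟨⊤, htop, by rwa [← grMeasure_congr Submodule.topEquiv.symm]⟩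
    have := hU.nontrivial
    refine ⟨grMeasure Λ U, ⟨U, _, _, inferInstance, hU, rfl, hUD, fun V hV hVi => ?_⟩,
      grMeasure_mono U.subtype_injective⟩
    by_contra hVD
    have := hVi.nontrivial
    let e := Submodule.equivMapOfInjective U.subtype U.subtype_injective V
    refine hmin (V.map U.subtype) ⟨hVi.of_equiv e, by rwa [← grMeasure_congr e]⟩ ?_
    refine lt_of_le_of_ne (Submodule.map_subtype_le U V) fun h => hV ?_
    apply Submodule.map_injective_of_injective U.subtype_injective
    rw [h, Submodule.map_subtype_top]
  obtain ⟨J, hJ, hJD⟩ := hne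
  obtain ⟨I₀, hI₀, -⟩ := hCle J hJ hJD
  obtain ⟨I, hI, hmin⟩ := exists_GR_min hCfin ⟨I₀, hI₀⟩
  obtain ⟨M, i₁, i₂, hMf, hM, hMI, hID, -⟩ := id hI
  refine ⟨I, ⟨M, i₁, i₂, hMf, hM, hMI⟩, hID, fun J hJ hJD => ?_⟩
  obtain ⟨I', hI', hle⟩ := hCle J hJ hJD
  exact GRle_trans (hmin I' hI') hle

end TakeOff

/-- An infinite set in which every element has finitely many predecessors with respect to `GRlt`
can be enumerated increasingly. -/
lemma exists_GR_enumeration {T : Set (Set ℕ)} (hT : T.Infinite)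
    (hfin : ∀ I ∈ T, {J | J ∈ T ∧ GRlt J I}.Finite) :
    ∃ f : ℕ → Set ℕ, (∀ n, f n ∈ T) ∧ (∀ I ∈ T, ∃! n, f n = I) ∧
      ∀ m n, m < n → GRlt (f m) (f n) := by
  classical
  let r : Set ℕ → ℕ := fun I => {J | J ∈ T ∧ GRlt J I}.ncard
  have hr : ∀ I ∈ T, ∀ J ∈ T, GRlt I J → r I < r J := by
    intro I hI J hJ hIJ
    refine Set.ncard_lt_ncard ((Set.ssubset_iff_of_subset ?_).mpr ?_) (hfin J hJ)
    · exact fun K hK => ⟨hK.1, GRlt_trans hK.2 hIJ⟩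
    · exact ⟨I, ⟨hI, hIJ⟩, fun h => GRlt_irrefl I h.2⟩
  have hrinj : Set.InjOn r T := by
    intro I hI J hJ h
    rcases GRlt_trichotomy I J with h' | h' | h'
    · exact absurd h (hr I hI J hJ h').ne
    · exact h'
    · exact absurd h (hr J hJ I hI h').ne'
  have : Infinite (r '' T) := (hT.image hrinj).to_subtype
  let e := Nat.orderEmbeddingOfSet (r '' T)
  have he : Set.range e = r '' T := Nat.orderEmbeddingOfSet_range (r '' T)
  have hf : ∀ n, ∃ I ∈ T, r I = e n := fun n => by
    have := Set.mem_range_self (f := e) n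
    rwa [he] at this
  choose f hfT hfr using hf
  refine ⟨f, hfT, fun I hI => ?_, fun m n hmn => ?_⟩
  · obtain ⟨n, hn⟩ : r I ∈ Set.range e := he ▸ Set.mem_image_of_mem r hI
    refine ⟨n, hrinj (hfT n) hI ((hfr n).trans hn), ?_⟩
    rintro m rfl
    exact e.injective ((hfr m).symm.trans hn.symm)
  · have h1 : r (f m) < r (f n) := by
      rw [hfr, hfr]
      exact e.strictMono hmn
    by_contra h
    rcases not_GRlt.mp h with h' | h'
    · rw [h'] at h1
      exact lt_irrefl _ h1
    · exact lt_asymm h1 (hr _ (hfT n) _ (hfT m) h')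

/-- Let `Λ` be a representation-infinite artin algebra.  The set `T` of
take-off GR measures for `Λ` (GR measures `I` such that only finitely many GR
measures `J` satisfy `J ≺ I`) is nonempty, closed under direct successors and
direct predecessors (hence a GR segment), infinite, and `(T, ≺)` is
order-isomorphic to `(ℕ, <)`: the GR segment containing a take-off measure is
`ℕ`-indexed. -/
theorem takeoff_segment_N_indexed (R : Type*) [CommRing R] [IsArtinianRing R]
    (Λ : Type u) [Ring Λ] [Algebra R Λ] [Module.Finite R Λ]
    (hinf : ¬ HasFiniteRepType Λ) :
    letI T : Set (Set ℕ) :=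
      {I | IsGRMeasureOf Λ I ∧ {J | IsGRMeasureOf Λ J ∧ GRlt J I}.Finite}
    T.Nonempty ∧
    (∀ I ∈ T, ∀ J, (IsDirectSuccessor Λ I J ∨ IsDirectSuccessor Λ J I) → J ∈ T) ∧
    T.Infinite ∧
    ∃ f : ℕ → Set ℕ, (∀ n, f n ∈ T) ∧ (∀ I ∈ T, ∃! n, f n = I) ∧
      ∀ m n, m < n → GRlt (f m) (f n) := by
  have : IsArtinianRing Λ := IsArtinianRing.of_finite R Λ
  have hΛ : HasLeftAlmostSplitMaps Λ := fun X _ _ _ hX => exists_leftAlmostSplit R Λ X hX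
  set T : Set (Set ℕ) := {I | IsGRMeasureOf Λ I ∧ {J | IsGRMeasureOf Λ J ∧ GRlt J I}.Finite}
  have hdown : ∀ I ∈ T, ∀ J, IsGRMeasureOf Λ J → GRlt J I → J ∈ T := fun I hI J hJ hJI =>
    ⟨hJ, hI.2.subset fun K hK => ⟨hK.1, GRlt_trans hK.2 hJI⟩⟩
  have hT : T.Infinite := by
    intro hfin
    obtain ⟨I, hI, hIT, hmin⟩ := exists_least_not_mem hΛ hfin hdown (by
      by_contra! h
      exact hinf (hasFiniteRepType_of_finite hΛ (hfin.subset h)))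
    refine hIT ⟨hI, hfin.subset fun J hJ => ?_⟩
    by_contra hJT
    exact not_GRlt.mpr (hmin J hJ.1 hJT) hJ.2
  refine ⟨hT.nonempty, ?_, hT, exists_GR_enumeration hT fun I hI =>
    hI.2.subset fun J hJ => ⟨hJ.1.1, hJ.2⟩⟩
  rintro I hI J (h | h)
  · refine ⟨h.2.1, (hI.2.insert I).subset fun K hK => ?_⟩
    rcases GRlt_trichotomy K I with h' | h' | h'
    · exact Or.inr ⟨hK.1, h'⟩
    · exact Or.inl h'
    · exact absurd ⟨K, hK.1, h', hK.2⟩ h.2.2.2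
  · exact hdown I hI J h.1 h.2.2.1
end

section
/- Let Λ be a representation-infinite artin algebra. Then the set L of landing GR measures for Λ (GR measures I such that only finitely many GR measures J satisfy I ≺ J) is nonempty and closed under direct successors and direct predecessors (so L is a GR segment), L is infinite, and (L, ≺) is order-isomorphic to the order dual of (ℕ, <); that is, the landing part is a (−ℕ)-indexed GR segment. -/
universe u

namespace GabrielRoiter

section Order

variable {I J K T : Set ℕ} {n : ℕ}

lemma grlt_iff : GRlt I J ↔ ∃ m, m ∈ J ∧ m ∉ I ∧ ∀ k < m, (k ∈ I ↔ k ∈ J) := by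
  constructor
  · rintro ⟨-, m, hm, hmin, hmJ⟩
    have hmI : m ∉ I := by
      rcases hm with hm | hm
      · exact absurd hmJ hm.2
      · exact hm.2
    refine ⟨m, hmJ, hmI, fun k hk => ?_⟩
    by_contra h
    have : k ∈ (I \ J) ∪ (J \ I) := by
      simp only [Set.mem_union, Set.mem_sdiff]
      tauto
    exact absurd (hmin k this) (not_le.2 hk)
  · rintro ⟨m, hmJ, hmI, h⟩
    refine ⟨fun e => hmI (e ▸ hmJ), m, Or.inr ⟨hmJ, hmI⟩, fun k hk => ?_, hmJ⟩
    by_contra hlt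
    have := h k (not_le.1 hlt)
    simp only [Set.mem_union, Set.mem_sdiff] at hk
    tauto

lemma _root_.GRlt.irrefl (h : GRlt I I) : False := h.1 rfl

lemma _root_.GRlt.trans (h₁ : GRlt I J) (h₂ : GRlt J K) : GRlt I K := by
  rw [grlt_iff] at *
  obtain ⟨m, hmJ, hmI, hm⟩ := h₁
  obtain ⟨n, hnK, hnJ, hn⟩ := h₂
  rcases lt_trichotomy m n with h | rfl | h
  · exact ⟨m, (hn m h).1 hmJ, hmI, fun k hk => (hm k hk).trans (hn k (hk.trans h))⟩
  · exact absurd hmJ hnJ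
  · exact ⟨n, hnK, fun hI => hnJ ((hm n h).1 hI),
      fun k hk => (hm k (hk.trans h)).trans (hn k hk)⟩

lemma grlt_or_eq_or_grlt (I J : Set ℕ) : GRlt I J ∨ I = J ∨ GRlt J I := by
  classical
  by_cases h : I = J
  · exact Or.inr (Or.inl h)
  have hex : ∃ m, ¬ (m ∈ I ↔ m ∈ J) := by
    by_contra! hc
    exact h (Set.ext hc)
  have hspec := Nat.find_spec hex
  have hmin : ∀ k < Nat.find hex, (k ∈ I ↔ k ∈ J) := fun k hk => not_not.1 (Nat.find_min hex hk)
  by_cases hI : Nat.find hex ∈ I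
  · exact Or.inr (Or.inr (grlt_iff.2 ⟨_, hI, by tauto, fun k hk => (hmin k hk).symm⟩))
  · exact Or.inl (grlt_iff.2 ⟨_, by tauto, hI, hmin⟩)

lemma _root_.GRle.trans (h₁ : GRle I J) (h₂ : GRle J K) : GRle I K := by
  rcases h₁ with rfl | h₁
  · exact h₂
  rcases h₂ with rfl | h₂
  · exact Or.inr h₁
  · exact Or.inr (h₁.trans h₂)

lemma _root_.GRlt.trans_le (h₁ : GRlt I J) (h₂ : GRle J K) : GRlt I K := by
  rcases h₂ with rfl | h₂
  · exact h₁
  · exact h₁.trans h₂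

lemma _root_.GRle.trans_lt (h₁ : GRle I J) (h₂ : GRlt J K) : GRlt I K := by
  rcases h₁ with rfl | h₁
  · exact h₂
  · exact h₁.trans h₂

lemma grle_or_grlt (I J : Set ℕ) : GRle I J ∨ GRlt J I := by
  rcases grlt_or_eq_or_grlt I J with h | h | h
  exacts [Or.inl (Or.inr h), Or.inl (Or.inl h), Or.inr h]

lemma _root_.GRle.not_grlt (h : GRle I J) : ¬ GRlt J I := fun h' => (h.trans_lt h').irrefl

lemma _root_.GRle.antisymm (h₁ : GRle I J) (h₂ : GRle J I) : I = J := by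
  rcases h₁ with h | h
  · exact h
  · exact absurd h h₂.not_grlt

/-- A nonempty finite collection of sets has a greatest element for the Gabriel–Roiter order. -/
lemma exists_grle_max {S : Set (Set ℕ)} (hfin : S.Finite) (hne : S.Nonempty) :
    ∃ I ∈ S, ∀ J ∈ S, GRle J I := by
  induction S, hfin using Set.Finite.induction_on with
  | empty => exact absurd hne (by simp)
  | @insert a S _ _ ih =>
    rcases S.eq_empty_or_nonempty with rfl | hS
    · exact ⟨a, by simp, fun J hJ => Or.inl (by simpa using hJ)⟩
    · obtain ⟨I, hIS, hmax⟩ := ih hS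
      rcases grle_or_grlt a I with h | h
      · refine ⟨I, Or.inr hIS, ?_⟩
        rintro J (rfl | hJ)
        exacts [h, hmax J hJ]
      · refine ⟨a, Or.inl rfl, ?_⟩
        rintro J (rfl | hJ)
        exacts [Or.inl rfl, (hmax J hJ).trans (Or.inr h)]

lemma grlt_insert (h : n ∉ I) : GRlt I (insert n I) :=
  grlt_iff.2 ⟨n, Set.mem_insert _ _, h, fun k hk => by
    simp [hk.ne]⟩

/-- If the elements of `J` are smaller than `n`, then `I ≺ J` implies `I ∪ {n} ≺ J`. -/
lemma _root_.GRlt.insert_left (h : GRlt I J) (hJ : ∀ k ∈ J, k < n) : GRlt (insert n I) J := by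
  rw [grlt_iff] at *
  obtain ⟨m, hmJ, hmI, hm⟩ := h
  refine ⟨m, hmJ, ?_, fun k hk => ?_⟩
  · rintro (rfl | h)
    exacts [(hJ _ hmJ).false, hmI h]
  · rw [← hm k hk, Set.mem_insert_iff, or_iff_right (hk.trans (hJ _ hmJ)).ne]

lemma empty_grlt (h : J.Nonempty) : GRlt ∅ J := by
  classical
  exact grlt_iff.2 ⟨Nat.find h, Nat.find_spec h, by simp, fun k hk => by
    simpa using Nat.find_min h hk⟩

end Order

section Length

variable {Λ : Type*} [Ring Λ] {M N : Type*} [AddCommGroup M] [Module Λ M] [AddCommGroup N]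
  [Module Λ N]

lemma coe_mlen [IsArtinian Λ M] [IsNoetherian Λ M] :
    (mlen Λ M : ℕ∞) = Module.length Λ M := by
  have h : ∃ s : CompositionSeries (Submodule Λ M), s.head = ⊥ ∧ s.last = ⊤ :=
    isFiniteLength_iff_exists_compositionSeries.1
      (isFiniteLength_iff_isNoetherian_isArtinian.2 ⟨‹_›, ‹_›⟩)
  rw [mlen, dif_pos h]
  exact Module.length_compositionSeries _ h.choose_spec.1 h.choose_spec.2

lemma mlen_congr [IsArtinian Λ M] [IsNoetherian Λ M] (e : M ≃ₗ[Λ] N) :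
    mlen Λ M = mlen Λ N := by
  have : IsArtinian Λ N := isArtinian_of_linearEquiv e
  have : IsNoetherian Λ N := isNoetherian_of_linearEquiv e
  have h := e.length_eq
  rw [← coe_mlen, ← coe_mlen] at h
  exact_mod_cast h

lemma mlen_le_of_injective [IsArtinian Λ M] [IsNoetherian Λ M] (f : N →ₗ[Λ] M)
    (hf : Function.Injective f) : mlen Λ N ≤ mlen Λ M := by
  have : IsArtinian Λ N := isArtinian_of_injective f hf
  have : IsNoetherian Λ N := isNoetherian_of_injective f hf
  have h := Module.length_le_of_injective f hf
  rw [← coe_mlen, ← coe_mlen] at h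
  exact_mod_cast h

lemma mlen_le_of_surjective [IsArtinian Λ M] [IsNoetherian Λ M] (f : M →ₗ[Λ] N)
    (hf : Function.Surjective f) : mlen Λ N ≤ mlen Λ M := by
  have : IsArtinian Λ N := isArtinian_of_surjective _ f hf
  have : IsNoetherian Λ N := isNoetherian_of_surjective f (LinearMap.range_eq_top.2 hf)
  have h := Module.length_le_of_surjective f hf
  rw [← coe_mlen, ← coe_mlen] at h
  exact_mod_cast h

lemma mlen_submodule_le [IsArtinian Λ M] [IsNoetherian Λ M] (A : Submodule Λ M) :
    mlen Λ A ≤ mlen Λ M := mlen_le_of_injective A.subtype A.injective_subtype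

lemma mlen_submodule_lt [IsArtinian Λ M] [IsNoetherian Λ M] {A : Submodule Λ M} (h : A ≠ ⊤) :
    mlen Λ A < mlen Λ M := by
  have := Submodule.length_lt h
  rw [← coe_mlen, ← coe_mlen] at this
  exact_mod_cast this

lemma mlen_ker_add_mlen_range [IsArtinian Λ M] [IsNoetherian Λ M] (f : M →ₗ[Λ] N) :
    mlen Λ (LinearMap.ker f) + mlen Λ (LinearMap.range f) = mlen Λ M := by
  have h := Module.length_eq_add_of_exact (LinearMap.ker f).subtype f.rangeRestrict
    (Submodule.injective_subtype _) f.surjective_rangeRestrict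
    (by
      rw [LinearMap.exact_iff]
      simp)
  rw [← coe_mlen, ← coe_mlen, ← coe_mlen] at h
  exact_mod_cast h.symm

lemma bijective_of_surjective_of_mlen_le [IsArtinian Λ M] [IsNoetherian Λ M] (f : M →ₗ[Λ] N)
    (hf : Function.Surjective f) (h : mlen Λ M ≤ mlen Λ N) : Function.Bijective f := by
  refine ⟨?_, hf⟩
  have h₁ := mlen_ker_add_mlen_range f
  have h₂ : mlen Λ (LinearMap.range f) = mlen Λ N := by
    exact mlen_congr (LinearEquiv.ofTop _ (LinearMap.range_eq_top.2 hf))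
  have h₃ : (mlen Λ (LinearMap.ker f) : ℕ∞) = 0 := by
    norm_cast
    omega
  rw [coe_mlen, Module.length_eq_zero_iff, Submodule.subsingleton_iff_eq_bot] at h₃
  exact LinearMap.ker_eq_bot.1 h₃

end Length

section Indecomposable

variable {Λ : Type*} [Ring Λ] {M N : Type*} [AddCommGroup M] [Module Λ M] [AddCommGroup N]
  [Module Λ N]

lemma indecomposable_iff : IsIndecomposableModule Λ M ↔
    Nontrivial M ∧ ∀ A B : Submodule Λ M, IsCompl A B → A = ⊥ ∨ B = ⊥ := by
  have hiff : (⊤ : Submodule Λ M) ≠ ⊥ ↔ Nontrivial M :=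
    ⟨fun h => (Submodule.nontrivial_iff Λ).1 ⟨⊤, ⊥, h⟩, fun _ => top_ne_bot⟩
  rw [IsIndecomposableModule, hiff]
  refine and_congr_right fun _ => ⟨fun h A B hAB => ?_, ?_⟩
  · by_contra! hc
    exact h ⟨A, B, hc.1, hc.2, hAB⟩
  · rintro h ⟨A, B, hA, hB, hAB⟩
    exact (h A B hAB).elim hA hB

lemma indecomposable_of_equiv (e : M ≃ₗ[Λ] N) (h : IsIndecomposableModule Λ M) :
    IsIndecomposableModule Λ N := by
  rw [indecomposable_iff] at *
  obtain ⟨hn, h⟩ := h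
  refine ⟨e.symm.toEquiv.nontrivial, fun A B hAB => ?_⟩
  refine (h _ _ ((Submodule.orderIsoMapComap e).symm.isCompl hAB)).imp ?_ ?_ <;>
  exact fun h => (map_eq_bot_iff (Submodule.orderIsoMapComap e).symm).1 h

/-- If `v ∘ u` is bijective with `u : X → Y`, `X` nonzero and `Y` indecomposable, then `u` is
bijective. -/
lemma bijective_of_comp_bijective [Nontrivial M] (hN : IsIndecomposableModule Λ N)
    (a : M →ₗ[Λ] N) (b : N →ₗ[Λ] M) (h : Function.Bijective (b ∘ₗ a)) :
    Function.Bijective a ∧ Function.Bijective b := by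
  have ha : Function.Injective a := by
    have := h.1
    rw [LinearMap.coe_comp] at this
    exact this.of_comp
  have hc : IsCompl (LinearMap.range a) (LinearMap.ker b) := by
    constructor
    · rw [Submodule.disjoint_def]
      rintro _ ⟨x, rfl⟩ hx
      have : (b ∘ₗ a) x = (b ∘ₗ a) 0 := by simpa using hx
      rw [h.1 this, map_zero]
    · rw [codisjoint_iff, eq_top_iff]
      intro y _
      obtain ⟨x, hx⟩ := h.2 (b y)
      rw [← sub_add_cancel y (a x), add_comm]
      exact Submodule.add_mem_sup ⟨x, rfl⟩ (by simpa [sub_eq_zero] using hx.symm)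
  have ha' : Function.Bijective a := by
    rcases (indecomposable_iff.1 hN).2 _ _ hc with h0 | h0
    · obtain ⟨x, hx⟩ := exists_ne (0 : M)
      have : a x = 0 := by
        rw [← Submodule.mem_bot Λ, ← h0]
        exact ⟨x, rfl⟩
      exact absurd (ha (by simpa using this)) hx
    · refine ⟨ha, LinearMap.range_eq_top.1 ?_⟩
      have := hc.sup_eq_top
      rwa [h0, sup_bot_eq] at this
  refine ⟨ha', ?_⟩
  rw [LinearMap.coe_comp] at h
  exact (Function.Bijective.of_comp_iff _ ha').1 h

end Indecomposable

end GabrielRoiter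

namespace GabrielRoiter

section Measure

variable {Λ : Type*} [Ring Λ] {M N : Type*} [AddCommGroup M] [Module Λ M] [AddCommGroup N]
  [Module Λ N] {S : Set ℕ}

lemma grChainSets_subset_of_injective [IsArtinian Λ M] [IsNoetherian Λ M] (f : N →ₗ[Λ] M)
    (hf : Function.Injective f) : grChainSets Λ N ⊆ grChainSets Λ M := by
  have : IsArtinian Λ N := isArtinian_of_injective f hf
  have : IsNoetherian Λ N := isNoetherian_of_injective f hf
  rintro _ ⟨t, c, hc, hind, rfl⟩
  refine ⟨t, fun i => (c i).map f, fun i j hij => Submodule.map_strictMono_of_injective hf (hc hij),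
    fun i => indecomposable_of_equiv (Submodule.equivMapOfInjective f hf (c i)) (hind i), ?_⟩
  congr 1
  ext1 i
  exact mlen_congr (Submodule.equivMapOfInjective f hf (c i))

lemma range_mlen_mem_grChainSets [IsArtinian Λ M] [IsNoetherian Λ M] {t : ℕ}
    {c : Fin (t + 1) → Submodule Λ M} (hc : StrictMono c)
    (hind : ∀ i, IsIndecomposableModule Λ (c i)) {A : Submodule Λ M} (hA : ∀ i, c i ≤ A) :
    (Set.range fun i => mlen Λ (c i)) ∈ grChainSets Λ A := by
  refine ⟨t, fun i => (c i).comap A.subtype, fun i j hij => ?_,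
    fun i => indecomposable_of_equiv (Submodule.comapSubtypeEquivOfLe (hA i)).symm (hind i), ?_⟩
  · refine lt_of_le_not_ge (Submodule.comap_mono (hc hij).le) fun h => (hc hij).not_ge ?_
    have := Submodule.map_mono (f := A.subtype) h
    simpa [Submodule.map_comap_subtype, hA] using this
  · congr 1
    ext1 i
    exact mlen_congr (Submodule.comapSubtypeEquivOfLe (hA i)).symm

lemma singleton_mem_grChainSets [IsArtinian Λ M] [IsNoetherian Λ M]
    (h : IsIndecomposableModule Λ M) : {mlen Λ M} ∈ grChainSets Λ M := by
  refine ⟨0, fun _ => ⊤, fun i j hij => by omega,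
    fun _ => indecomposable_of_equiv Submodule.topEquiv.symm h, ?_⟩
  rw [Set.range_const, mlen_congr (Submodule.topEquiv (R := Λ) (M := M)).symm]

lemma insert_mem_grChainSets [IsArtinian Λ M] [IsNoetherian Λ M]
    (h : IsIndecomposableModule Λ M) {A : Submodule Λ M} (hA : A ≠ ⊤)
    (hS : S ∈ grChainSets Λ A) : insert (mlen Λ M) S ∈ grChainSets Λ M := by
  obtain ⟨t, c, hc, hind, rfl⟩ := hS
  have hmap : StrictMono fun i => (c i).map A.subtype := fun i j hij =>
    Submodule.map_strictMono_of_injective A.injective_subtype (hc hij)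
  have hlt : ∀ i, (c i).map A.subtype < ⊤ := fun i =>
    (Submodule.map_subtype_le A (c i)).trans_lt hA.lt_top
  refine ⟨t + 1, Fin.snoc (α := fun _ => Submodule Λ M) (fun i => (c i).map A.subtype) ⊤,
    ?_, ?_, ?_⟩
  · intro i j hij
    induction i using Fin.lastCases with
    | last => exact absurd hij (Fin.le_last j).not_gt
    | cast i =>
      induction j using Fin.lastCases with
      | last => simpa using hlt i
      | cast j => simpa using hmap (Fin.castSucc_lt_castSucc_iff.1 hij)
  · intro i
    induction i using Fin.lastCases with
    | last =>
      rw [Fin.snoc_last]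
      exact indecomposable_of_equiv Submodule.topEquiv.symm h
    | cast i =>
      rw [Fin.snoc_castSucc]
      exact indecomposable_of_equiv
        (Submodule.equivMapOfInjective A.subtype A.injective_subtype (c i)) (hind i)
  · ext k
    simp only [Set.mem_insert_iff, Set.mem_range]
    constructor
    · rintro (rfl | ⟨i, rfl⟩)
      · refine ⟨Fin.last _, ?_⟩
        rw [Fin.snoc_last]
        exact (mlen_congr (Submodule.topEquiv (R := Λ) (M := M)).symm).symm
      · refine ⟨i.castSucc, ?_⟩
        rw [Fin.snoc_castSucc]
        exact (mlen_congr
          (Submodule.equivMapOfInjective A.subtype A.injective_subtype (c i))).symm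
    · rintro ⟨i, rfl⟩
      induction i using Fin.lastCases with
      | last =>
        rw [Fin.snoc_last]
        exact Or.inl (mlen_congr (Submodule.topEquiv (R := Λ) (M := M)).symm).symm
      | cast i =>
        rw [Fin.snoc_castSucc]
        exact Or.inr ⟨i, mlen_congr
          (Submodule.equivMapOfInjective A.subtype A.injective_subtype (c i))⟩

lemma exists_submodule_of_mem_grChainSets [IsArtinian Λ M] [IsNoetherian Λ M]
    (hS : S ∈ grChainSets Λ M) : S = {mlen Λ M} ∨
      ∃ A : Submodule Λ M, A ≠ ⊤ ∧ IsIndecomposableModule Λ A ∧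
        ∃ T ∈ grChainSets Λ A, S = T ∨ S = insert (mlen Λ M) T := by
  obtain ⟨t, c, hc, hind, rfl⟩ := hS
  by_cases hl : c (Fin.last t) = ⊤
  · have hlen : mlen Λ (c (Fin.last t)) = mlen Λ M := by
      rw [hl]
      exact (mlen_congr (Submodule.topEquiv (R := Λ) (M := M)).symm).symm
    rcases t with _ | t
    · left
      rw [← hlen]
      ext k
      simp [Fin.exists_fin_one, eq_comm]
    · right
      have hlt : c (Fin.last t).castSucc < c (Fin.last (t + 1)) :=
        hc (Fin.castSucc_lt_last _)
      refine ⟨c (Fin.last t).castSucc, (hlt.trans_le le_top).ne, hind _, _,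
        range_mlen_mem_grChainSets (c := fun i => c i.castSucc)
          (fun i j hij => hc (Fin.castSucc_lt_castSucc_iff.2 hij)) (fun i => hind _)
          (fun i => hc.monotone (Fin.castSucc_le_castSucc_iff.2 (Fin.le_last i))), Or.inr ?_⟩
      ext k
      rw [← hlen]
      simp only [Set.mem_insert_iff, Set.mem_range]
      rw [Fin.exists_fin_succ', or_comm]
      simp only [eq_comm]
  · exact Or.inr ⟨_, hl, hind _, _, range_mlen_mem_grChainSets hc hind
      (fun i => hc.monotone (Fin.le_last i)), Or.inl rfl⟩

lemma le_mlen_of_mem_grChainSets [IsArtinian Λ M] [IsNoetherian Λ M]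
    (hS : S ∈ grChainSets Λ M) {k : ℕ} (hk : k ∈ S) : k ≤ mlen Λ M := by
  obtain ⟨t, c, -, -, rfl⟩ := hS
  obtain ⟨i, rfl⟩ := hk
  exact mlen_submodule_le _

lemma nonempty_of_mem_grChainSets (hS : S ∈ grChainSets Λ M) : S.Nonempty := by
  obtain ⟨t, c, -, -, rfl⟩ := hS
  exact Set.range_nonempty _

lemma grMeasure_spec [IsArtinian Λ M] [IsNoetherian Λ M] (h : IsIndecomposableModule Λ M) :
    grMeasure Λ M ∈ grChainSets Λ M ∧ ∀ S ∈ grChainSets Λ M, GRle S (grMeasure Λ M) := by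
  have hex : ∃ S, S ∈ grChainSets Λ M ∧ ∀ S' ∈ grChainSets Λ M, GRle S' S := by
    refine exists_grle_max ?_ ⟨_, singleton_mem_grChainSets h⟩
    exact (Set.finite_Iic (mlen Λ M)).finite_subsets.subset
      fun S hS k hk => le_mlen_of_mem_grChainSets hS hk
  rw [grMeasure, dif_pos hex]
  exact hex.choose_spec

lemma grMeasure_mono [IsArtinian Λ M] [IsNoetherian Λ M] (hN : IsIndecomposableModule Λ N)
    (hM : IsIndecomposableModule Λ M) (f : N →ₗ[Λ] M) (hf : Function.Injective f) :
    GRle (grMeasure Λ N) (grMeasure Λ M) := by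
  have : IsArtinian Λ N := isArtinian_of_injective f hf
  have : IsNoetherian Λ N := isNoetherian_of_injective f hf
  exact (grMeasure_spec hM).2 _ (grChainSets_subset_of_injective f hf (grMeasure_spec hN).1)

lemma grMeasure_congr [IsArtinian Λ M] [IsNoetherian Λ M] (hM : IsIndecomposableModule Λ M)
    (e : M ≃ₗ[Λ] N) : grMeasure Λ M = grMeasure Λ N := by
  have : IsArtinian Λ N := isArtinian_of_linearEquiv e
  have : IsNoetherian Λ N := isNoetherian_of_linearEquiv e
  have hN := indecomposable_of_equiv e hM
  exact (grMeasure_mono hM hN e.toLinearMap e.injective).antisymm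
    (grMeasure_mono hN hM e.symm.toLinearMap e.symm.injective)

lemma grMeasure_submodule_grlt [IsArtinian Λ M] [IsNoetherian Λ M]
    (hM : IsIndecomposableModule Λ M) {A : Submodule Λ M} (hA : IsIndecomposableModule Λ A)
    (hAM : A ≠ ⊤) : GRlt (grMeasure Λ A) (grMeasure Λ M) := by
  have hA' := (grMeasure_spec hA).1
  refine GRlt.trans_le (grlt_insert ?_)
    ((grMeasure_spec hM).2 _ (insert_mem_grChainSets hM hAM hA'))
  exact fun h => (mlen_submodule_lt hAM).not_ge (le_mlen_of_mem_grChainSets hA' h)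

/-- An injective non-surjective map between indecomposable modules strictly increases the
Gabriel–Roiter measure. -/
lemma grMeasure_grlt_of_injective [IsArtinian Λ M] [IsNoetherian Λ M]
    (hN : IsIndecomposableModule Λ N) (hM : IsIndecomposableModule Λ M) (f : N →ₗ[Λ] M)
    (hf : Function.Injective f) (hf' : ¬ Function.Surjective f) :
    GRlt (grMeasure Λ N) (grMeasure Λ M) := by
  have : IsArtinian Λ N := isArtinian_of_injective f hf
  have : IsNoetherian Λ N := isNoetherian_of_injective f hf
  rw [grMeasure_congr hN (LinearEquiv.ofInjective f hf)]
  exact grMeasure_submodule_grlt hM (indecomposable_of_equiv (LinearEquiv.ofInjective f hf) hN)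
    fun h => hf' (LinearMap.range_eq_top.1 h)

end Measure

section Decomposition

variable {Λ : Type u} [Ring Λ]

/-- A module of finite length is a finite direct sum of indecomposable modules. -/
lemma exists_decomposition (M : Type u) [AddCommGroup M] [Module Λ M] [IsArtinian Λ M]
    [IsNoetherian Λ M] :
    ∃ (ι : Type) (_ : Fintype ι) (N : ι → BundledMod Λ)
      (a : ∀ i, (N i).carrier →ₗ[Λ] M) (p : ∀ i, M →ₗ[Λ] (N i).carrier),
      (∀ i, IsIndecomposableModule Λ (N i).carrier) ∧ (∀ i x, p i (a i x) = x) ∧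
        ∀ x, ∑ i, a i (p i x) = x := by
  induction hn : mlen Λ M using Nat.strong_induction_on generalizing M with
  | _ n ih =>
  by_cases hM : IsIndecomposableModule Λ M
  · exact ⟨Unit, inferInstance, fun _ => ⟨M⟩, fun _ => LinearMap.id, fun _ => LinearMap.id,
      fun _ => hM, fun _ _ => rfl, fun x => by simp⟩
  rcases subsingleton_or_nontrivial M with hs | hs
  · exact ⟨Empty, inferInstance, Empty.elim, fun i => i.elim, fun i => i.elim, fun i => i.elim,
      fun i => i.elim, fun x => Subsingleton.elim _ _⟩
  rw [indecomposable_iff] at hM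
  push Not at hM
  obtain ⟨A, B, hAB, hA, hB⟩ := hM hs
  have hA' : A ≠ ⊤ := fun h => hB (by simpa [h] using hAB.disjoint)
  have hB' : B ≠ ⊤ := fun h => hA (by simpa [h] using hAB.disjoint)
  obtain ⟨ι, _, N, a, p, hN, hap, hpa⟩ := ih _ (hn ▸ mlen_submodule_lt hA') A rfl
  obtain ⟨κ, _, L, b, q, hL, hbq, hqb⟩ := ih _ (hn ▸ mlen_submodule_lt hB') B rfl
  refine ⟨ι ⊕ κ, inferInstance, Sum.elim N L,
    fun i => match i with
      | .inl i => A.subtype ∘ₗ a i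
      | .inr i => B.subtype ∘ₗ b i,
    fun i => match i with
      | .inl i => p i ∘ₗ A.projectionOnto B hAB
      | .inr i => q i ∘ₗ B.projectionOnto A hAB.symm, ?_, ?_, ?_⟩
  · rintro (i | i)
    exacts [hN i, hL i]
  · rintro (i | i) x
    · exact (congrArg (p i) (Submodule.projectionOnto_apply_left hAB (a i x))).trans (hap i x)
    · exact (congrArg (q i) (Submodule.projectionOnto_apply_left hAB.symm (b i x))).trans (hbq i x)
  · intro x
    rw [Fintype.sum_sum_type]
    have hA := congrArg A.subtype (hpa (A.projectionOnto B hAB x))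
    have hB := congrArg B.subtype (hqb (B.projectionOnto A hAB.symm x))
    rw [map_sum] at hA hB
    exact (congrArg₂ (· + ·) hA hB).trans (Submodule.projection_add_projection_eq_self hAB x)

/-- Gabriel's main property of the Gabriel–Roiter measure: if an indecomposable module `X` of
finite length embeds into a product of indecomposable modules `Y i` of finite length, then some
`Y i` has larger measure than `X` or is isomorphic to `X` via the corresponding component. -/
theorem exists_grlt_or_bijective (X : Type u) [AddCommGroup X] [Module Λ X] [IsArtinian Λ X]
    [IsNoetherian Λ X] (hX : IsIndecomposableModule Λ X) {ι : Type*} (Y : ι → BundledMod Λ)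
    [∀ i, IsArtinian Λ (Y i).carrier] [∀ i, IsNoetherian Λ (Y i).carrier]
    (hY : ∀ i, IsIndecomposableModule Λ (Y i).carrier) (g : ∀ i, X →ₗ[Λ] (Y i).carrier)
    (hg : ∀ x, (∀ i, g i x = 0) → x = 0) :
    ∃ i, GRlt (grMeasure Λ X) (grMeasure Λ (Y i).carrier) ∨ Function.Bijective (g i) := by
  induction hn : mlen Λ X using Nat.strong_induction_on generalizing X ι with
  | _ n ih =>
  by_cases hinj : ∃ i, Function.Injective (g i)
  · obtain ⟨i, hi⟩ := hinj
    refine ⟨i, ?_⟩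
    by_cases hs : Function.Surjective (g i)
    · exact Or.inr ⟨hi, hs⟩
    · exact Or.inl (grMeasure_grlt_of_injective hX (hY i) (g i) hi hs)
  push Not at hinj
  choose κ _ Z a p hZ hpa hap using fun i =>
    exists_decomposition (Λ := Λ) (LinearMap.range (g i))
  let W : (Σ i, κ i) → BundledMod Λ := fun s => Z s.1 s.2
  let h : ∀ s : Σ i, κ i, X →ₗ[Λ] (W s).carrier := fun s => p s.1 s.2 ∘ₗ (g s.1).rangeRestrict
  have hW : ∀ s, IsIndecomposableModule Λ (W s).carrier := fun s => hZ s.1 s.2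
  have hsurj : ∀ s, Function.Surjective (h s) := fun s =>
    (Function.LeftInverse.surjective (hpa s.1 s.2)).comp (g s.1).surjective_rangeRestrict
  have : ∀ s, IsArtinian Λ (W s).carrier := fun s => isArtinian_of_surjective _ (h s) (hsurj s)
  have : ∀ s, IsNoetherian Λ (W s).carrier := fun s =>
    isNoetherian_of_surjective (h s) (LinearMap.range_eq_top.2 (hsurj s))
  have hninj : ∀ s, ¬ Function.Injective (h s) := fun s hs => hinj s.1 <| by
    intro x y hxy
    refine hs ?_
    have : (g s.1).rangeRestrict x = (g s.1).rangeRestrict y := Subtype.ext hxy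
    simp only [h, LinearMap.comp_apply, this]
  have hh : ∀ x, (∀ s, h s x = 0) → x = 0 := fun x hx => hg x fun i => by
    have := hap i ((g i).rangeRestrict x)
    rw [Finset.sum_eq_zero fun j _ => by
      have := hx ⟨i, j⟩
      simp only [h, LinearMap.comp_apply] at this
      rw [this, map_zero]] at this
    exact congrArg Subtype.val this.symm
  have hle : ∀ s, GRle (grMeasure Λ (W s).carrier) (grMeasure Λ (Y s.1).carrier) := fun s =>
    grMeasure_mono (hW s) (hY s.1) ((LinearMap.range (g s.1)).subtype ∘ₗ a s.1 s.2)
      ((LinearMap.range (g s.1)).injective_subtype.comp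
        (Function.LeftInverse.injective (hpa s.1 s.2)))
  have hlen : ∀ s, ∀ k ∈ grMeasure Λ (W s).carrier, k < mlen Λ X := fun s k hk => by
    refine (le_mlen_of_mem_grChainSets (grMeasure_spec (hW s)).1 hk).trans_lt ?_
    by_contra! hc
    exact hninj s (bijective_of_surjective_of_mlen_le (h s) (hsurj s) hc).1
  rcases exists_submodule_of_mem_grChainSets (grMeasure_spec hX).1 with hS | ⟨A, hA, hAi, T, hT, hS⟩
  · obtain ⟨x, hx⟩ := @exists_ne X (indecomposable_iff.1 hX).1 0
    have : ∃ s, h s x ≠ 0 := by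
      by_contra! hc
      exact hx (hh x hc)
    obtain ⟨s, -⟩ := this
    refine ⟨s.1, Or.inl (GRlt.trans_le ?_ (hle s))⟩
    rw [hS, ← insert_empty_eq]
    exact (empty_grlt (nonempty_of_mem_grChainSets (grMeasure_spec (hW s)).1)).insert_left (hlen s)
  · obtain ⟨s, hs | hs⟩ := ih _ (hn ▸ mlen_submodule_lt hA) A hAi W hW (fun s => h s ∘ₗ A.subtype)
      (fun x hx => Subtype.ext (hh x hx)) rfl
    · refine ⟨s.1, Or.inl (GRlt.trans_le ?_ (hle s))⟩
      have hTs := ((grMeasure_spec hAi).2 T hT).trans_lt hs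
      rcases hS with hS | hS
      · rwa [hS]
      · rw [hS]
        exact hTs.insert_left (hlen s)
    · have := (indecomposable_iff.1 hAi).1
      exact absurd (bijective_of_comp_bijective hX A.subtype
        ((LinearEquiv.ofBijective _ hs).symm.toLinearMap ∘ₗ h s) (by
          convert Function.bijective_id
          ext1 x
          exact (LinearEquiv.ofBijective _ hs).symm_apply_apply x)).1.2
        fun hsu => hA (by simpa using LinearMap.range_eq_top.2 hsu)

end Decomposition

end GabrielRoiter

namespace GabrielRoiter

section Injective

variable {R : Type u} [CommRing R]

/-- An injective module contains an injective hull of each of its submodules. -/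
lemma exists_essential_baer {Q : Type u} [AddCommGroup Q] [Module R Q] (hQ : Module.Baer R Q)
    (S : Submodule R Q) : ∃ J : Submodule R Q, S ≤ J ∧
      (∀ x ∈ J, x ≠ 0 → ∃ r : R, r • x ∈ S ∧ r • x ≠ 0) ∧ Module.Baer R J := by
  obtain ⟨J, hSJ, hJ⟩ := zorn_le_nonempty₀
    {J : Submodule R Q | ∀ x ∈ J, x ≠ 0 → ∃ r : R, r • x ∈ S ∧ r • x ≠ 0}
    (fun c hc hchain y hy => ⟨sSup c, fun x hx hx0 => by
      obtain ⟨K, hK, hxK⟩ := (Submodule.mem_sSup_of_directed ⟨y, hy⟩ hchain.directedOn).1 hx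
      exact hc hK x hxK hx0, fun z hz => le_sSup hz⟩)
    S (fun x hx hx0 => ⟨1, by simpa using hx, by simpa using hx0⟩)
  obtain ⟨C, -, hC⟩ := zorn_le_nonempty₀ {C : Submodule R Q | Disjoint J C}
    (fun c hc hchain y hy => ⟨sSup c, by
      rw [Set.mem_ofPred_eq, Submodule.disjoint_def]
      intro x hxJ hx
      obtain ⟨K, hK, hxK⟩ := (Submodule.mem_sSup_of_directed ⟨y, hy⟩ hchain.directedOn).1 hx
      exact Submodule.disjoint_def.1 (hc hK) x hxJ hxK, fun z hz => le_sSup hz⟩)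
    ⊥ disjoint_bot_right
  have hdisj : Disjoint J C := hC.prop
  obtain ⟨φ, hφ⟩ := hQ.extension_property (C.mkQ ∘ₗ J.subtype) (by
    rw [← LinearMap.ker_eq_bot, LinearMap.ker_eq_bot']
    intro x hx
    have : (x : Q) ∈ C := by simpa using hx
    exact Subtype.ext (Submodule.disjoint_def.1 hdisj x x.2 this)) J.subtype
  let π : Q →ₗ[R] Q := φ ∘ₗ C.mkQ
  have hπJ : ∀ x ∈ J, π x = x := fun x hx => LinearMap.congr_fun hφ ⟨x, hx⟩
  have hCker : C ≤ LinearMap.ker π := fun x hx => by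
    simp [π, (Submodule.Quotient.mk_eq_zero C).2 hx]
  have hker : LinearMap.ker π ≤ C := by
    refine hC.le_of_ge ?_ hCker
    rw [Set.mem_ofPred_eq, Submodule.disjoint_def]
    intro x hx hxk
    rw [← hπJ x hx]
    exact hxk
  have hrange : LinearMap.range π ≤ J := by
    refine hJ.le_of_ge ?_ fun x hx => ⟨x, hπJ x hx⟩
    rintro _ ⟨x, rfl⟩ hx0
    have hxC : x ∉ C := fun h => hx0 (hCker h)
    have hnd : ¬ Disjoint J (C ⊔ Submodule.span R {x}) := fun h =>
      hxC (hC.le_of_ge h le_sup_left (Submodule.mem_sup_right (Submodule.mem_span_singleton_self x)))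
    rw [Submodule.disjoint_def] at hnd
    push Not at hnd
    obtain ⟨j, hj, hjs, hj0⟩ := hnd
    obtain ⟨c, hc, y, hy, rfl⟩ := Submodule.mem_sup.1 hjs
    obtain ⟨r, rfl⟩ := Submodule.mem_span_singleton.1 hy
    obtain ⟨r', hr', hr'0⟩ := hJ.prop _ hj hj0
    have hr : r • π x = c + r • x := by
      rw [← hπJ _ hj, map_add, map_smul, LinearMap.mem_ker.1 (hCker hc), zero_add]
    refine ⟨r' * r, ?_, ?_⟩ <;> rw [mul_smul, hr] <;> assumption
  refine ⟨J, hSJ, hJ.prop, fun I g => ?_⟩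
  obtain ⟨g', hg'⟩ := hQ I (J.subtype ∘ₗ g)
  refine ⟨(LinearMap.codRestrict J π fun x => hrange ⟨x, rfl⟩) ∘ₗ g', fun x hx => ?_⟩
  refine Subtype.ext ?_
  have := hg' x hx
  simp only [LinearMap.comp_apply, LinearMap.codRestrict_apply, this]
  exact hπJ _ (g ⟨x, hx⟩).2

variable [IsArtinianRing R]

/-- Over a commutative artinian ring, an essential extension of a finitely generated module is
finitely generated. -/
lemma fg_of_essential {Q : Type u} [AddCommGroup Q] [Module R Q] {S J : Submodule R Q}
    (hS : S.FG) (hJ : ∀ x ∈ J, x ≠ 0 → ∃ r : R, r • x ∈ S ∧ r • x ≠ 0) : J.FG := by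
  have hSfin : Module.Finite R S := ⟨(Submodule.fg_top S).2 hS⟩
  have hSN : IsNoetherian R S := inferInstance
  suffices ∀ I : Ideal R, (J ⊓ Submodule.torsionBySet R Q I).FG by
    convert this ⊥
    rw [eq_comm, inf_eq_left]
    intro x _
    rw [Submodule.mem_torsionBySet_iff]
    rintro ⟨a, ha⟩
    obtain rfl : a = 0 := (Submodule.mem_bot R).1 ha
    exact zero_smul R x
  intro I
  induction I using IsNoetherian.induction with
  | _ I ih =>
  by_cases hI : I = ⊤
  · convert Submodule.fg_bot
    rw [eq_bot_iff]
    rintro x ⟨-, hx⟩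
    simpa using (Submodule.mem_torsionBySet_iff _ _).1 hx ⟨1, by simp [hI]⟩
  have : Nontrivial (R ⧸ I) := Ideal.Quotient.nontrivial_iff.2 hI
  obtain ⟨p, hp⟩ := associatedPrimes.nonempty R (R ⧸ I)
  obtain ⟨hprime, x, hx⟩ := isAssociatedPrime_iff.1 hp
  obtain ⟨a, rfl⟩ := Ideal.Quotient.mk_surjective x
  have hpa : ∀ r, r ∈ p ↔ r * a ∈ I := fun r => by
    rw [hx, Submodule.mem_colon_singleton, Submodule.mem_bot, ← Ideal.Quotient.eq_zero_iff_mem,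
      map_mul]
    rfl
  have hmax : p.IsMaximal := IsArtinianRing.isMaximal_of_isPrime p
  refine Submodule.fg_of_fg_map_of_fg_inf_ker (LinearMap.lsmul R Q a) ?_ ?_
  · refine isNoetherian_submodule.1 hSN _ ?_
    rintro _ ⟨x, ⟨hxJ, hxI⟩, rfl⟩
    by_cases h0 : a • x = 0
    · simp [h0]
    obtain ⟨r, hr, hr0⟩ := hJ _ (J.smul_mem a hxJ) h0
    have hrp : r ∉ p := fun h => hr0 <| by
      rw [← mul_smul]
      exact (Submodule.mem_torsionBySet_iff _ _).1 hxI ⟨_, (hpa r).1 h⟩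
    obtain ⟨s, hs⟩ := hmax.exists_inv hrp
    obtain ⟨t, ht, hst⟩ := hs
    have h1 : a • x = s • r • a • x := by
      have : t • a • x = 0 := by
        rw [← mul_smul]
        exact (Submodule.mem_torsionBySet_iff _ _).1 hxI ⟨_, (hpa t).1 ht⟩
      rw [← mul_smul s r, ← add_zero ((s * r) • a • x), ← this, ← add_smul, hst, one_smul]
    change a • x ∈ S
    rw [h1]
    exact S.smul_mem s hr
  · have haI : a ∉ I := fun h => hprime.ne_top ((Ideal.eq_top_iff_one p).2 (by simpa [hpa] using h))
    suffices heq : J ⊓ Submodule.torsionBySet R Q I ⊓ LinearMap.ker (LinearMap.lsmul R Q a) =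
        J ⊓ Submodule.torsionBySet R Q (I ⊔ Ideal.span {a} : Ideal R) by
      rw [heq]
      exact ih _ (left_lt_sup.2 fun h => haI (h (Ideal.mem_span_singleton_self a)))
    ext x
    simp only [Submodule.mem_inf, Submodule.mem_torsionBySet_iff, LinearMap.mem_ker,
      LinearMap.lsmul_apply, and_assoc]
    refine and_congr_right fun _ => ⟨?_, ?_⟩
    · rintro ⟨h₁, h₂⟩ ⟨b, hb⟩
      obtain ⟨i, hi, j, hj, rfl⟩ := Submodule.mem_sup.1 hb
      obtain ⟨c, rfl⟩ := Ideal.mem_span_singleton'.1 hj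
      have := h₁ ⟨i, hi⟩
      simp only [add_smul, mul_smul, h₂, smul_zero, add_zero]
      exact this
    · intro h
      exact ⟨fun b => h ⟨b, Submodule.mem_sup_left b.2⟩,
        h ⟨a, Submodule.mem_sup_right (Ideal.mem_span_singleton_self a)⟩⟩

variable (R) in
/-- A commutative artinian ring has a finitely generated injective cogenerator. -/
theorem exists_finite_injective_cogenerator :
    ∃ (J : Type u) (_ : AddCommGroup J) (_ : Module R J), Module.Finite R J ∧ Module.Baer R J ∧
      ∀ (V : Type u) [AddCommGroup V] [Module R V] (v : V), v ≠ 0 →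
        ∃ β : V →ₗ[R] J, β v ≠ 0 := by
  classical
  let S₀ : Type u := ∀ m : MaximalSpectrum R, R ⧸ m.asIdeal
  let Q := CategoryTheory.Injective.under (ModuleCat.of R S₀)
  let i : S₀ →ₗ[R] Q := (CategoryTheory.Injective.ι (ModuleCat.of R S₀)).hom
  have hi : Function.Injective i :=
    (ModuleCat.mono_iff_injective (CategoryTheory.Injective.ι (ModuleCat.of R S₀))).1 inferInstance
  have hQ : Module.Baer R Q := Module.Baer.of_injective <|
    Module.injective_module_of_injective_object R Q (inj :=
      inferInstanceAs (CategoryTheory.Injective (CategoryTheory.Injective.under (ModuleCat.of R S₀))))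
  obtain ⟨J, hSJ, hJ, hJb⟩ := exists_essential_baer hQ (LinearMap.range i)
  have hfin : Module.Finite R S₀ := inferInstanceAs
    (Module.Finite R (∀ m : MaximalSpectrum R, R ⧸ m.asIdeal))
  refine ⟨J, inferInstance, inferInstance, ⟨(Submodule.fg_top J).2
    (fg_of_essential (LinearMap.range_eq_map i ▸ hfin.fg_top.map i) hJ)⟩, hJb, ?_⟩
  intro V _ _ v hv
  let e := LinearMap.toSpanSingleton R V v
  have hker : LinearMap.ker e ≠ ⊤ := fun h => hv <| by
    have : (1 : R) ∈ LinearMap.ker e := h ▸ Submodule.mem_top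
    simpa [e] using this
  obtain ⟨n, hn, hen⟩ := Ideal.exists_le_maximal _ hker
  let s₀ : S₀ := Pi.single (⟨n, hn⟩ : MaximalSpectrum R) 1
  have hs₀ : s₀ ≠ 0 := by
    have : Nontrivial (R ⧸ n) := Ideal.Quotient.nontrivial_iff.2 hn.ne_top
    intro h
    have := congrFun h ⟨n, hn⟩
    simp only [s₀, Pi.single_eq_same] at this
    exact one_ne_zero this
  have hns : ∀ r ∈ n, r • s₀ = 0 := fun r hr => by
    rw [← Pi.single_smul, Algebra.smul_def, mul_one]
    have : algebraMap R (R ⧸ n) r = 0 := Ideal.Quotient.eq_zero_iff_mem.2 hr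
    rw [this, Pi.single_zero]
  let s : J := ⟨i s₀, hSJ ⟨s₀, rfl⟩⟩
  have hs : s ≠ 0 := fun h => hs₀ (hi (by simpa [s] using congrArg Subtype.val h))
  have hle : LinearMap.ker e ≤ LinearMap.ker (LinearMap.toSpanSingleton R J s) := fun r hr => by
    rw [LinearMap.mem_ker, LinearMap.toSpanSingleton_apply]
    refine Subtype.ext ?_
    change r • i s₀ = 0
    rw [← map_smul, hns r (hen hr), map_zero]
  obtain ⟨β, hβ⟩ := hJb.extension_property ((LinearMap.ker e).liftQ e le_rfl)
    (LinearMap.ker_eq_bot.1 (Submodule.ker_liftQ_eq_bot _ _ _ le_rfl))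
    ((LinearMap.ker e).liftQ _ hle)
  refine ⟨β, ?_⟩
  have := LinearMap.congr_fun hβ (Submodule.Quotient.mk 1)
  simp only [LinearMap.comp_apply, Submodule.liftQ_apply, e, LinearMap.toSpanSingleton_apply,
    one_smul] at this
  rwa [this]

end Injective

end GabrielRoiter

namespace GabrielRoiter

section Coinduced

variable {R : Type u} [CommRing R] {J : Type u} [AddCommGroup J] [Module R J]

/-- A map into an injective module extends along every map with smaller kernel. -/
lemma exists_comp_eq_of_ker_le (hJ : Module.Baer R J) {A B : Type u} [AddCommGroup A]
    [AddCommGroup B] [Module R A] [Module R B] (T : A →ₗ[R] B) (ψ : A →ₗ[R] J)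
    (h : LinearMap.ker T ≤ LinearMap.ker ψ) : ∃ α : B →ₗ[R] J, ∀ a, α (T a) = ψ a := by
  obtain ⟨α, hα⟩ := hJ.extension_property ((LinearMap.ker T).liftQ T le_rfl)
    (LinearMap.ker_eq_bot.1 (Submodule.ker_liftQ_eq_bot _ _ _ le_rfl))
    ((LinearMap.ker T).liftQ ψ h)
  exact ⟨α, fun a => LinearMap.congr_fun hα (Submodule.Quotient.mk a)⟩

variable (R) in
/-- The `Λ`-module `Hom_R(Λ, J)` coinduced from an `R`-module `J`. -/
def Coinduced (Λ : Type u) [Ring Λ] [Algebra R Λ] (J : Type u) [AddCommGroup J] [Module R J] :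
    Type u := Λ →ₗ[R] J

variable {Λ : Type u} [Ring Λ] [Algebra R Λ]

instance : AddCommGroup (Coinduced R Λ J) := inferInstanceAs (AddCommGroup (Λ →ₗ[R] J))

instance : Module R (Coinduced R Λ J) := inferInstanceAs (Module R (Λ →ₗ[R] J))

instance : FunLike (Coinduced R Λ J) Λ J := inferInstanceAs (FunLike (Λ →ₗ[R] J) Λ J)

instance : LinearMapClass (Coinduced R Λ J) R Λ J :=
  inferInstanceAs (LinearMapClass (Λ →ₗ[R] J) R Λ J)

lemma Coinduced.ext {φ ψ : Coinduced R Λ J} (h : ∀ a, φ a = ψ a) : φ = ψ := DFunLike.ext _ _ h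

instance : SMul Λ (Coinduced R Λ J) where
  smul a φ := LinearMap.comp (show Λ →ₗ[R] J from φ) (LinearMap.mulRight R a)

lemma Coinduced.smul_apply (a : Λ) (φ : Coinduced R Λ J) (b : Λ) : (a • φ) b = φ (b * a) := rfl

lemma Coinduced.add_apply (φ ψ : Coinduced R Λ J) (b : Λ) : (φ + ψ) b = φ b + ψ b := rfl

lemma Coinduced.zero_apply (b : Λ) : (0 : Coinduced R Λ J) b = 0 := rfl

lemma Coinduced.rsmul_apply (r : R) (φ : Coinduced R Λ J) (b : Λ) : (r • φ) b = r • φ b := rfl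

instance : Module Λ (Coinduced R Λ J) where
  one_smul φ := Coinduced.ext fun a => by rw [Coinduced.smul_apply, mul_one]
  mul_smul a b φ := Coinduced.ext fun c => by simp only [Coinduced.smul_apply, mul_assoc]
  smul_zero a := rfl
  smul_add a φ ψ := rfl
  add_smul a b φ := Coinduced.ext fun c => by
    simp only [Coinduced.smul_apply, Coinduced.add_apply, mul_add, map_add]
  zero_smul φ := Coinduced.ext fun c => by
    rw [Coinduced.smul_apply, mul_zero, map_zero, Coinduced.zero_apply]

instance : IsScalarTower R Λ (Coinduced R Λ J) where
  smul_assoc r a φ := Coinduced.ext fun c => by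
    rw [Coinduced.smul_apply, Coinduced.rsmul_apply, Coinduced.smul_apply, mul_smul_comm, map_smul]

/-- The map into a coinduced module determined by an `R`-linear map. -/
def coinducedLift {Y : Type u} [AddCommGroup Y] [Module Λ Y] [Module R Y] [IsScalarTower R Λ Y]
    (α : Y →ₗ[R] J) : Y →ₗ[Λ] Coinduced R Λ J where
  toFun y := α ∘ₗ (LinearMap.toSpanSingleton Λ Y y).restrictScalars R
  map_add' y z := Coinduced.ext fun a => by
    change α (a • (y + z)) = α (a • y) + α (a • z)
    rw [smul_add, map_add]
  map_smul' b y := Coinduced.ext fun a => by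
    change α (a • b • y) = α ((a * b) • y)
    rw [mul_smul]

lemma coinducedLift_apply {Y : Type u} [AddCommGroup Y] [Module Λ Y] [Module R Y]
    [IsScalarTower R Λ Y] (α : Y →ₗ[R] J) (y : Y) (a : Λ) :
    coinducedLift (Λ := Λ) α y a = α (a • y) := rfl

instance [IsArtinianRing R] [Module.Finite R Λ] [Module.Finite R J] :
    Module.Finite Λ (Coinduced R Λ J) := by
  have : Module.Finite R (Coinduced R Λ J) := inferInstanceAs (Module.Finite R (Λ →ₗ[R] J))
  exact Module.Finite.of_restrictScalars_finite R Λ _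

end Coinduced

section AlmostSplit

variable {Λ : Type u} [Ring Λ]

/-- Fitting's lemma. -/
lemma bijective_or_isNilpotent {E : Type u} [AddCommGroup E] [Module Λ E] [IsArtinian Λ E]
    [IsNoetherian Λ E] (hE : IsIndecomposableModule Λ E) (h : E →ₗ[Λ] E) :
    Function.Bijective h ∨ IsNilpotent (h : Module.End Λ E) := by
  obtain ⟨n, hn⟩ := Filter.eventually_atTop.1 (LinearMap.eventually_isCompl_ker_pow_range_pow h)
  have hc := hn (n + 1) (Nat.le_succ n)
  rcases (indecomposable_iff.1 hE).2 _ _ hc with h0 | h0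
  · left
    have h1 : LinearMap.ker h = ⊥ := by
      rw [eq_bot_iff, ← h0]
      intro x hx
      rw [LinearMap.mem_ker, pow_succ, Module.End.mul_apply, LinearMap.mem_ker.1 hx, map_zero]
    exact ⟨LinearMap.ker_eq_bot.1 h1, IsArtinian.surjective_of_injective_endomorphism h
      (LinearMap.ker_eq_bot.1 h1)⟩
  · exact Or.inr ⟨n + 1, LinearMap.range_eq_bot.1 h0⟩

/-- The endomorphism ring of an indecomposable module of finite length is local. -/
lemma bijective_or_bijective_of_add {E : Type u} [AddCommGroup E] [Module Λ E] [IsArtinian Λ E]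
    [IsNoetherian Λ E] (hE : IsIndecomposableModule Λ E) (g h : E →ₗ[Λ] E)
    (hgh : Function.Bijective (g + h)) : Function.Bijective g ∨ Function.Bijective h := by
  let e := LinearEquiv.ofBijective (g + h) hgh
  have he : ∀ k : E →ₗ[Λ] E, Function.Bijective (e.symm.toLinearMap ∘ₗ k) →
      Function.Bijective k := fun k hk => by
    rw [LinearMap.coe_comp] at hk
    exact (Function.Bijective.of_comp_iff' e.symm.bijective k).1 hk
  rcases bijective_or_isNilpotent hE (e.symm.toLinearMap ∘ₗ g) with hg | hg
  · exact Or.inl (he g hg)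
  · right
    refine he h ?_
    have h1 : e.symm.toLinearMap ∘ₗ h = 1 - (e.symm.toLinearMap ∘ₗ g : Module.End Λ E) := by
      rw [eq_sub_iff_add_eq, ← LinearMap.comp_add]
      ext x
      change e.symm (h x + g x) = x
      rw [LinearEquiv.symm_apply_eq, add_comm]
      rfl
    rw [h1]
    exact (Module.End.isUnit_iff _).1 hg.isUnit_one_sub

/-- Every finitely presented module has generators and relations which describe the maps
out of it. -/
lemma exists_generators_relations [IsNoetherianRing Λ] (E : Type u) [AddCommGroup E] [Module Λ E]
    [Module.Finite Λ E] : ∃ (n m : ℕ) (x : Fin n → E) (s : Fin m → Fin n → Λ),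
      (∀ j, ∑ i, s j i • x i = 0) ∧
      (∀ h : E →ₗ[Λ] E, (∀ i, h (x i) = x i) → h = LinearMap.id) ∧
      ∀ (Y : Type u) [AddCommGroup Y] [Module Λ Y] (y : Fin n → Y), (∀ j, ∑ i, s j i • y i = 0) →
        ∃ h : E →ₗ[Λ] Y, ∀ i, h (x i) = y i := by
  obtain ⟨n, f, hf⟩ := Module.Finite.exists_fin' Λ E
  obtain ⟨m, s, hs⟩ := Submodule.fg_iff_exists_fin_generating_family.1
    (IsNoetherian.noetherian (LinearMap.ker f))
  have hfa : ∀ a : Fin n → Λ, f a = ∑ i, a i • f (Pi.single i 1) := fun a => by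
    have ha : a = ∑ i, a i • Pi.single i (1 : Λ) := by
      ext j
      simp [Finset.sum_apply, Pi.single_apply]
    conv_lhs => rw [ha]
    simp only [map_sum, map_smul]
  refine ⟨n, m, fun i => f (Pi.single i 1), s, fun j => ?_, fun h hh => ?_, fun Y _ _ y hy => ?_⟩
  · rw [← hfa]
    exact LinearMap.mem_ker.1 (hs ▸ Submodule.subset_span ⟨j, rfl⟩)
  · ext e
    obtain ⟨a, rfl⟩ := hf e
    rw [hfa, map_sum]
    simp [hh]
  · have hle : LinearMap.ker f ≤ LinearMap.ker (Fintype.linearCombination Λ y) := by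
      rw [← hs, Submodule.span_le]
      rintro _ ⟨j, rfl⟩
      simpa [Fintype.linearCombination_apply] using hy j
    refine ⟨(LinearMap.ker f).liftQ _ hle ∘ₗ (f.quotKerEquivOfSurjective hf).symm.toLinearMap,
      fun i => ?_⟩
    have : (f.quotKerEquivOfSurjective hf).symm (f (Pi.single i 1)) =
        Submodule.Quotient.mk (Pi.single i 1) := by
      rw [LinearEquiv.symm_apply_eq]
      rfl
    rw [LinearMap.comp_apply, LinearEquiv.coe_coe, this, Submodule.liftQ_apply]
    simp [Fintype.linearCombination_apply]

variable {R : Type u} [CommRing R] [IsArtinianRing R] [Algebra R Λ] [Module.Finite R Λ]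

/-- Existence of right almost split maps. -/
theorem exists_rightAlmostSplit {J : Type u} [AddCommGroup J] [Module R J] [Module.Finite R J]
    (hJ : Module.Baer R J)
    (hcog : ∀ (V : Type u) [AddCommGroup V] [Module R V] (v : V), v ≠ 0 → ∃ β : V →ₗ[R] J, β v ≠ 0)
    (E : Type u) [AddCommGroup E] [Module Λ E] [Module R E] [IsScalarTower R Λ E]
    [Module.Finite Λ E] (hE : IsIndecomposableModule Λ E) :
    ∃ (P : Type u) (_ : AddCommGroup P) (_ : Module Λ P) (π : P →ₗ[Λ] E), Module.Finite Λ P ∧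
      (∀ σ : E →ₗ[Λ] P, π ∘ₗ σ ≠ LinearMap.id) ∧
      ∀ (Y : Type u) [AddCommGroup Y] [Module Λ Y] [Module R Y] [IsScalarTower R Λ Y]
        (f : Y →ₗ[Λ] E), (∀ h : E →ₗ[Λ] Y, ¬ Function.Bijective (f ∘ₗ h)) →
        ∃ g : Y →ₗ[Λ] P, π ∘ₗ g = f := by
  classical
  have hΛa : IsArtinianRing Λ := IsArtinianRing.of_finite R Λ
  have hΛ : IsNoetherianRing Λ := IsNoetherianRing.of_finite R Λ
  have hEn : Nontrivial E := (indecomposable_iff.1 hE).1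
  obtain ⟨n, m, x, s, hsx, hx, hs⟩ := exists_generators_relations (Λ := Λ) E
  let N : Submodule R (Fin n → E) :=
    { carrier := {v | ∃ h : E →ₗ[Λ] E, ¬ Function.Bijective h ∧ ∀ i, h (x i) = v i}
      add_mem' := by
        rintro v w ⟨g, hg, hgv⟩ ⟨h, hh, hhw⟩
        refine ⟨g + h, fun hb => ?_, fun i => by simp [hgv, hhw]⟩
        exact (bijective_or_bijective_of_add hE g h hb).elim hg hh
      zero_mem' := ⟨0, fun hb => by
        obtain ⟨e, he⟩ := exists_ne (0 : E)
        exact he (hb.1 rfl), fun i => rfl⟩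
      smul_mem' := by
        rintro r v ⟨h, hh, hhv⟩
        refine ⟨r • h, fun hb => hh ?_, fun i => by simp [hhv]⟩
        exact (bijective_of_comp_bijective hE h (r • LinearMap.id) hb).1 }
  have hxN : x ∉ N := fun ⟨h, hh, hhx⟩ => hh (hx h hhx ▸ Function.bijective_id)
  obtain ⟨β', hβ'⟩ := hcog _ (N.mkQ x) (by simpa using hxN)
  let β : (Fin n → E) →ₗ[R] J := β' ∘ₗ N.mkQ
  have hβN : ∀ v ∈ N, β v = 0 := fun v hv => by
    simp [β, (Submodule.Quotient.mk_eq_zero N).2 hv]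
  let P : Submodule Λ (E × (Fin m → Coinduced R Λ J)) :=
    { carrier := {p | ∀ i a, β (Pi.single i (a • p.1)) = ∑ j, p.2 j (s j i * a)}
      add_mem' := fun {p q} hp hq i a => by
        simp only [Prod.fst_add, Prod.snd_add, smul_add, Pi.single_add, map_add, Pi.add_apply,
          Coinduced.add_apply, Finset.sum_add_distrib, hp i a, hq i a]
      zero_mem' := fun i a => by simp [Coinduced.zero_apply]
      smul_mem' := fun b p hp i a => by
        simp only [Prod.smul_fst, Prod.smul_snd, Pi.smul_apply, Coinduced.smul_apply, mul_assoc,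
          ← mul_smul, hp i (a * b)] }
  refine ⟨P, inferInstance, inferInstance, LinearMap.fst Λ _ _ ∘ₗ P.subtype, inferInstance,
    fun σ hσ => hβ' ?_, fun Y _ _ _ _ f hf => ?_⟩
  · change β x = 0
    have h1 : ∀ e, (σ e : E × (Fin m → Coinduced R Λ J)).1 = e := fun e =>
      LinearMap.congr_fun hσ e
    have h2 : ∀ i e, β (Pi.single i e) =
        ∑ j, (s j i • σ e : E × (Fin m → Coinduced R Λ J)).2 j 1 := fun i e => by
      have := (σ e).2 i 1
      simpa [h1, Coinduced.smul_apply] using this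
    rw [← Finset.univ_sum_single x, map_sum]
    simp only [h2]
    rw [Finset.sum_comm]
    refine Finset.sum_eq_zero fun j _ => ?_
    have h3 : ∑ i, s j i • σ (x i) = 0 := by simp only [← map_smul, ← map_sum, hsx, map_zero]
    have h4 := congrArg (fun p : P => (p : E × (Fin m → Coinduced R Λ J)).2 j 1) h3
    let ev : P →+ J :=
      { toFun := fun p => (p : E × (Fin m → Coinduced R Λ J)).2 j 1
        map_zero' := rfl
        map_add' := fun _ _ => rfl }
    change ev (∑ i, s j i • σ (x i)) = ev 0 at h4
    rw [map_sum, map_zero] at h4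
    exact h4
  · let T : (Fin n → Y) →ₗ[R] (Fin m → Y) :=
      LinearMap.pi fun j => ∑ i, Algebra.lsmul R R Y (s j i) ∘ₗ LinearMap.proj i
    have hT : ∀ y j, T y j = ∑ i, s j i • y i := fun y j => by
      simp [T, LinearMap.sum_apply]
    obtain ⟨α, hα⟩ := exists_comp_eq_of_ker_le hJ T
      (β ∘ₗ (f.restrictScalars R).compLeft (Fin n)) fun y hy => by
        obtain ⟨h, hh⟩ := hs Y y fun j => by rw [← hT, LinearMap.mem_ker.1 hy, Pi.zero_apply]
        refine hβN _ ⟨f ∘ₗ h, hf h, fun i => ?_⟩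
        simp [hh]
    have hβf : ∀ y, β (fun i => f (y i)) = α (T y) := fun y => (hα y).symm
    refine ⟨LinearMap.codRestrict P (LinearMap.prod f (LinearMap.pi fun j =>
      coinducedLift (Λ := Λ) (α ∘ₗ LinearMap.single R (fun _ => Y) j))) fun y i a => ?_, ?_⟩
    · change β (Pi.single i (a • f y)) = ∑ j, α (Pi.single j ((s j i * a) • y))
      have h1 : (Pi.single i (a • f y) : Fin n → E) =
          fun k => f ((Pi.single i (a • y) : Fin n → Y) k) := by
        ext k
        by_cases hk : k = i
        · subst hk
          simp
        · simp [hk]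
      rw [h1, hβf, ← map_sum]
      congr 1
      rw [Finset.univ_sum_single (fun j => (s j i * a) • y)]
      ext j
      rw [hT, Finset.sum_eq_single i (fun k _ hk => by simp [hk]) (by simp), Pi.single_eq_same,
        mul_smul]
    · ext y
      rfl

end AlmostSplit

end GabrielRoiter

namespace GabrielRoiter

section HaradaSai

variable {Λ : Type u} [Ring Λ]

lemma eq_of_le_of_mlen_le {M : Type u} [AddCommGroup M] [Module Λ M] [IsArtinian Λ M]
    [IsNoetherian Λ M] {A B : Submodule Λ M} (h : A ≤ B) (hm : mlen Λ B ≤ mlen Λ A) : A = B := by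
  refine h.antisymm (Submodule.submoduleOf_eq_top.1 ?_)
  by_contra hne
  have h1 := mlen_submodule_lt hne
  have h2 := mlen_congr (Submodule.submoduleOfEquivOfLe h)
  omega

/-- If the image of a nonzero composite through an indecomposable module has maximal length,
then the first map is surjective and the second one is injective. -/
lemma surjective_and_injective_of_mlen_range_le {X Y Z : Type u} [AddCommGroup X] [Module Λ X]
    [AddCommGroup Y] [Module Λ Y] [AddCommGroup Z] [Module Λ Z] [IsArtinian Λ Y]
    [IsNoetherian Λ Y] [IsArtinian Λ Z] [IsNoetherian Λ Z] (hY : IsIndecomposableModule Λ Y)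
    (f : X →ₗ[Λ] Y) (g : Y →ₗ[Λ] Z) (h0 : g ∘ₗ f ≠ 0)
    (hf : mlen Λ (LinearMap.range f) ≤ mlen Λ (LinearMap.range (g ∘ₗ f)))
    (hg : mlen Λ (LinearMap.range g) ≤ mlen Λ (LinearMap.range (g ∘ₗ f))) :
    Function.Surjective f ∧ Function.Injective g := by
  have hrange : LinearMap.range (g ∘ₗ f) = LinearMap.range g :=
    eq_of_le_of_mlen_le (LinearMap.range_comp_le_range f g) hg
  have hc : IsCompl (LinearMap.range f) (LinearMap.ker g) := by
    constructor
    · let g' : LinearMap.range f →ₗ[Λ] LinearMap.range (g ∘ₗ f) :=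
        LinearMap.codRestrict _ (g ∘ₗ (LinearMap.range f).subtype) fun y => by
          obtain ⟨x, hx⟩ := y.2
          exact ⟨x, by simp [hx]⟩
      have hg' : Function.Bijective g' := bijective_of_surjective_of_mlen_le g' (by
        rintro ⟨_, x, rfl⟩
        exact ⟨⟨f x, x, rfl⟩, rfl⟩) hf
      rw [Submodule.disjoint_def]
      intro y hy hyg
      have : (⟨y, hy⟩ : LinearMap.range f) = 0 := hg'.1 (Subtype.ext (by simpa [g'] using hyg))
      exact congrArg Subtype.val this
    · rw [codisjoint_iff, eq_top_iff]
      intro y _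
      obtain ⟨x, hx⟩ : g y ∈ LinearMap.range (g ∘ₗ f) := hrange ▸ ⟨y, rfl⟩
      refine Submodule.mem_sup.2 ⟨f x, ⟨x, rfl⟩, y - f x, ?_, by abel⟩
      rw [LinearMap.mem_ker, map_sub, ← hx, LinearMap.comp_apply, sub_self]
  rcases (indecomposable_iff.1 hY).2 _ _ hc with h | h
  · exact absurd (by rw [LinearMap.range_eq_bot.1 h, LinearMap.comp_zero]) h0
  · rw [h] at hc
    exact ⟨LinearMap.range_eq_top.1 (by simpa using hc.sup_eq_top), LinearMap.ker_eq_bot.1 h⟩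

variable {ι : Type*} (E : ι → BundledMod Λ)

/-- `w` is a map following a composite of `k` non-isomorphisms between members of the
family `E`. -/
def NonIsoComp : ℕ → ∀ i j, ((E i).carrier →ₗ[Λ] (E j).carrier) → Prop
  | 0, _, _, _ => True
  | k + 1, i, j, w => ∃ (l : ι) (w' : (E l).carrier →ₗ[Λ] (E j).carrier)
      (h : (E i).carrier →ₗ[Λ] (E l).carrier),
      NonIsoComp k l j w' ∧ ¬ Function.Bijective h ∧ w = w' ∘ₗ h

lemma NonIsoComp.exists_eq_comp (n : ℕ) : ∀ (m : ℕ) {i j : ι}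
    {w : (E i).carrier →ₗ[Λ] (E j).carrier}, NonIsoComp E (m + n) i j w →
    ∃ (l : ι) (f : (E i).carrier →ₗ[Λ] (E l).carrier) (g : (E l).carrier →ₗ[Λ] (E j).carrier),
      NonIsoComp E m i l f ∧ NonIsoComp E n l j g ∧ w = g ∘ₗ f
  | 0, i, j, w, hw => ⟨i, LinearMap.id, w, trivial, by simpa using hw, rfl⟩
  | m + 1, i, j, w, hw => by
    rw [Nat.add_right_comm] at hw
    obtain ⟨l, w', h, hw', hh, rfl⟩ := hw
    obtain ⟨l', f, g, hf, hg, rfl⟩ := NonIsoComp.exists_eq_comp n m hw'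
    exact ⟨l', f ∘ₗ h, g, ⟨l, f, h, hf, hh, rfl⟩, hg, rfl⟩

variable {E} [∀ i, IsArtinian Λ (E i).carrier] [∀ i, IsNoetherian Λ (E i).carrier]

/-- The Harada–Sai lemma. -/
lemma mlen_range_add_le (hE : ∀ i, IsIndecomposableModule Λ (E i).carrier) {b : ℕ}
    (hb : ∀ i, mlen Λ (E i).carrier ≤ b) (m : ℕ) : ∀ {i j : ι}
    {w : (E i).carrier →ₗ[Λ] (E j).carrier}, NonIsoComp E (2 ^ m - 1) i j w → w ≠ 0 →
    mlen Λ (LinearMap.range w) + m ≤ b := by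
  induction m with
  | zero => exact fun {i j w} _ _ => (mlen_submodule_le _).trans (hb j)
  | succ m ih =>
    intro i j w hw hw0
    have hpow : 2 ^ (m + 1) - 1 = (2 ^ m - 1) + ((2 ^ m - 1) + 1) := by
      have := Nat.one_le_two_pow (n := m)
      omega
    rw [hpow] at hw
    obtain ⟨k, f, g', hf, ⟨l, g, h, hg, hh, rfl⟩, rfl⟩ := hw.exists_eq_comp
    by_contra! hlt
    have hf' := ih hf (by rintro rfl; exact hw0 (LinearMap.comp_zero _))
    have hg' := ih hg (by rintro rfl; exact hw0 (by simp))
    have h1 : mlen Λ (LinearMap.range (g ∘ₗ h)) ≤ mlen Λ (LinearMap.range g) :=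
      mlen_le_of_injective (Submodule.inclusion (LinearMap.range_comp_le_range h g))
        (Submodule.inclusion_injective _)
    have h2 : mlen Λ (LinearMap.range (h ∘ₗ f)) ≤ mlen Λ (LinearMap.range f) := by
      refine mlen_le_of_surjective (LinearMap.codRestrict (LinearMap.range (h ∘ₗ f))
        (h ∘ₗ (LinearMap.range f).subtype) fun y => ?_) ?_
      · obtain ⟨x, hx⟩ := y.2
        exact ⟨x, by simp [hx]⟩
      · rintro ⟨_, x, rfl⟩
        exact ⟨⟨f x, x, rfl⟩, rfl⟩
    have h3 := surjective_and_injective_of_mlen_range_le (hE k) f (g ∘ₗ h) hw0 (by omega)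
      (by omega)
    have h4 := surjective_and_injective_of_mlen_range_le (hE l) (h ∘ₗ f) g hw0
      (by rw [← LinearMap.comp_assoc]; omega) (by rw [← LinearMap.comp_assoc]; omega)
    refine hh ⟨Function.Injective.of_comp (f := g) ?_, Function.Surjective.of_comp (g := f) ?_⟩
    · exact h3.2
    · exact h4.1

/-- Long composites of non-isomorphisms between indecomposables of bounded length vanish. -/
lemma exists_nonIsoComp_eq_zero [Finite ι] (hE : ∀ i, IsIndecomposableModule Λ (E i).carrier) :
    ∃ n, ∀ {i j : ι} {w : (E i).carrier →ₗ[Λ] (E j).carrier}, NonIsoComp E n i j w → w = 0 := by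
  obtain ⟨b, hb⟩ := (Set.finite_range fun i => mlen Λ (E i).carrier).bddAbove
  refine ⟨2 ^ (b + 1) - 1, fun {i j w} hw => ?_⟩
  by_contra h
  have := mlen_range_add_le hE (fun i => hb ⟨i, rfl⟩) (b + 1) hw h
  omega

end HaradaSai

end GabrielRoiter

namespace GabrielRoiter

section Cocover

variable {Λ : Type u} [Ring Λ]

/-- `M` is a finitely generated indecomposable module. -/
def IsFGIndec (Λ : Type u) [Ring Λ] (M : Type u) [AddCommGroup M] [Module Λ M] : Prop :=
  Module.Finite Λ M ∧ IsIndecomposableModule Λ M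

/-- There are finitely many indecomposable modules which cogenerate all modules. -/
lemma exists_finite_cogenerating_family (R : Type u) [CommRing R] [IsArtinianRing R] [Algebra R Λ]
    [Module.Finite R Λ] :
    ∃ (κ : Type) (_ : Finite κ) (D : κ → BundledMod Λ), (∀ k, IsFGIndec Λ (D k).carrier) ∧
      ∀ (Y : Type u) [AddCommGroup Y] [Module Λ Y] (y : Y), y ≠ 0 →
        ∃ (k : κ) (g : Y →ₗ[Λ] (D k).carrier), g y ≠ 0 := by
  obtain ⟨J, _, _, _, -, hcog⟩ := exists_finite_injective_cogenerator R
  have : IsArtinianRing Λ := IsArtinianRing.of_finite R Λ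
  have : IsNoetherianRing Λ := IsNoetherianRing.of_finite R Λ
  obtain ⟨κ, _, D, a, p, hD, hpa, hap⟩ := exists_decomposition (Λ := Λ) (Coinduced R Λ J)
  refine ⟨κ, inferInstance, D, fun k => ⟨Module.Finite.of_surjective (p k)
    (Function.LeftInverse.surjective (hpa k)), hD k⟩, fun Y _ _ y hy => ?_⟩
  let _ : Module R Y := Module.compHom Y (algebraMap R Λ)
  have : IsScalarTower R Λ Y := IsScalarTower.of_algebraMap_smul fun _ _ => rfl
  obtain ⟨α, hα⟩ := hcog Y y hy
  by_contra! h
  have h0 : coinducedLift (Λ := Λ) α y = 0 := by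
    rw [← hap (coinducedLift α y)]
    refine Finset.sum_eq_zero fun k _ => ?_
    have := h k (p k ∘ₗ coinducedLift α)
    rw [LinearMap.comp_apply] at this
    rw [this, map_zero]
  have h1 := coinducedLift_apply (Λ := Λ) α y 1
  rw [h0, one_smul, Coinduced.zero_apply] at h1
  exact hα h1.symm

/-- Existence of sink maps, phrased in terms of indecomposable modules. -/
lemma exists_finite_sink_family (R : Type u) [CommRing R] [IsArtinianRing R] [Algebra R Λ]
    [Module.Finite R Λ] (E : Type u) [AddCommGroup E] [Module Λ E]
    (hE : IsFGIndec Λ E) :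
    ∃ (κ : Type) (_ : Fintype κ) (Q : κ → BundledMod Λ) (q : ∀ k, (Q k).carrier →ₗ[Λ] E),
      (∀ k, IsFGIndec Λ (Q k).carrier) ∧ (∀ k, ¬ Function.Bijective (q k)) ∧
      ∀ (Y : Type u) [AddCommGroup Y] [Module Λ Y], IsFGIndec Λ Y → ¬ Nonempty (Y ≃ₗ[Λ] E) →
        ∀ f : Y →ₗ[Λ] E, ∃ g : ∀ k, Y →ₗ[Λ] (Q k).carrier, ∀ y, f y = ∑ k, q k (g k y) := by
  obtain ⟨J, _, _, _, hJ, hcog⟩ := exists_finite_injective_cogenerator R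
  have : IsArtinianRing Λ := IsArtinianRing.of_finite R Λ
  have : IsNoetherianRing Λ := IsNoetherianRing.of_finite R Λ
  let _ : Module R E := Module.compHom E (algebraMap R Λ)
  have : IsScalarTower R Λ E := IsScalarTower.of_algebraMap_smul fun _ _ => rfl
  have := hE.1
  have : Nontrivial E := (indecomposable_iff.1 hE.2).1
  obtain ⟨P, _, _, π, _, hπ, hfac⟩ := exists_rightAlmostSplit (Λ := Λ) hJ hcog E hE.2
  obtain ⟨κ, _, Q, a, p, hQ, hpa, hap⟩ := exists_decomposition (Λ := Λ) P
  refine ⟨κ, inferInstance, Q, fun k => π ∘ₗ a k, fun k => ⟨Module.Finite.of_surjective (p k)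
    (Function.LeftInverse.surjective (hpa k)), hQ k⟩, fun k hk => ?_, fun Y _ _ hY hYE f => ?_⟩
  · let e := LinearEquiv.ofBijective _ hk
    refine hπ (a k ∘ₗ e.symm.toLinearMap) ?_
    ext x
    exact e.apply_symm_apply x
  · let _ : Module R Y := Module.compHom Y (algebraMap R Λ)
    have : IsScalarTower R Λ Y := IsScalarTower.of_algebraMap_smul fun _ _ => rfl
    obtain ⟨g, rfl⟩ := hfac Y f fun h hb => hYE
      ⟨LinearEquiv.ofBijective f (bijective_of_comp_bijective hY.2 h f hb).2⟩
    refine ⟨fun k => p k ∘ₗ g, fun y => ?_⟩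
    simp only [LinearMap.comp_apply, ← map_sum, hap]

/-- If finitely many indecomposable modules are excluded, then finitely many of the remaining
indecomposable modules cogenerate all the remaining ones. -/
theorem exists_finite_cocover (R : Type u) [CommRing R] [IsArtinianRing R] [Algebra R Λ]
    [Module.Finite R Λ] {ι : Type} [Finite ι] (E : ι → BundledMod Λ)
    (hE : ∀ i, IsFGIndec Λ (E i).carrier) :
    ∃ (τ : Type) (_ : Finite τ) (N : τ → BundledMod Λ), (∀ t, IsFGIndec Λ (N t).carrier) ∧
      (∀ t i, ¬ Nonempty ((N t).carrier ≃ₗ[Λ] (E i).carrier)) ∧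
      ∀ (Y : Type u) [AddCommGroup Y] [Module Λ Y], IsFGIndec Λ Y →
        (∀ i, ¬ Nonempty (Y ≃ₗ[Λ] (E i).carrier)) → ∀ y : Y, y ≠ 0 →
        ∃ (t : τ) (v : Y →ₗ[Λ] (N t).carrier), v y ≠ 0 := by
  have : IsArtinianRing Λ := IsArtinianRing.of_finite R Λ
  have : IsNoetherianRing Λ := IsNoetherianRing.of_finite R Λ
  have : ∀ i, Module.Finite Λ (E i).carrier := fun i => (hE i).1
  obtain ⟨κ, _, D, hD, hcog⟩ := exists_finite_cogenerating_family (Λ := Λ) R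
  choose σ _ Q q hQ hq hfac using fun i => exists_finite_sink_family R (E i).carrier (hE i)
  obtain ⟨B, hB⟩ := exists_nonIsoComp_eq_zero fun i => (hE i).2
  let M : κ ⊕ (Σ i, σ i) → BundledMod Λ := Sum.elim D fun s => Q s.1 s.2
  have hM : ∀ t, IsFGIndec Λ (M t).carrier := by
    rintro (k | s)
    · exact hD k
    · exact hQ s.1 s.2
  refine ⟨{t // ∀ i, ¬ Nonempty ((M t).carrier ≃ₗ[Λ] (E i).carrier)}, inferInstance,
    fun t => M t.1, fun t => hM t.1, fun t => t.2, fun Y _ _ hY hYE y hy => ?_⟩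
  by_contra! hvan
  have key : ∀ n k, k + n = B → ∀ {i j : ι} (w : (E i).carrier →ₗ[Λ] (E j).carrier),
      NonIsoComp E k i j w → ∀ f : Y →ₗ[Λ] (E i).carrier, w (f y) = 0 := by
    intro n
    induction n with
    | zero =>
      rintro k rfl i j w hw f
      rw [hB hw, LinearMap.zero_apply]
    | succ n ih =>
      intro k hk i j w hw f
      obtain ⟨g, hg⟩ := hfac i Y hY (hYE i) f
      rw [hg, map_sum]
      refine Finset.sum_eq_zero fun s _ => ?_
      by_cases hs : ∀ l, ¬ Nonempty ((Q i s).carrier ≃ₗ[Λ] (E l).carrier)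
      · have : g s y = 0 := hvan ⟨Sum.inr ⟨i, s⟩, hs⟩ (g s)
        rw [this, map_zero, map_zero]
      · push Not at hs
        obtain ⟨l, ⟨e⟩⟩ := hs
        have := ih (k + 1) (by omega) (w ∘ₗ q i s ∘ₗ e.symm.toLinearMap)
          ⟨i, w, q i s ∘ₗ e.symm.toLinearMap, hw, fun hb => hq i s ?_, rfl⟩
          (e.toLinearMap ∘ₗ g s)
        · simpa using this
        · exact (Function.Bijective.of_comp_iff (q i s) e.symm.bijective).1 hb
  obtain ⟨k, g, hg⟩ := hcog Y y hy
  by_cases hk : ∀ l, ¬ Nonempty ((D k).carrier ≃ₗ[Λ] (E l).carrier)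
  · exact hg (hvan ⟨Sum.inl k, hk⟩ g)
  · push Not at hk
    obtain ⟨l, ⟨e⟩⟩ := hk
    have := key B 0 (zero_add B) LinearMap.id trivial (e.toLinearMap ∘ₗ g)
    exact hg (by simpa using this)

end Cocover

end GabrielRoiter

namespace GabrielRoiter

section Landing

variable {Λ : Type u} [Ring Λ]

/-- `S` contains the measures of only finitely many finitely generated indecomposable modules
up to isomorphism. -/
def IsOfFiniteType (Λ : Type u) [Ring Λ] (S : Set (Set ℕ)) : Prop :=
  ∃ (ι : Type) (_ : Finite ι) (E : ι → BundledMod Λ), (∀ i, IsFGIndec Λ (E i).carrier) ∧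
    (∀ i, grMeasure Λ (E i).carrier ∈ S) ∧
    ∀ (M : Type u) [AddCommGroup M] [Module Λ M], IsFGIndec Λ M → grMeasure Λ M ∈ S →
      ∃ i, Nonempty (M ≃ₗ[Λ] (E i).carrier)

lemma isOfFiniteType_empty : IsOfFiniteType Λ ∅ :=
  ⟨Empty, inferInstance, Empty.elim, fun i => i.elim, fun i => i.elim, fun _ _ _ _ h => h.elim⟩

lemma exists_isFGIndec_of_not_hasFiniteRepType (hinf : ¬ HasFiniteRepType Λ) {ι : Type} [Finite ι]
    (E : ι → BundledMod Λ) : ∃ (M : Type u) (_ : AddCommGroup M) (_ : Module Λ M),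
      IsFGIndec Λ M ∧ ∀ i, ¬ Nonempty (M ≃ₗ[Λ] (E i).carrier) := by
  by_contra! h
  obtain ⟨n, ⟨e⟩⟩ := Finite.exists_equiv_fin ι
  refine hinf ⟨n, fun i => E (e.symm i), fun M _ _ hM hM' => ?_⟩
  obtain ⟨i, hi⟩ := h M inferInstance inferInstance ⟨hM, hM'⟩
  obtain ⟨k, rfl⟩ := e.symm.surjective i
  exact ⟨k, hi⟩

/-- If only finitely many indecomposable modules have their measure in `S`, then there is a
maximal measure outside of `S`, and it is attained by finitely many indecomposable modules. -/
lemma IsOfFiniteType.exists_max (R : Type u) [CommRing R] [IsArtinianRing R] [Algebra R Λ]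
    [Module.Finite R Λ] (hinf : ¬ HasFiniteRepType Λ) {S : Set (Set ℕ)} (hS : IsOfFiniteType Λ S) :
    ∃ I, IsGRMeasureOf Λ I ∧ I ∉ S ∧ (∀ J, IsGRMeasureOf Λ J → J ∉ S → GRle J I) ∧
      IsOfFiniteType Λ (insert I S) := by
  have : IsArtinianRing Λ := IsArtinianRing.of_finite R Λ
  have : IsNoetherianRing Λ := IsNoetherianRing.of_finite R Λ
  obtain ⟨ι, _, E, hE, hES, hSE⟩ := hS
  obtain ⟨τ, _, N, hN, hNE, hcov⟩ := exists_finite_cocover R E hE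
  have : ∀ t, Module.Finite Λ (N t).carrier := fun t => (hN t).1
  obtain ⟨M, _, _, hM, hME⟩ := exists_isFGIndec_of_not_hasFiniteRepType hinf E
  have : Nonempty τ := by
    have : Nontrivial M := (indecomposable_iff.1 hM.2).1
    obtain ⟨y, hy⟩ := exists_ne (0 : M)
    obtain ⟨t, -⟩ := hcov M hM hME y hy
    exact ⟨t⟩
  obtain ⟨_, ⟨t₀, rfl⟩, hmax⟩ := exists_grle_max (Set.finite_range fun t => grMeasure Λ (N t).carrier)
    (Set.range_nonempty _)
  have hle : ∀ (Y : Type u) [AddCommGroup Y] [Module Λ Y], IsFGIndec Λ Y → grMeasure Λ Y ∉ S →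
      ∃ t, GRlt (grMeasure Λ Y) (grMeasure Λ (N t).carrier) ∨
        Nonempty (Y ≃ₗ[Λ] (N t).carrier) := fun Y _ _ hY hYS => by
    have := hY.1
    obtain ⟨s, hs⟩ := exists_grlt_or_bijective Y hY.2
      (fun s : Σ t, (Y →ₗ[Λ] (N t).carrier) => N s.1) (fun s => (hN s.1).2) (fun s => s.2)
      (fun y hy => by
        by_contra hy0
        obtain ⟨t, v, hv⟩ := hcov Y hY (fun i ⟨e⟩ => hYS (grMeasure_congr hY.2 e ▸ hES i)) y hy0
        exact hv (hy ⟨t, v⟩))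
    exact ⟨s.1, hs.imp_right fun h => ⟨LinearEquiv.ofBijective s.2 h⟩⟩
  refine ⟨_, ⟨(N t₀).carrier, inferInstance, inferInstance, (hN t₀).1, (hN t₀).2, rfl⟩,
    fun h => ?_, ?_, ι ⊕ {t // grMeasure Λ (N t).carrier = grMeasure Λ (N t₀).carrier},
    inferInstance, Sum.elim E fun t => N t.1, ?_, ?_, fun Y _ _ hY hYS => ?_⟩
  · obtain ⟨i, hi⟩ := hSE _ (hN t₀) h
    exact hNE t₀ i hi
  · rintro _ ⟨Y, _, _, hY, hY', rfl⟩ hYS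
    obtain ⟨t, ht⟩ := hle Y ⟨hY, hY'⟩ hYS
    refine GRle.trans ?_ (hmax _ ⟨t, rfl⟩)
    exact ht.elim Or.inr fun ⟨e⟩ => Or.inl (grMeasure_congr hY' e)
  · rintro (i | t)
    exacts [hE i, hN t.1]
  · rintro (i | t)
    exacts [Or.inr (hES i), Or.inl t.2]
  · by_cases hS : grMeasure Λ Y ∈ S
    · obtain ⟨i, hi⟩ := hSE Y hY hS
      exact ⟨Sum.inl i, hi⟩
    · have hI := hYS.resolve_right hS
      obtain ⟨t, ht | ⟨⟨e⟩⟩⟩ := hle Y hY hS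
      · rw [hI] at ht
        exact absurd ht (hmax _ ⟨t, rfl⟩).not_grlt
      · have := hY.1
        exact ⟨Sum.inr ⟨t, (grMeasure_congr hY.2 e).symm.trans hI⟩, ⟨e⟩⟩

/-- The landing measures form a strictly decreasing sequence. -/
theorem exists_landing_sequence (R : Type u) [CommRing R] [IsArtinianRing R] [Algebra R Λ]
    [Module.Finite R Λ] (hinf : ¬ HasFiniteRepType Λ) :
    ∃ f : ℕ → Set ℕ, (∀ n, IsGRMeasureOf Λ (f n)) ∧ (∀ m n, m < n → GRlt (f n) (f m)) ∧
      (∀ n J, IsGRMeasureOf Λ J → GRlt (f n) J → ∃ m < n, f m = J) ∧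
      ∀ J, IsGRMeasureOf Λ J → (∃ n, f n = J) ∨ ∀ n, GRlt J (f n) := by
  choose I hI hIS hmax hins using fun S : {S // IsOfFiniteType Λ S} => S.2.exists_max R hinf
  let T : ℕ → {S // IsOfFiniteType Λ S} :=
    fun n => n.rec ⟨∅, isOfFiniteType_empty⟩ fun _ S => ⟨insert (I S) S.1, hins S⟩
  have hT : ∀ n J, J ∈ (T n).1 ↔ ∃ m < n, I (T m) = J := fun n => by
    induction n with
    | zero => exact fun J => ⟨fun h => h.elim, fun ⟨m, hm, _⟩ => absurd hm m.not_lt_zero⟩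
    | succ n ih =>
      intro J
      change J ∈ insert (I (T n)) (T n).1 ↔ _
      rw [Set.mem_insert_iff, ih]
      constructor
      · rintro (rfl | ⟨m, hm, rfl⟩)
        exacts [⟨n, n.lt_succ_self, rfl⟩, ⟨m, hm.trans n.lt_succ_self, rfl⟩]
      · rintro ⟨m, hm, rfl⟩
        rcases (Nat.lt_succ_iff_lt_or_eq.1 hm) with h | rfl
        exacts [Or.inr ⟨m, h, rfl⟩, Or.inl rfl]
  refine ⟨fun n => I (T n), fun n => hI _, fun m n hmn => ?_, fun n J hJ hlt => ?_, fun J hJ => ?_⟩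
  · have h1 : I (T n) ∉ (T m).1 := fun h => by
      obtain ⟨k, hk, hk'⟩ := (hT _ _).1 h
      exact hIS (T n) ((hT _ _).2 ⟨k, hk.trans hmn, hk'⟩)
    refine (hmax _ _ (hI _) h1).resolve_left fun h => hIS (T n) ((hT _ _).2 ⟨m, hmn, h.symm⟩)
  · rw [← hT]
    by_contra h
    exact (hmax _ _ hJ h).not_grlt hlt
  · refine or_iff_not_imp_left.2 fun h n => ?_
    have h1 : J ∉ (T n).1 := fun h' => h (((hT _ _).1 h').imp fun _ hm => hm.2)
    exact (hmax _ _ hJ h1).resolve_left fun h' => h ⟨n, h'.symm⟩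

end Landing

end GabrielRoiter

/-- Let `Λ` be a representation-infinite artin algebra.  The set `L` of
landing GR measures for `Λ` (GR measures `I` such that only finitely many GR
measures `J` satisfy `I ≺ J`) is nonempty, closed under direct successors and
direct predecessors (hence a GR segment), infinite, and `(L, ≺)` is
order-isomorphic to the order dual of `(ℕ, <)`: the landing part is a
`(-ℕ)`-indexed GR segment. -/
theorem landing_segment_negN_indexed (R : Type*) [CommRing R] [IsArtinianRing R]
    (Λ : Type u) [Ring Λ] [Algebra R Λ] [Module.Finite R Λ]
    (hinf : ¬ HasFiniteRepType Λ) :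
    letI L : Set (Set ℕ) :=
      {I | IsGRMeasureOf Λ I ∧ {J | IsGRMeasureOf Λ J ∧ GRlt I J}.Finite}
    L.Nonempty ∧
    (∀ I ∈ L, ∀ J, (IsDirectSuccessor Λ I J ∨ IsDirectSuccessor Λ J I) → J ∈ L) ∧
    L.Infinite ∧
    ∃ f : ℕ → Set ℕ, (∀ n, f n ∈ L) ∧ (∀ I ∈ L, ∃! n, f n = I) ∧
      ∀ m n, m < n → GRlt (f n) (f m) := by

  have := IsNoetherianRing.of_finite R Λ
  let _ : Algebra (Subalgebra.center R Λ) Λ := (Subalgebra.center R Λ).subtype.toAlgebra'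
    fun c x => (Subalgebra.mem_center_iff.1 c.2 x).symm
  have : @IsScalarTower R (Subalgebra.center R Λ) Λ _ Algebra.toSMul _ :=
    IsScalarTower.of_algebraMap_eq fun _ => rfl
  have : Module.Finite R (Subalgebra.center R Λ) :=
    Module.Finite.of_injective (Subalgebra.center R Λ).val.toLinearMap Subtype.val_injective
  have : IsArtinianRing (Subalgebra.center R Λ) := IsArtinianRing.of_finite R _
  have : @Module.Finite (Subalgebra.center R Λ) Λ _ _ Algebra.toModule :=
    Module.Finite.of_restrictScalars_finite R _ _
  obtain ⟨f, hf, hanti, habove, hrange⟩ :=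
    GabrielRoiter.exists_landing_sequence (Subalgebra.center R Λ) hinf
  have hinj : Function.Injective f := fun m n hmn => by
    rcases lt_trichotomy m n with h | h | h
    · exact ((hmn ▸ hanti m n h : GRlt (f m) (f m))).irrefl.elim
    · exact h
    · exact ((hmn ▸ hanti n m h : GRlt (f n) (f n))).irrefl.elim
  have hL : ∀ n, {J | IsGRMeasureOf Λ J ∧ GRlt (f n) J}.Finite := fun n =>
    ((Set.finite_Iio n).image f).subset fun J hJ => habove n J hJ.1 hJ.2
  refine ⟨⟨f 0, hf 0, hL 0⟩, ?_, ?_, f, fun n => ⟨hf n, hL n⟩, fun I hI => ?_, hanti⟩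
  · rintro I ⟨-, hI⟩ J (⟨-, hJ, hIJ, -⟩ | ⟨hJ, -, -, hno⟩)
    · exact ⟨hJ, hI.subset fun K hK => ⟨hK.1, hIJ.trans hK.2⟩⟩
    · refine ⟨hJ, (hI.insert I).subset fun K hK => ?_⟩
      rcases GabrielRoiter.grlt_or_eq_or_grlt K I with h | h | h
      · exact absurd ⟨K, hK.1, hK.2, h⟩ hno
      · exact Or.inl h
      · exact Or.inr ⟨hK.1, h⟩
  · exact (Set.infinite_range_of_injective hinj).mono
      (Set.range_subset_iff.2 fun n => ⟨hf n, hL n⟩)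
  · obtain ⟨n, hn⟩ | h := hrange I hI.1
    · exact ⟨n, hn, fun m hm => hinj (hm.trans hn.symm)⟩
    · exact absurd (hI.2.subset (Set.range_subset_iff.2 fun n => ⟨hf n, h n⟩))
        (Set.infinite_range_of_injective hinj)
end
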